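/- Let k be an integral domain of characteristic 0, n an even positive integer, X the generic n×n matrix over k[x_{ij}], and adj(X) its adjugate. If adj(X) = Y·Z where Y, Z are n×n matrices over k[x_{ij}], neither of which is invertible over k[x_{ij}], then det(Y) is associated in k[x_{ij}] either to det(X) or to det(X)^{n−2}. -/

import Mathlib

namespace AdjFac

/-- A grading of a ring by `ℤ`, given by component maps. -/
structure Gr (R : Type) [CommRing R] where
  c : ℤ → R →+ R
  fin : ∀ x, ∃ s : Finset ℤ, (∀ g, g ∉ s → c g x = 0) ∧ ∑ g ∈ s, c g x = x
  cc : ∀ g h x, c g (c h x) = if g = h then c h x else 0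
  one : c 0 1 = 1
  mul : ∀ g h x y, c h x = x → c g (x * y) = x * c (g - h) y

namespace Gr
variable {R : Type} [CommRing R] (gr : Gr R)

def vc {ι : Type} (a : ι → ℤ) (β : ℤ) (x : ι → R) : ι → R := fun i => gr.c (a i - β) (x i)

def HomM {ι κ : Type} (a : ι → ℤ) (b : κ → ℤ) (M : Matrix ι κ R) : Prop :=
  ∀ i j, gr.c (a i - b j) (M i j) = M i j

def HomS {ι : Type} (a : ι → ℤ) (N : Submodule R (ι → R)) : Prop :=
  ∀ x ∈ N, ∀ β, gr.vc a β x ∈ N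

variable {gr}

theorem c_zero_of_hom {g h : ℤ} (hgh : g ≠ h) {x : R} (hx : gr.c h x = x) : gr.c g x = 0 := by
  rw [← hx, gr.cc, if_neg hgh]

theorem vc_mulVec {ι κ : Type} [Fintype κ] {a : ι → ℤ} {b : κ → ℤ} {M : Matrix ι κ R}
    (hM : gr.HomM a b M) (β : ℤ) (y : κ → R) :
    gr.vc a β (M.mulVec y) = M.mulVec (gr.vc b β y) := by
  funext i
  simp only [vc, Matrix.mulVec, dotProduct, map_sum]
  refine Finset.sum_congr rfl fun j _ => ?_
  rw [gr.mul _ _ _ _ (hM i j)]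
  congr 3; ring

theorem HomM.mul {ι κ μ : Type} [Fintype κ] {a : ι → ℤ} {b : κ → ℤ} {d : μ → ℤ}
    {M : Matrix ι κ R} {M' : Matrix κ μ R}
    (hM : gr.HomM a b M) (hM' : gr.HomM b d M') : gr.HomM a d (M * M') := by
  intro i j
  simp only [Matrix.mul_apply, map_sum]
  refine Finset.sum_congr rfl fun k _ => ?_
  rw [gr.mul _ _ _ _ (hM i k)]
  rw [show a i - d j - (a i - b k) = b k - d j by ring, hM' k j]

theorem vc_fin {ι : Type} [Fintype ι] (a : ι → ℤ) (x : ι → R) :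
    ∃ s : Finset ℤ, ∑ β ∈ s, gr.vc a β x = x := by
  classical
  choose s hs hs' using fun i => gr.fin (x i)
  refine ⟨Finset.univ.biUnion fun i => (s i).image fun g => a i - g, ?_⟩
  funext i
  rw [Finset.sum_apply]
  simp only [vc]
  conv_rhs => rw [← hs' i]
  have : ∑ g ∈ s i, gr.c g (x i) = ∑ β ∈ (s i).image (fun g => a i - g), gr.c (a i - β) (x i) := by
    rw [Finset.sum_image]
    · simp
    · intro p _ q _ h; simpa using h
  rw [this]
  symm
  apply Finset.sum_subset
  · exact Finset.subset_biUnion_of_mem (fun i => (s i).image fun g => a i - g) (Finset.mem_univ i)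
  · intro β _ hβ
    apply hs
    intro h
    exact hβ (Finset.mem_image.2 ⟨_, h, by ring⟩)

theorem vc_vc {ι : Type} (a : ι → ℤ) (β : ℤ) (x : ι → R) :
    gr.vc a β (gr.vc a β x) = gr.vc a β x := by
  funext i; simp [vc, gr.cc]

theorem homS_ker {ι κ : Type} [Fintype κ] {a : ι → ℤ} {b : κ → ℤ} {M : Matrix ι κ R}
    (hM : gr.HomM a b M) : gr.HomS b (LinearMap.ker M.mulVecLin) := by
  intro x hx β
  simp only [LinearMap.mem_ker, Matrix.mulVecLin_apply] at hx ⊢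
  rw [← vc_mulVec hM, hx]
  funext i; simp [vc]

variable (gr) in
def FFR : ℕ → ∀ (ι : Type) [Fintype ι], (ι → ℤ) → Submodule R (ι → R) → Prop
  | 0, _, _, _, N => N = ⊥
  | l + 1, ι, _, a, N => ∃ (κ : Type) (_ : Fintype κ) (b : κ → ℤ) (M : Matrix ι κ R),
      gr.HomM a b M ∧ LinearMap.range M.mulVecLin = N ∧ FFR l κ b (LinearMap.ker M.mulVecLin)

theorem FFR.succ {l : ℕ} : ∀ {ι : Type} [Fintype ι] {a : ι → ℤ} {N : Submodule R (ι → R)},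
    gr.FFR l ι a N → gr.FFR (l + 1) ι a N := by
  induction l with
  | zero =>
    intro ι _ a N h
    refine ⟨Empty, inferInstance, Empty.elim, 0, fun i j => j.elim, ?_, ?_⟩
    · simp only [FFR] at h
      rw [h]
      simp
    · simp only [FFR]
      rw [eq_bot_iff]
      intro x _
      rw [Submodule.mem_bot]
      exact Subsingleton.elim _ _
  | succ l ih =>
    rintro ι _ a N ⟨κ, _, b, M, h1, h2, h3⟩
    exact ⟨κ, _, b, M, h1, h2, ih h3⟩

theorem FFR.map_inj {l : ℕ} {ι ι' : Type} [Fintype ι] [Fintype ι'] {a : ι → ℤ} {a' : ι' → ℤ}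
    {N : Submodule R (ι → R)} (h : gr.FFR l ι a N) {Φ : Matrix ι' ι R} (hΦ : gr.HomM a' a Φ)
    (hinj : ∀ x ∈ N, Φ.mulVec x = 0 → x = 0) : gr.FFR l ι' a' (N.map Φ.mulVecLin) := by
  cases l with
  | zero => simp only [FFR] at h ⊢; rw [h]; simp
  | succ l =>
    obtain ⟨κ, _, b, M, h1, h2, h3⟩ := h
    refine ⟨κ, inferInstance, b, Φ * M, hΦ.mul h1, ?_, ?_⟩
    · rw [Matrix.mulVecLin_mul, LinearMap.range_comp, h2]
    · convert h3 using 1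
      ext y
      simp only [LinearMap.mem_ker, Matrix.mulVecLin_apply, ← Matrix.mulVec_mulVec]
      constructor
      · intro hy
        exact hinj _ (h2 ▸ ⟨y, rfl⟩) hy
      · intro hy; rw [hy, Matrix.mulVec_zero]

theorem FFR.ext' {l : ℕ} : ∀ {ι ι' : Type} [Fintype ι] [Fintype ι'] {a : ι → ℤ} {a' : ι' → ℤ}
    {K : Submodule R (ι → R)} (_ : gr.HomS a K) {Ψ : Matrix ι' ι R} (_ : gr.HomM a' a Ψ)
    (_ : gr.FFR l ι' a' (K.map Ψ.mulVecLin)) (_ : ∃ l', gr.FFR l' ι a (K ⊓ LinearMap.ker Ψ.mulVecLin)),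
    ∃ l', gr.FFR l' ι a K := by
  induction l with
  | zero =>
    rintro ι ι' _ _ a a' K hK Ψ hΨ h ⟨l', h'⟩
    refine ⟨l', ?_⟩
    simp only [FFR] at h
    rwa [inf_eq_left.2] at h'
    intro x hx
    have : Ψ.mulVecLin x ∈ K.map Ψ.mulVecLin := ⟨x, hx, rfl⟩
    rwa [h] at this
  | succ l ih =>
    rintro ι ι' _ _ a a' K hK Ψ hΨ ⟨κ, _, b, M, h1, h2, h3⟩ ⟨l', h'⟩
    obtain ⟨κ', _, b', M', h1', h2', h3'⟩ := h'.succ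
    classical
    have lift : ∀ j, ∃ x ∈ K, gr.vc a (b j) x = x ∧ Ψ.mulVec x = fun i => M i j := by
      intro j
      have : M.mulVecLin (Pi.single j 1) ∈ K.map Ψ.mulVecLin := h2 ▸ ⟨_, rfl⟩
      obtain ⟨x, hx, hx'⟩ := this
      refine ⟨gr.vc a (b j) x, hK x hx _, vc_vc _ _ _, ?_⟩
      rw [← vc_mulVec hΨ]
      simp only [Matrix.mulVecLin_apply, Matrix.mulVec_single_one] at hx'
      rw [hx']
      funext i
      exact h1 i j
    choose A hAK hA hA' using lift
    let A0 : Matrix ι κ R := fun i j => A j i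
    have hA0 : gr.HomM a b A0 := fun i j => congrFun (hA j) i
    have hΨA : Ψ * A0 = M := by
      ext i j
      exact congrFun (hA' j) i
    have hAy : ∀ y, A0.mulVec y ∈ K := by
      intro y
      have : A0.mulVec y = ∑ j, y j • A j := by
        funext i
        simp [Matrix.mulVec, dotProduct, A0, mul_comm]
      rw [this]
      exact Submodule.sum_mem _ fun j _ => Submodule.smul_mem _ _ (hAK j)
    have hM'K : ∀ y, M'.mulVec y ∈ K ⊓ LinearMap.ker Ψ.mulVecLin := fun y => h2' ▸ ⟨y, rfl⟩
    let B : Matrix ι (κ ⊕ κ') R := Matrix.fromCols A0 M'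
    have hB : gr.HomM a (Sum.elim b b') B := by
      rintro i (j | j)
      · exact hA0 i j
      · exact h1' i j
    have hBr : LinearMap.range B.mulVecLin = K := by
      apply le_antisymm
      · rintro _ ⟨y, rfl⟩
        simp only [Matrix.mulVecLin_apply, B]
        rw [← Sum.elim_comp_inl_inr y, Matrix.fromCols_mulVec_sumElim]
        exact K.add_mem (hAy _) (hM'K _).1
      · intro x hx
        have : Ψ.mulVecLin x ∈ LinearMap.range M.mulVecLin := h2 ▸ ⟨x, hx, rfl⟩
        obtain ⟨y, hy⟩ := this
        simp only [Matrix.mulVecLin_apply] at hy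
        have h5 : x - A0.mulVec y ∈ LinearMap.range M'.mulVecLin := by
          rw [h2']
          refine ⟨K.sub_mem hx (hAy y), ?_⟩
          rw [SetLike.mem_coe, LinearMap.mem_ker, Matrix.mulVecLin_apply, Matrix.mulVec_sub, Matrix.mulVec_mulVec,
            hΨA, hy, sub_self]
        obtain ⟨y', hy'⟩ := h5
        refine ⟨Sum.elim y y', ?_⟩
        simp only [Matrix.mulVecLin_apply, B] at hy' ⊢
        rw [Matrix.fromCols_mulVec_sumElim, hy']
        abel
    let Pr : Matrix κ (κ ⊕ κ') R := Matrix.fromCols 1 0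
    have hPr : gr.HomM b (Sum.elim b b') Pr := by
      rintro i (j | j)
      · by_cases hij : i = j
        · subst hij; simp [Pr, gr.one]
        · simp [Pr, hij]
      · simp [Pr]
    have hPr' : ∀ y, Pr.mulVec y = y ∘ Sum.inl := by
      intro y
      conv_lhs => rw [← Sum.elim_comp_inl_inr y]
      simp [Pr]
    let In : Matrix (κ ⊕ κ') κ' R := Matrix.fromRows 0 1
    have hIn : gr.HomM (Sum.elim b b') b' In := by
      rintro (i | i) j
      · simp [In]
      · by_cases hij : i = j
        · subst hij; simp [In, gr.one]
        · simp [In, hij]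
    have hIn' : ∀ y, In.mulVec y = Sum.elim (0 : κ → R) y := by
      intro y
      simp [In, Matrix.fromRows_mulVec]
    have key : ∃ l', gr.FFR l' (κ ⊕ κ') (Sum.elim b b') (LinearMap.ker B.mulVecLin) := by
      refine ih (homS_ker hB) hPr ?_ ⟨l', ?_⟩
      · convert h3 using 1
        ext y
        simp only [Submodule.mem_map, LinearMap.mem_ker, Matrix.mulVecLin_apply]
        constructor
        · rintro ⟨z, hz, rfl⟩
          rw [← Sum.elim_comp_inl_inr z, Matrix.fromCols_mulVec_sumElim] at hz
          rw [hPr', ← hΨA, ← Matrix.mulVec_mulVec, eq_neg_of_add_eq_zero_left hz, Matrix.mulVec_neg]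
          have := (hM'K (z ∘ Sum.inr)).2
          simp only [SetLike.mem_coe, LinearMap.mem_ker, Matrix.mulVecLin_apply] at this
          rw [this, neg_zero]
        · intro hy
          have h5 : -A0.mulVec y ∈ LinearMap.range M'.mulVecLin := by
            rw [h2']
            refine ⟨K.neg_mem (hAy y), ?_⟩
            rw [SetLike.mem_coe, LinearMap.mem_ker, Matrix.mulVecLin_apply, Matrix.mulVec_neg, Matrix.mulVec_mulVec,
              hΨA, hy, neg_zero]
          obtain ⟨y', hy'⟩ := h5
          refine ⟨Sum.elim y y', ?_, by rw [hPr']; rfl⟩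
          simp only [Matrix.mulVecLin_apply, B] at hy' ⊢
          rw [Matrix.fromCols_mulVec_sumElim, hy']
          abel
      · have h6 := h3'.map_inj hIn (by
          intro x _ hx
          rw [hIn'] at hx
          funext i
          exact congrFun hx (Sum.inr i))
        convert h6 using 1
        ext z
        simp only [Submodule.mem_map, LinearMap.mem_ker, Matrix.mulVecLin_apply, Submodule.mem_inf]
        constructor
        · rintro ⟨hz1, hz2⟩
          rw [hPr'] at hz2
          refine ⟨z ∘ Sum.inr, ?_, ?_⟩
          · rw [← Sum.elim_comp_inl_inr z, Matrix.fromCols_mulVec_sumElim, hz2] at hz1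
            simpa using hz1
          · rw [hIn', ← hz2, Sum.elim_comp_inl_inr]
        · rintro ⟨y, hy, rfl⟩
          rw [hIn', hPr']
          simp only [B]
          rw [Matrix.fromCols_mulVec_sumElim, hy]
          simp
    obtain ⟨m, hm⟩ := key
    exact ⟨m + 1, κ ⊕ κ', inferInstance, Sum.elim b b', B, hB, hBr, hm⟩

theorem FFR.quot {ι ι' : Type} [Fintype ι] [Fintype ι'] {a : ι → ℤ} {a' : ι' → ℤ}
    {B : Submodule R (ι → R)} {Ψ : Matrix ι' ι R} (hΨ : gr.HomM a' a Ψ)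
    (hB : ∃ l, gr.FFR l ι a B) (h' : ∃ l', gr.FFR l' ι a (B ⊓ LinearMap.ker Ψ.mulVecLin)) :
    ∃ l, gr.FFR l ι' a' (B.map Ψ.mulVecLin) := by
  obtain ⟨l, hl⟩ := hB
  obtain ⟨l', hl'⟩ := h'
  obtain ⟨κ, _, b, M, h1, h2, h3⟩ := hl.succ
  have h5 : gr.HomM a' b (Ψ * M) := hΨ.mul h1
  obtain ⟨m, hm⟩ : ∃ m, gr.FFR m κ b (LinearMap.ker (Ψ * M).mulVecLin) := by
    refine FFR.ext' (homS_ker h5) h1 (l := l') ?_ ⟨l, ?_⟩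
    · convert hl' using 1
      ext x
      simp only [Submodule.mem_map, LinearMap.mem_ker, Matrix.mulVecLin_apply, Submodule.mem_inf,
        ← Matrix.mulVec_mulVec]
      constructor
      · rintro ⟨y, hy, rfl⟩
        exact ⟨h2 ▸ ⟨y, rfl⟩, hy⟩
      · rintro ⟨hx, hx'⟩
        rw [← h2] at hx
        obtain ⟨y, rfl⟩ := hx
        exact ⟨y, hx', rfl⟩
    · convert h3 using 1
      rw [inf_eq_right]
      intro y hy
      simp only [LinearMap.mem_ker, Matrix.mulVecLin_apply, ← Matrix.mulVec_mulVec] at hy ⊢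
      rw [hy, Matrix.mulVec_zero]
  exact ⟨m + 1, κ, _, b, Ψ * M, h5, by rw [Matrix.mulVecLin_mul, LinearMap.range_comp, h2], hm⟩

variable (gr) in
def HFFR : Prop := ∀ (ι : Type) [Fintype ι] (a : ι → ℤ) (N : Submodule R (ι → R)),
  gr.HomS a N → ∃ l, gr.FFR l ι a N

end Gr
end AdjFac


namespace AdjFac
namespace Gr
open Polynomial

/-- the trivial grading -/
noncomputable def triv (k : Type) [CommRing k] : Gr k where
  c g := if g = 0 then AddMonoidHom.id k else 0
  fin x := ⟨{0}, by
    constructor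
    · intro g hg
      have : g ≠ 0 := by simpa using hg
      simp [this]
    · simp⟩
  cc g h x := by
    by_cases h1 : h = 0
    · subst h1
      by_cases h2 : g = 0 <;> simp [h2]
    · simp [h1]
  one := by simp
  mul g h x y hx := by
    by_cases h1 : h = 0
    · subst h1
      by_cases h2 : g = 0 <;> simp [h2]
    · have : x = 0 := by simpa [h1] using hx.symm
      simp [this]

theorem exists_homog_span {R : Type} [CommRing R] [IsNoetherianRing R] {gr : Gr R} {ι : Type}
    [Fintype ι] {a : ι → ℤ} {N : Submodule R (ι → R)} (hN : gr.HomS a N) :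
    ∃ s : Set (ι → R), s.Finite ∧ Submodule.span R s = N ∧ ∀ x ∈ s, ∃ β, gr.vc a β x = x := by
  classical
  obtain ⟨t, ht⟩ := (IsNoetherian.noetherian N : N.FG)
  choose S hS using fun x : ι → R => vc_fin (gr := gr) a x
  refine ⟨↑(t.biUnion fun x => (S x).image fun β => gr.vc a β x), Finset.finite_toSet _, ?_, ?_⟩
  · apply le_antisymm
    · rw [Submodule.span_le]
      intro y hy
      simp only [Finset.coe_biUnion, Set.mem_iUnion, Finset.coe_image, Set.mem_image,
        Finset.mem_coe] at hy
      obtain ⟨x, hx, β, _, rfl⟩ := hy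
      exact hN x (ht ▸ Submodule.subset_span hx) β
    · conv_lhs => rw [← ht]
      rw [Submodule.span_le]
      intro x hx
      rw [SetLike.mem_coe]
      conv => arg 2; rw [← hS x]
      refine Submodule.sum_mem _ fun β hβ => Submodule.subset_span ?_
      simp only [Finset.coe_biUnion, Set.mem_iUnion, Finset.coe_image, Set.mem_image,
        Finset.mem_coe]
      exact ⟨x, hx, β, hβ, rfl⟩
  · intro y hy
    simp only [Finset.coe_biUnion, Set.mem_iUnion, Finset.coe_image, Set.mem_image,
      Finset.mem_coe] at hy
    obtain ⟨x, hx, β, _, rfl⟩ := hy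
    exact ⟨β, vc_vc _ _ _⟩

theorem hffr_triv (k : Type) [Field k] : (triv k).HFFR := by
  intro ι _ a N hN
  obtain ⟨s, hs, hspan, hh⟩ := exists_homog_span hN
  obtain ⟨b, hbs, hb, hli⟩ := exists_linearIndependent k s
  have hbf : b.Finite := hs.subset hbs
  have := hbf.fintype
  choose β hβ using fun x : b => hh x (hbs x.2)
  refine ⟨1, b, inferInstance, β, Matrix.of fun i j => j.1 i, fun i j => congrFun (hβ j) i, ?_, ?_⟩
  · rw [Matrix.range_mulVecLin, ← hspan, ← hb]
    congr 1
    ext x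
    simp only [Set.mem_range]
    constructor
    · rintro ⟨y, rfl⟩; exact y.2
    · intro hx; exact ⟨⟨x, hx⟩, rfl⟩
  · simp only [FFR]
    rw [LinearMap.ker_eq_bot]
    rw [Matrix.coe_mulVecLin]
    rw [Matrix.mulVec_injective_iff]
    exact hli

section poly
variable {R : Type} [CommRing R] (gr : Gr R) (w : ℤ)

noncomputable def pc (g : ℤ) : R[X] →+ R[X] where
  toFun f := ∑ j ∈ Finset.range (f.natDegree + 1), monomial j (gr.c (g - j * w) (f.coeff j))
  map_zero' := by simp
  map_add' f h := by
    have key : ∀ (f : R[X]) (j : ℕ), (∑ j ∈ Finset.range (f.natDegree + 1),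
        monomial j (gr.c (g - j * w) (f.coeff j))).coeff j = gr.c (g - j * w) (f.coeff j) := by
      intro f j
      simp only [finsetSum_coeff, coeff_monomial]
      rw [Finset.sum_ite_eq']
      split_ifs with h
      · rfl
      · rw [coeff_eq_zero_of_natDegree_lt, map_zero]
        simpa [Nat.lt_succ_iff] using h
    ext j
    rw [coeff_add, key, key, key, coeff_add, map_add]

theorem pc_coeff (g : ℤ) (f : R[X]) (j : ℕ) :
    (gr.pc w g f).coeff j = gr.c (g - j * w) (f.coeff j) := by
  show (∑ j ∈ Finset.range (f.natDegree + 1),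
        monomial j (gr.c (g - j * w) (f.coeff j))).coeff j = _
  simp only [finsetSum_coeff, coeff_monomial]
  rw [Finset.sum_ite_eq']
  split_ifs with h
  · rfl
  · rw [coeff_eq_zero_of_natDegree_lt, map_zero]
    simpa [Nat.lt_succ_iff] using h

noncomputable def poly : Gr R[X] where
  c := gr.pc w
  fin f := by
    classical
    choose s hs hs' using fun j : ℕ => gr.fin (f.coeff j)
    refine ⟨(Finset.range (f.natDegree + 1)).biUnion fun j =>
      (s j).image fun g => g + j * w, ?_, ?_⟩
    · intro g hg
      ext j
      rw [pc_coeff, coeff_zero]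
      by_cases hj : j ∈ Finset.range (f.natDegree + 1)
      · apply hs
        intro h
        apply hg
        rw [Finset.mem_biUnion]
        exact ⟨j, hj, Finset.mem_image.2 ⟨_, h, by ring⟩⟩
      · rw [coeff_eq_zero_of_natDegree_lt, map_zero]
        simpa [Nat.lt_succ_iff] using hj
    · ext j
      simp only [finsetSum_coeff, pc_coeff]
      by_cases hj : j ∈ Finset.range (f.natDegree + 1)
      · conv_rhs => rw [← hs' j]
        have : ∑ g ∈ s j, gr.c g (f.coeff j) =
            ∑ β ∈ (s j).image (fun g => g + j * w), gr.c (β - j * w) (f.coeff j) := by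
          rw [Finset.sum_image]
          · simp
          · intro p _ q _ h; simpa using h
        rw [this]
        symm
        apply Finset.sum_subset
        · exact Finset.subset_biUnion_of_mem (fun j : ℕ => (s j).image fun g => g + j * w) hj
        · intro β _ hβ
          apply hs
          intro h
          exact hβ (Finset.mem_image.2 ⟨_, h, by ring⟩)
      · rw [coeff_eq_zero_of_natDegree_lt]
        · simp
        · simpa [Nat.lt_succ_iff] using hj
  cc g h f := by
    ext j
    rw [pc_coeff, pc_coeff, gr.cc]
    by_cases hgh : g = h
    · subst hgh; simp [pc_coeff]
    · rw [if_neg, if_neg hgh, coeff_zero]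
      intro h'; apply hgh; linarith
  one := by
    ext j
    rw [pc_coeff, coeff_one]
    by_cases hj : j = 0
    · subst hj; simp [gr.one]
    · simp [hj]
  mul g h x y hx := by
    ext j
    rw [pc_coeff, coeff_mul, coeff_mul, map_sum]
    refine Finset.sum_congr rfl fun p hp => ?_
    have h1 : gr.c (h - p.1 * w) (x.coeff p.1) = x.coeff p.1 := by
      conv_rhs => rw [← hx]
      rw [pc_coeff]
    rw [gr.mul _ _ _ _ h1, pc_coeff]
    rw [Finset.HasAntidiagonal.mem_antidiagonal] at hp
    rw [← hp]
    congr 3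
    push_cast; ring

theorem poly_c_coeff (g : ℤ) (f : R[X]) (j : ℕ) :
    ((gr.poly w).c g f).coeff j = gr.c (g - j * w) (f.coeff j) := pc_coeff _ _ _ _ _

theorem poly_C {g : ℤ} {r : R} (h : gr.c g r = r) : (gr.poly w).c g (C r) = C r := by
  ext j
  rw [poly_c_coeff, coeff_C]
  split_ifs with hj
  · subst hj; simpa using h
  · simp

theorem poly_X_pow (j : ℕ) : (gr.poly w).c (j * w) (X ^ j) = X ^ j := by
  ext i
  rw [poly_c_coeff, coeff_X_pow]
  split_ifs with h
  · subst h; simp [gr.one]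
  · simp

theorem poly_X : (gr.poly w).c w X = X := by
  have := gr.poly_X_pow w 1
  simpa using this

/-- extension of a submodule to the polynomial ring, coefficientwise -/
def extP {κ : Type} (N : Submodule R (κ → R)) : Submodule R[X] (κ → R[X]) where
  carrier := {y | ∀ e, (fun k => (y k).coeff e) ∈ N}
  add_mem' {x y} hx hy e := by
    have := N.add_mem (hx e) (hy e)
    convert this using 1
    funext k; simp
  zero_mem' e := by
    convert N.zero_mem using 1
    funext k; simp
  smul_mem' f y hy e := by
    have : (fun k => ((f • y) k).coeff e) =
        ∑ p ∈ Finset.HasAntidiagonal.antidiagonal e, f.coeff p.1 • (fun k => (y k).coeff p.2) := by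
      funext k
      simp [coeff_mul]
    rw [this]
    exact Submodule.sum_mem _ fun p _ => N.smul_mem _ (hy _)

theorem coeff_mapC_mulVec {ι κ : Type} [Fintype κ] (M : Matrix ι κ R) (y : κ → R[X]) (e : ℕ) :
    (fun i => ((M.map C).mulVec y i).coeff e) = M.mulVec (fun k => (y k).coeff e) := by
  funext i
  simp [Matrix.mulVec, dotProduct, finsetSum_coeff]

variable {gr} in
theorem FFR.extP {l : ℕ} : ∀ {κ : Type} [Fintype κ] {b : κ → ℤ} {N : Submodule R (κ → R)},
    gr.FFR l κ b N → (gr.poly w).FFR l κ b (extP N) := by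
  induction l with
  | zero =>
    intro κ _ b N h
    simp only [FFR] at h ⊢
    rw [eq_bot_iff]
    intro y hy
    rw [Submodule.mem_bot]
    funext k
    ext e
    have := hy e
    rw [h, Submodule.mem_bot] at this
    simpa using congrFun this k
  | succ l ih =>
    rintro κ _ b N ⟨μ, _, d, M, h1, h2, h3⟩
    refine ⟨μ, inferInstance, d, M.map C, fun i j => poly_C _ _ (h1 i j), ?_, ?_⟩
    · ext y
      constructor
      · rintro ⟨z, rfl⟩ e
        rw [Matrix.mulVecLin_apply, coeff_mapC_mulVec, ← h2]
        exact ⟨_, rfl⟩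
      · intro hy
        have : ∀ e, ∃ z : μ → R, M.mulVec z = fun k => (y k).coeff e := by
          intro e
          have := hy e
          rw [← h2] at this
          exact this
        choose z hz using this
        let D := Finset.univ.sup fun k => (y k).natDegree
        refine ⟨fun j => ∑ e ∈ Finset.range (D + 1), monomial e (z e j), ?_⟩
        funext i
        ext e
        rw [Matrix.mulVecLin_apply]
        have h5 := congrFun (coeff_mapC_mulVec M
          (fun j => ∑ e ∈ Finset.range (D + 1), monomial e (z e j)) e) i
        rw [h5]
        simp only [finsetSum_coeff, coeff_monomial, Finset.sum_ite_eq']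
        split_ifs with he
        · exact congrFun (hz e) i
        · rw [coeff_eq_zero_of_natDegree_lt]
          · simp [Matrix.mulVec, dotProduct]
          · have : (y i).natDegree ≤ D := Finset.le_sup (f := fun k => (y k).natDegree) (Finset.mem_univ i)
            simp only [Finset.mem_range] at he
            omega
    · convert ih h3 using 1
      ext y
      constructor
      · intro hy e
        rw [LinearMap.mem_ker, Matrix.mulVecLin_apply] at hy ⊢
        rw [← coeff_mapC_mulVec, hy]
        simp; rfl
      · intro hy
        rw [LinearMap.mem_ker, Matrix.mulVecLin_apply]
        funext i
        ext e
        have := hy e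
        rw [LinearMap.mem_ker, Matrix.mulVecLin_apply, ← coeff_mapC_mulVec] at this
        simpa using congrFun this i

end poly
end Gr
end AdjFac


namespace AdjFac
namespace Gr
open Polynomial

section step
variable {R : Type} [CommRing R] (gr : Gr R) (w : ℤ) {ι : Type} [Fintype ι]

noncomputable def enc (D : ℕ) : (ι × Fin D → R) →ₗ[R] (ι → R[X]) where
  toFun x i := ∑ j : Fin D, monomial (j : ℕ) (x (i, j))
  map_add' x y := by funext i; simp [Finset.sum_add_distrib]
  map_smul' r x := by funext i; simp [Finset.smul_sum, smul_monomial]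

theorem enc_apply (D : ℕ) (x : ι × Fin D → R) (i : ι) :
    enc D x i = ∑ j : Fin D, monomial (j : ℕ) (x (i, j)) := rfl

noncomputable def ND (N : Submodule R[X] (ι → R[X])) (D : ℕ) : Submodule R (ι × Fin D → R) :=
  (N.restrictScalars R).comap (enc D)

theorem mem_ND {N : Submodule R[X] (ι → R[X])} {D : ℕ} {x : ι × Fin D → R} :
    x ∈ ND N D ↔ enc D x ∈ N := Iff.rfl

theorem poly_monomial (g : ℤ) (j : ℕ) (r : R) :
    (gr.poly w).c g (monomial j r) = monomial j (gr.c (g - j * w) r) := by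
  ext i
  rw [poly_c_coeff, coeff_monomial, coeff_monomial]
  split_ifs with h
  · subst h; rfl
  · simp

variable {gr w} in
theorem homS_ND {a : ι → ℤ} {N : Submodule R[X] (ι → R[X])} (hN : (gr.poly w).HomS a N)
    (D : ℕ) (e : ℤ) : gr.HomS (fun p : ι × Fin D => a p.1 - p.2 * w - e) (ND N D) := by
  intro x hx β
  rw [mem_ND] at hx ⊢
  convert hN _ hx (e + β) using 1
  funext i
  simp only [vc, enc_apply, map_sum]
  refine Finset.sum_congr rfl fun j _ => ?_
  rw [poly_monomial]
  congr 3
  ring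

noncomputable def pt [DecidableEq ι] (R : Type) [CommRing R] (D : ℕ) : Matrix ι (ι × Fin D) R[X] :=
  Matrix.of fun i p => if i = p.1 then X ^ (p.2 : ℕ) else 0

theorem pt_mulVec [DecidableEq ι] (D : ℕ) (y : ι × Fin D → R[X]) (i : ι) :
    (pt R D).mulVec y i = ∑ j : Fin D, X ^ (j : ℕ) * y (i, j) := by
  simp [pt, Matrix.mulVec, dotProduct, Fintype.sum_prod_type]

noncomputable def jm [DecidableEq ι] (R : Type) [CommRing R] (D : ℕ) :
    Matrix (ι × Fin (D + 1)) (ι × Fin D) R[X] :=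
  Matrix.of fun p q => if p.1 = q.1 then
    ((if (p.2 : ℕ) = q.2 then X else 0) - (if (p.2 : ℕ) = q.2 + 1 then 1 else 0)) else 0

noncomputable def ze {A : Type} [Zero A] {D : ℕ} (z : ι × Fin D → A) (i : ι) (j : ℕ) : A :=
  if h : j < D then z (i, ⟨j, h⟩) else 0

theorem sumite {A : Type} [AddCommMonoid A] {D : ℕ} (m : ℕ) (f : Fin D → A) :
    (∑ j : Fin D, if m = (j : ℕ) then f j else 0) = if h : m < D then f ⟨m, h⟩ else 0 := by
  split_ifs with h
  · rw [Finset.sum_eq_single ⟨m, h⟩]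
    · simp
    · intro b _ hb
      rw [if_neg]
      intro h'; apply hb; ext; exact h'.symm
    · simp
  · apply Finset.sum_eq_zero
    intro j _
    rw [if_neg]
    have := j.2
    omega

theorem jm_mulVec [DecidableEq ι] (D : ℕ) (z : ι × Fin D → R[X]) (i : ι) (j : Fin (D + 1)) :
    (jm R D).mulVec z (i, j) = X * ze z i j - (if (j : ℕ) = 0 then 0 else ze z i (j - 1)) := by
  simp only [jm, Matrix.mulVec, dotProduct, Fintype.sum_prod_type, Matrix.of_apply, ite_mul,
    zero_mul, sub_mul, one_mul]
  rw [Finset.sum_eq_single i]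
  · simp only [if_true, Finset.sum_sub_distrib]
    congr 1
    · rw [sumite (j : ℕ) (fun q => X * z (i, q))]
      simp only [ze]
      split_ifs <;> simp
    · by_cases hj : (j : ℕ) = 0
      · rw [if_pos hj]
        apply Finset.sum_eq_zero
        intro q _
        rw [if_neg]; omega
      · rw [if_neg hj]
        have : ∀ q : Fin D, ((j : ℕ) = q + 1) ↔ ((j : ℕ) - 1 = q) := by intro q; omega
        simp only [this]
        rw [sumite ((j : ℕ) - 1) (fun q => z (i, q))]
        rfl
  · intro b _ hb
    simp [Ne.symm hb]
  · simp

variable {gr w} in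
theorem homM_pt [DecidableEq ι] (a : ι → ℤ) (D : ℕ) :
    (gr.poly w).HomM a (fun p : ι × Fin D => a p.1 - p.2 * w - 0) (pt R D) := by
  intro i p
  simp only [pt, Matrix.of_apply]
  split_ifs with h
  · subst h
    convert gr.poly_X_pow w p.2 using 2
    ring
  · simp

variable {gr w} in
theorem homM_jm [DecidableEq ι] (a : ι → ℤ) (D : ℕ) :
    (gr.poly w).HomM (fun p : ι × Fin (D + 1) => a p.1 - p.2 * w - 0)
      (fun p : ι × Fin D => a p.1 - p.2 * w - w) (jm R D) := by
  intro p q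
  simp only [jm, Matrix.of_apply]
  split_ifs with h h1 h2 h2
  · omega
  · simp only [sub_zero, h, h1]
    convert gr.poly_X w using 2
    ring
  · simp only [zero_sub, map_neg, h, h2, sub_zero]
    congr 1
    convert (gr.poly w).one using 2
    push_cast; ring
  · simp
  · simp

theorem enc_coeff_jm [DecidableEq ι] (D : ℕ) (z : ι × Fin D → R[X]) (e : ℕ) :
    enc (D + 1) (fun p => ((jm R D).mulVec z p).coeff (e + 1)) =
      enc D (fun p => (z p).coeff e) - (X : R[X]) • enc D (fun p => (z p).coeff (e + 1)) := by
  funext i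
  simp only [enc_apply, jm_mulVec, coeff_sub, map_sub, Finset.sum_sub_distrib, coeff_X_mul,
    Pi.sub_apply, Pi.smul_apply, smul_eq_mul]
  congr 1
  · rw [Fin.sum_univ_castSucc]
    simp [ze]
  · rw [Fin.sum_univ_succ]
    simp [ze, Finset.mul_sum, X_mul_monomial]

theorem enc_coeff_jm_zero [DecidableEq ι] (D : ℕ) (z : ι × Fin D → R[X]) :
    enc (D + 1) (fun p => ((jm R D).mulVec z p).coeff 0) =
       - ((X : R[X]) • enc D (fun p => (z p).coeff 0)) := by
  funext i
  simp only [enc_apply, jm_mulVec, coeff_sub, map_sub, Finset.sum_sub_distrib,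
    Pi.neg_apply, Pi.smul_apply, smul_eq_mul, mul_coeff_zero, coeff_X_zero, zero_mul, map_zero,
    Finset.sum_const_zero, zero_sub]
  congr 1
  · rw [Fin.sum_univ_succ]
    simp [ze, Finset.mul_sum, X_mul_monomial]

theorem pt_jm [DecidableEq ι] (D : ℕ) (z : ι × Fin D → R[X]) :
    (pt R (D + 1)).mulVec ((jm R D).mulVec z) = 0 := by
  funext i
  rw [pt_mulVec]
  simp only [jm_mulVec, mul_sub, Finset.sum_sub_distrib]
  rw [Fin.sum_univ_castSucc, Fin.sum_univ_succ]
  simp only [ze, Fin.val_castSucc, Fin.is_lt, dite_true, Fin.eta, Fin.val_last, lt_irrefl,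
    dite_false, mul_zero, add_zero, Fin.val_zero, if_true, Fin.val_succ, Nat.add_sub_cancel,
    zero_add, Nat.succ_ne_zero, if_false, Pi.zero_apply]
  rw [sub_eq_zero]
  refine Finset.sum_congr rfl fun j _ => ?_
  ring

theorem jm_inj [DecidableEq ι] (D : ℕ) (z : ι × Fin D → R[X]) (h : (jm R D).mulVec z = 0) :
    z = 0 := by
  have : ∀ i, ∀ j, ze z i j = 0 := by
    intro i j
    induction j with
    | zero =>
      have := congrFun h (i, 0)
      rw [jm_mulVec] at this
      simpa using this
    | succ j ih =>
      by_cases hj : j + 1 < D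
      · have := congrFun h (i, ⟨j + 1, by omega⟩)
        rw [jm_mulVec] at this
        simpa [ih] using this
      · simp [ze, hj]
  funext p
  have h2 := this p.1 p.2
  simpa [ze] using h2

theorem jm_surj [DecidableEq ι] (D : ℕ) (y : ι × Fin (D + 1) → R[X])
    (h : (pt R (D + 1)).mulVec y = 0) : ∃ z, (jm R D).mulVec z = y := by
  let Z : ι → ℕ → R[X] := fun i j => - ∑ m ∈ Finset.range (D - j), X ^ m * ze y i (j + 1 + m)
  refine ⟨fun p => Z p.1 p.2, ?_⟩
  have hZ : ∀ i j, ze (fun p : ι × Fin D => Z p.1 p.2) i j = Z i j := by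
    intro i j
    simp only [ze]
    split_ifs with hj
    · rfl
    · simp [Z, Nat.sub_eq_zero_of_le (not_lt.1 hj)]
  funext p
  obtain ⟨i, j⟩ := p
  rw [jm_mulVec, hZ, hZ]
  have hy : ze y i j = y (i, j) := by simp only [ze]; rw [dif_pos j.2]
  by_cases hj : (j : ℕ) = 0
  · rw [if_pos hj, sub_zero]
    have h1 := congrFun h i
    rw [pt_mulVec, Fin.sum_univ_succ] at h1
    simp only [Z]
    have hj' : j = 0 := by ext; exact hj
    subst hj'
    simp only [Fin.val_zero, Nat.sub_zero, pow_zero, one_mul, Fin.val_succ, Pi.zero_apply] at h1 ⊢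
    rw [Finset.sum_range, mul_neg, Finset.mul_sum]
    rw [eq_neg_of_add_eq_zero_left h1]
    congr 1
    refine Finset.sum_congr rfl fun m _ => ?_
    simp only [ze]
    rw [dif_pos (by omega)]
    rw [pow_succ']
    rw [mul_assoc]
    congr 4
    ext; simp; omega
  · rw [if_neg hj, ← hy]
    simp only [Z]
    have e1 : D - ((j : ℕ) - 1) = D - j + 1 := by omega
    rw [e1, Finset.sum_range_succ']
    have e2 : ∀ m : ℕ, (j : ℕ) - 1 + 1 + (m + 1) = j + 1 + m := by omega
    have e3 : (j : ℕ) - 1 + 1 + 0 = j := by omega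
    have e4 : ∑ k ∈ Finset.range (D - j), X ^ (k + 1) * ze y i ((j : ℕ) - 1 + 1 + (k + 1)) =
        ∑ m ∈ Finset.range (D - j), X * (X ^ m * ze y i ((j : ℕ) + 1 + m)) := by
      refine Finset.sum_congr rfl fun m _ => ?_
      rw [e2 m, pow_succ', mul_assoc]
    rw [e4, e3, mul_neg, Finset.mul_sum, pow_zero, one_mul]
    ring

theorem extP_inf_ker [DecidableEq ι] (D : ℕ) (N : Submodule R[X] (ι → R[X])) :
    extP (ND N (D + 1)) ⊓ LinearMap.ker (pt R (D + 1)).mulVecLin =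
      (extP (ND N D)).map (jm R D).mulVecLin := by
  ext y
  simp only [Submodule.mem_inf, LinearMap.mem_ker, Matrix.mulVecLin_apply, Submodule.mem_map]
  constructor
  · rintro ⟨hy, hy'⟩
    obtain ⟨z, rfl⟩ := jm_surj D y hy'
    refine ⟨z, ?_, rfl⟩
    have key : ∀ m e, (∀ p, (z p).natDegree < e + m) → enc D (fun p => (z p).coeff e) ∈ N := by
      intro m
      induction m with
      | zero =>
        intro e he
        have : (fun p => (z p).coeff e) = 0 := by
          funext p
          exact coeff_eq_zero_of_natDegree_lt (he p)
        rw [this, map_zero]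
        exact N.zero_mem
      | succ m ih =>
        intro e he
        have h1 := ih (e + 1) (by intro p; have := he p; omega)
        have h2 := enc_coeff_jm D z e
        rw [eq_sub_iff_add_eq] at h2
        rw [← h2]
        exact N.add_mem (hy (e + 1)) (N.smul_mem _ h1)
    intro e
    refine key ((Finset.univ.sup fun p => (z p).natDegree) + 1) e ?_
    intro p
    have : (z p).natDegree ≤ Finset.univ.sup fun p => (z p).natDegree :=
      Finset.le_sup (f := fun k => (z k).natDegree) (Finset.mem_univ p)
    omega
  · rintro ⟨z, hz, rfl⟩
    refine ⟨?_, pt_jm D z⟩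
    intro e
    rw [mem_ND]
    cases e with
    | zero =>
      rw [enc_coeff_jm_zero]
      exact N.neg_mem (N.smul_mem _ (hz 0))
    | succ e =>
      rw [enc_coeff_jm]
      exact N.sub_mem (hz e) (N.smul_mem _ (hz (e + 1)))

theorem extP_map_pt [DecidableEq ι] [IsNoetherianRing R] (N : Submodule R[X] (ι → R[X])) :
    ∃ D, (extP (ND N (D + 1))).map (pt R (D + 1)).mulVecLin = N := by
  obtain ⟨t, ht⟩ := (IsNoetherian.noetherian N : N.FG)
  let D := t.sup fun x => Finset.univ.sup fun i => (x i).natDegree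
  refine ⟨D, le_antisymm ?_ ?_⟩
  · rintro _ ⟨y, hy, rfl⟩
    rw [Matrix.mulVecLin_apply]
    have : (pt R (D + 1)).mulVec y = ∑ e ∈ Finset.range ((Finset.univ.sup fun p => (y p).natDegree) + 1),
        (X ^ e : R[X]) • enc (D + 1) (fun p => (y p).coeff e) := by
      funext i
      rw [pt_mulVec]
      simp only [Finset.sum_apply, Pi.smul_apply, enc_apply, smul_eq_mul, Finset.mul_sum]
      rw [Finset.sum_comm]
      refine Finset.sum_congr rfl fun j _ => ?_
      conv_lhs => rw [(y (i, j)).as_sum_range' ((Finset.univ.sup fun p => (y p).natDegree) + 1)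
        (Nat.lt_succ_of_le (Finset.le_sup (f := fun k => (y k).natDegree) (Finset.mem_univ (i, j))))]
      rw [Finset.mul_sum]
      refine Finset.sum_congr rfl fun e _ => ?_
      rw [X_pow_mul_monomial, X_pow_mul_monomial, add_comm]
    rw [this]
    exact Submodule.sum_mem _ fun e _ => N.smul_mem _ (hy e)
  · conv_lhs => rw [← ht]
    rw [Submodule.span_le]
    intro x hx
    have hx' : ∀ i, (x i).natDegree < D + 1 := by
      intro i
      have h1 : (Finset.univ.sup fun i => (x i).natDegree) ≤ D :=
        Finset.le_sup (f := fun x : ι → R[X] => Finset.univ.sup fun i => (x i).natDegree) hx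
      have h2 : (x i).natDegree ≤ _ :=
        Finset.le_sup (f := fun i => (x i).natDegree) (Finset.mem_univ i)
      omega
    have hen : enc (D + 1) (fun p => (x p.1).coeff p.2) = x := by
      funext i
      rw [enc_apply]
      conv_rhs => rw [(x i).as_sum_range' (D + 1) (hx' i)]
      rw [Finset.sum_range]
    refine ⟨fun p => C ((x p.1).coeff p.2), ?_, ?_⟩
    · intro e
      rw [mem_ND]
      cases e with
      | zero =>
        simp only [coeff_C_zero]
        rw [hen]
        exact ht ▸ Submodule.subset_span hx
      | succ e =>
        simp only [coeff_C_succ]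
        have : enc (D + 1) (fun _ : ι × Fin (D + 1) => (0 : R)) = 0 := map_zero _
        rw [this]
        exact N.zero_mem
    · rw [Matrix.mulVecLin_apply]
      conv_rhs => rw [← hen]
      funext i
      rw [pt_mulVec, enc_apply]
      refine Finset.sum_congr rfl fun j _ => ?_
      rw [X_pow_mul_C, C_mul_X_pow_eq_monomial]

variable {gr} in
theorem HFFR.poly [IsNoetherianRing R] (h : gr.HFFR) (w : ℤ) : (gr.poly w).HFFR := by
  classical
  intro ι _ a N hN
  obtain ⟨D, hD⟩ := extP_map_pt N
  rw [← hD]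
  refine FFR.quot (homM_pt a (D + 1)) ?_ ?_
  · obtain ⟨l, hl⟩ := h _ _ _ (homS_ND hN (D + 1) 0)
    exact ⟨l, hl.extP w⟩
  · obtain ⟨l, hl⟩ := h _ _ _ (homS_ND hN D w)
    refine ⟨l, ?_⟩
    rw [extP_inf_ker]
    exact (hl.extP w).map_inj (homM_jm a D) (fun x _ hx => jm_inj D x hx)

end step
end Gr
end AdjFac


namespace AdjFac
namespace Gr

section transport
variable {R R' : Type} [CommRing R] [CommRing R']

def mapE (gr : Gr R) (e : R ≃+* R') : Gr R' where
  c g := (e : R →+ R').comp ((gr.c g).comp (e.symm : R' →+ R))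
  fin x := by
    obtain ⟨s, h1, h2⟩ := gr.fin (e.symm x)
    refine ⟨s, fun g hg => ?_, ?_⟩
    · simp [h1 g hg]
    · simp only [AddMonoidHom.comp_apply, AddMonoidHom.coe_coe]
      rw [← map_sum, h2, e.apply_symm_apply]
  cc g h x := by
    simp only [AddMonoidHom.comp_apply, AddMonoidHom.coe_coe, e.symm_apply_apply, gr.cc]
    split_ifs <;> simp
  one := by simp [gr.one]
  mul g h x y hx := by
    simp only [AddMonoidHom.comp_apply, AddMonoidHom.coe_coe] at hx ⊢
    rw [map_mul, gr.mul g h _ _ (by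
      apply e.injective; rw [hx, e.apply_symm_apply]), map_mul, e.apply_symm_apply]

theorem mapE_c (gr : Gr R) (e : R ≃+* R') (g : ℤ) (x : R') :
    (gr.mapE e).c g x = e (gr.c g (e.symm x)) := rfl

/-- preimage submodule under a ring isomorphism -/
def pre (e : R ≃+* R') {ι : Type} (N : Submodule R' (ι → R')) : Submodule R (ι → R) where
  carrier := {x | (fun i => e (x i)) ∈ N}
  add_mem' {x y} hx hy := by
    have := N.add_mem hx hy
    simpa [Pi.add_def] using this
  zero_mem' := by
    show (fun i => e ((0 : ι → R) i)) ∈ N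
    simp only [Pi.zero_apply, map_zero]
    exact N.zero_mem
  smul_mem' r x hx := by
    have := N.smul_mem (e r) hx
    simpa [Pi.smul_def] using this

theorem FFR.mapE {gr : Gr R} (e : R ≃+* R') {l : ℕ} : ∀ {ι : Type} [Fintype ι] {a : ι → ℤ}
    {N : Submodule R' (ι → R')}, gr.FFR l ι a (pre e N) → (gr.mapE e).FFR l ι a N := by
  induction l with
  | zero =>
    intro ι _ a N h
    simp only [FFR] at h ⊢
    rw [eq_bot_iff] at h ⊢
    intro x hx
    have h1 : (fun i => e.symm (x i)) ∈ pre e N := by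
      show (fun i => e (e.symm (x i))) ∈ N
      simpa using hx
    have := h h1
    rw [Submodule.mem_bot] at this ⊢
    funext i
    have := congrFun this i
    simpa using this
  | succ l ih =>
    rintro ι _ a N ⟨κ, _, b, M, h1, h2, h3⟩
    have hmv : ∀ y : κ → R, (fun i => e (M.mulVec y i)) = (M.map e).mulVec (fun i => e (y i)) := by
      intro y; funext i
      simp [Matrix.mulVec, dotProduct]
    refine ⟨κ, inferInstance, b, M.map e, ?_, ?_, ih ?_⟩
    · intro i j
      rw [mapE_c, Matrix.map_apply, e.symm_apply_apply, h1 i j]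
    · ext x
      constructor
      · rintro ⟨y, rfl⟩
        have : M.mulVec (fun i => e.symm (y i)) ∈ pre e N := h2 ▸ ⟨_, rfl⟩
        have h5 : (fun i => e (M.mulVec (fun i => e.symm (y i)) i)) ∈ N := this
        rw [hmv] at h5
        simpa using h5
      · intro hx
        have h1 : (fun i => e.symm (x i)) ∈ pre e N := by
          show (fun i => e (e.symm (x i))) ∈ N
          simpa using hx
        rw [← h2] at h1
        obtain ⟨y, hy⟩ := h1
        refine ⟨fun i => e (y i), ?_⟩
        rw [Matrix.mulVecLin_apply] at hy ⊢
        rw [← hmv, hy]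
        simp
    · convert h3 using 1
      ext y
      show (fun i => e (y i)) ∈ LinearMap.ker (M.map e).mulVecLin ↔ _
      rw [LinearMap.mem_ker, LinearMap.mem_ker, Matrix.mulVecLin_apply, Matrix.mulVecLin_apply,
        ← hmv]
      constructor
      · intro h; funext i
        have := congrFun h i
        simpa using this
      · intro h; funext i; simp [h]

theorem HFFR.mapE {gr : Gr R} (h : gr.HFFR) (e : R ≃+* R') : (gr.mapE e).HFFR := by
  intro ι _ a N hN
  obtain ⟨l, hl⟩ := h ι a (pre e N) (by
    intro x hx β
    have h5 := hN _ hx β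
    show (fun i => e (gr.vc a β x i)) ∈ N
    convert h5 using 1
    funext i
    simp [vc, mapE_c])
  exact ⟨l, hl.mapE e⟩
end transport

theorem exists_gr (k : Type) [Field k] (σ : Type) [Finite σ] : ∀ (w : σ → ℤ),
    ∃ gr : Gr (MvPolynomial σ k), gr.HFFR ∧ (∀ r, gr.c 0 (MvPolynomial.C r) = MvPolynomial.C r) ∧
      ∀ i, gr.c (w i) (MvPolynomial.X i) = MvPolynomial.X i := by
  induction σ using Finite.induction_empty_option with
  | of_equiv e ih =>
    intro w
    obtain ⟨gr, h1, h2, h3⟩ := ih (w ∘ e)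
    refine ⟨gr.mapE (MvPolynomial.renameEquiv k e).toRingEquiv, h1.mapE _, ?_, ?_⟩
    · intro r
      rw [mapE_c]
      have : (MvPolynomial.renameEquiv k e).toRingEquiv.symm (MvPolynomial.C r) = MvPolynomial.C r := by
        rw [RingEquiv.symm_apply_eq]; simp
      rw [this, h2]
      simp
    · intro i
      rw [mapE_c]
      have : (MvPolynomial.renameEquiv k e).toRingEquiv.symm (MvPolynomial.X i) =
          MvPolynomial.X (e.symm i) := by
        rw [RingEquiv.symm_apply_eq]; simp
      rw [this]
      have h4 := h3 (e.symm i)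
      simp only [Function.comp_apply, Equiv.apply_symm_apply] at h4
      rw [h4]
      simp
  | h_empty =>
    intro w
    refine ⟨(triv k).mapE (MvPolynomial.isEmptyRingEquiv k PEmpty).symm, (hffr_triv k).mapE _, ?_,
      fun i => i.elim⟩
    intro r
    rw [mapE_c]
    simp [triv]
    exact MvPolynomial.coeff_zero_C r
  | h_option ih =>
    rename_i α _
    intro w
    obtain ⟨gr, h1, h2, h3⟩ := ih (w ∘ some)
    refine ⟨(gr.poly (w none)).mapE (MvPolynomial.optionEquivLeft k α).toRingEquiv.symm,
      (h1.poly _).mapE _, ?_, ?_⟩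
    · intro r
      rw [mapE_c, RingEquiv.symm_symm, RingEquiv.symm_apply_eq]
      simp only [AlgEquiv.toRingEquiv_eq_coe, AlgEquiv.coe_ringEquiv, MvPolynomial.optionEquivLeft_C]
      exact poly_C _ _ (h2 r)
    · intro i
      rw [mapE_c, RingEquiv.symm_symm, RingEquiv.symm_apply_eq]
      cases i with
      | none =>
        simp only [AlgEquiv.toRingEquiv_eq_coe, AlgEquiv.coe_ringEquiv,
          MvPolynomial.optionEquivLeft_X_none]
        exact poly_X _ _
      | some i =>
        simp only [AlgEquiv.toRingEquiv_eq_coe, AlgEquiv.coe_ringEquiv,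
          MvPolynomial.optionEquivLeft_X_some]
        exact poly_C _ _ (h3 i)

theorem hom_mul {R : Type} [CommRing R] {gr : Gr R} {g h : ℤ} {x y : R} (hx : gr.c g x = x)
    (hy : gr.c h y = y) : gr.c (g + h) (x * y) = x * y := by
  rw [gr.mul _ _ _ _ hx, add_sub_cancel_left, hy]

end Gr
end AdjFac

namespace AdjFac

structure GH (T : Type) [CommRing T] where
  H : ℤ → AddSubgroup T
  one : (1 : T) ∈ H 0
  mul : ∀ {i j : ℤ} {x y : T}, x ∈ H i → y ∈ H j → x * y ∈ H (i + j)

namespace GH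
variable {T : Type} [CommRing T] (gh : GH T)

/-- homogeneous matrices -/
def Hom {ι κ : Type} (a : ι → ℤ) (b : κ → ℤ) (M : Matrix ι κ T) : Prop :=
  ∀ i j, M i j ∈ gh.H (a i - b j)

variable {gh}

theorem Hom.mul {ι κ μ : Type} [Fintype κ] {a : ι → ℤ} {b : κ → ℤ} {c : μ → ℤ}
    {M : Matrix ι κ T} {N : Matrix κ μ T} (hM : gh.Hom a b M) (hN : gh.Hom b c N) :
    gh.Hom a c (M * N) := by
  intro i j
  rw [Matrix.mul_apply]
  refine AddSubgroup.sum_mem _ fun l _ => ?_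
  have := gh.mul (hM i l) (hN l j)
  rwa [sub_add_sub_cancel] at this

theorem Hom.one {ι : Type} [DecidableEq ι] {a : ι → ℤ} : gh.Hom a a (1 : Matrix ι ι T) := by
  intro i j
  rw [Matrix.one_apply]
  split_ifs with h
  · subst h; simpa using gh.one
  · exact zero_mem _

theorem Hom.zero {ι κ : Type} {a : ι → ℤ} {b : κ → ℤ} : gh.Hom a b (0 : Matrix ι κ T) :=
  fun _ _ => zero_mem _

theorem Hom.add {ι κ : Type} {a : ι → ℤ} {b : κ → ℤ} {M N : Matrix ι κ T}
    (hM : gh.Hom a b M) (hN : gh.Hom a b N) : gh.Hom a b (M + N) :=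
  fun i j => add_mem (hM i j) (hN i j)

theorem Hom.sub {ι κ : Type} {a : ι → ℤ} {b : κ → ℤ} {M N : Matrix ι κ T}
    (hM : gh.Hom a b M) (hN : gh.Hom a b N) : gh.Hom a b (M - N) :=
  fun i j => sub_mem (hM i j) (hN i j)

theorem Hom.fromBlocks {ι ι' κ κ' : Type} {a : ι → ℤ} {b : κ → ℤ} {a' : ι' → ℤ} {b' : κ' → ℤ}
    {A : Matrix ι κ T} {B : Matrix ι κ' T} {C : Matrix ι' κ T} {D : Matrix ι' κ' T}
    (hA : gh.Hom a b A) (hB : gh.Hom a b' B) (hC : gh.Hom a' b C) (hD : gh.Hom a' b' D) :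
    gh.Hom (Sum.elim a a') (Sum.elim b b') (Matrix.fromBlocks A B C D) := by
  rintro (i | i) (j | j)
  · exact hA i j
  · exact hB i j
  · exact hC i j
  · exact hD i j

end GH

/-- weighted idempotents -/
structure WI {T : Type} [CommRing T] (gh : GH T) where
  ι : Type
  ft : Fintype ι
  de : DecidableEq ι
  a : ι → ℤ
  e : Matrix ι ι T
  hom : gh.Hom a a e
  idem : e * e = e

namespace WI
variable {T : Type} [CommRing T] {gh : GH T}

instance (E : WI gh) : Fintype E.ι := E.ft
instance (E : WI gh) : DecidableEq E.ι := E.de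

def Eqv (E F : WI gh) : Prop :=
  ∃ (x : Matrix E.ι F.ι T) (y : Matrix F.ι E.ι T), gh.Hom E.a F.a x ∧ gh.Hom F.a E.a y ∧
    x * y = E.e ∧ y * x = F.e

theorem Eqv.refl (E : WI gh) : Eqv E E := ⟨E.e, E.e, E.hom, E.hom, E.idem, E.idem⟩

theorem Eqv.symm {E F : WI gh} : Eqv E F → Eqv F E := by
  rintro ⟨x, y, hx, hy, h1, h2⟩
  exact ⟨y, x, hy, hx, h2, h1⟩

theorem Eqv.trans {E F G : WI gh} : Eqv E F → Eqv F G → Eqv E G := by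
  rintro ⟨x, y, hx, hy, h1, h2⟩ ⟨x', y', hx', hy', h1', h2'⟩
  refine ⟨x * x', y' * y, hx.mul hx', hy'.mul hy, ?_, ?_⟩
  · calc x * x' * (y' * y) = x * (x' * y') * y := by simp only [Matrix.mul_assoc]
      _ = (x * y) * (x * y) := by rw [h1', ← h2]; simp only [Matrix.mul_assoc]
      _ = E.e := by rw [h1, E.idem]
  · calc y' * y * (x * x') = y' * (y * x) * x' := by simp only [Matrix.mul_assoc]
      _ = (y' * x') * (y' * x') := by rw [h2, ← h1']; simp only [Matrix.mul_assoc]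
      _ = G.e := by rw [h2', G.idem]

/-- direct sum -/
def sum (E F : WI gh) : WI gh where
  ι := E.ι ⊕ F.ι
  ft := inferInstance
  de := inferInstance
  a := Sum.elim E.a F.a
  e := Matrix.fromBlocks E.e 0 0 F.e
  hom := GH.Hom.fromBlocks E.hom .zero .zero F.hom
  idem := by rw [Matrix.fromBlocks_multiply]; simp [E.idem, F.idem]

theorem Eqv.sum {E E' F F' : WI gh} : Eqv E E' → Eqv F F' → Eqv (E.sum F) (E'.sum F') := by
  rintro ⟨x, y, hx, hy, h1, h2⟩ ⟨x', y', hx', hy', h1', h2'⟩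
  refine ⟨Matrix.fromBlocks x 0 0 x', Matrix.fromBlocks y 0 0 y',
    GH.Hom.fromBlocks hx .zero .zero hx', GH.Hom.fromBlocks hy .zero .zero hy', ?_, ?_⟩
  · refine (Matrix.fromBlocks_multiply x 0 0 x' y 0 0 y').trans ?_
    rw [h1, h1']; simp [WI.sum]
  · refine (Matrix.fromBlocks_multiply y 0 0 y' x 0 0 x').trans ?_
    rw [h2, h2']; simp [WI.sum]

theorem Eqv.of_equiv {E F : WI gh} (σ : E.ι ≃ F.ι) (ha : ∀ i, F.a (σ i) = E.a i)
    (he : ∀ i j, F.e (σ i) (σ j) = E.e i j) : Eqv E F := by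
  refine ⟨E.e.submatrix id σ.symm, E.e.submatrix σ.symm id, ?_, ?_, ?_, ?_⟩
  · intro i j
    have := E.hom i (σ.symm j)
    rwa [← ha (σ.symm j), σ.apply_symm_apply] at this
  · intro i j
    have := E.hom (σ.symm i) j
    rwa [← ha (σ.symm i), σ.apply_symm_apply] at this
  · rw [Matrix.submatrix_mul_equiv, E.idem]; rfl
  · rw [← Matrix.submatrix_mul _ _ _ id _ Function.bijective_id, E.idem]
    ext i j
    simp [← he]

theorem sum_comm (E F : WI gh) : Eqv (E.sum F) (F.sum E) :=
  Eqv.of_equiv (Equiv.sumComm _ _) (by rintro (i | i) <;> rfl)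
    (by rintro (i | i) (j | j) <;> rfl)

theorem sum_assoc (E F G : WI gh) : Eqv ((E.sum F).sum G) (E.sum (F.sum G)) :=
  Eqv.of_equiv (Equiv.sumAssoc _ _ _) (by rintro ((i | i) | i) <;> rfl)
    (by rintro ((i | i) | i) ((j | j) | j) <;> rfl)

/-- a homogeneous idempotent on the empty family -/
def zero (gh : GH T) : WI gh where
  ι := Empty
  ft := inferInstance
  de := inferInstance
  a := fun _ => 0
  e := 0
  hom := .zero
  idem := by simp

theorem eqv_zero (E : WI gh) (h : E.e = 0) : Eqv E (zero gh) :=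
  ⟨0, 0, .zero, .zero, by simp [h], Subsingleton.elim (α := Matrix Empty Empty T) _ _⟩

theorem zero_sum (E : WI gh) : Eqv ((zero gh).sum E) E :=
  Eqv.of_equiv (Equiv.emptySum Empty E.ι) (by rintro (i | i); exacts [i.elim, rfl])
    (by rintro (i | i) (j | j); exacts [i.elim, i.elim, j.elim, rfl])

instance setoid (gh : GH T) : Setoid (WI gh) := ⟨Eqv, Eqv.refl, Eqv.symm, Eqv.trans⟩

def M (gh : GH T) := Quotient (setoid gh)

def cls (E : WI gh) : M gh := Quotient.mk _ E

instance : Add (M gh) := ⟨Quotient.map₂ WI.sum (fun _ _ h _ _ h' => h.sum h')⟩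
instance : Zero (M gh) := ⟨cls (zero gh)⟩

instance : AddCommMonoid (M gh) where
  add_assoc := by
    rintro ⟨E⟩ ⟨F⟩ ⟨G⟩; exact Quotient.sound (sum_assoc E F G)
  add_comm := by
    rintro ⟨E⟩ ⟨F⟩; exact Quotient.sound (sum_comm E F)
  zero_add := by
    rintro ⟨E⟩; exact Quotient.sound (zero_sum E)
  add_zero := by
    rintro ⟨E⟩; exact Quotient.sound ((sum_comm _ _).trans (zero_sum E))
  nsmul := nsmulRec

theorem cls_add (E F : WI gh) : cls E + cls F = cls (E.sum F) := rfl
theorem cls_eq {E F : WI gh} : cls E = cls F ↔ Eqv E F := Quotient.eq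
theorem cls_zero {E : WI gh} (h : E.e = 0) : cls E = 0 := cls_eq.2 (eqv_zero E h)

/-- bundling -/
def of {ι : Type} [ft : Fintype ι] [de : DecidableEq ι] (a : ι → ℤ) (e : Matrix ι ι T)
    (hom : gh.Hom a a e) (idem : e * e = e) : WI gh := ⟨ι, ft, de, a, e, hom, idem⟩

theorem cls_of_add {ι : Type} [Fintype ι] [DecidableEq ι] (a : ι → ℤ) (e f g : Matrix ι ι T)
    (he : gh.Hom a a e) (hf : gh.Hom a a f) (hg : gh.Hom a a g)
    (ie : e * e = e) (jf : f * f = f) (ig : g * g = g) (hef : e * f = 0) (hfe : f * e = 0)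
    (h : g = e + f) : cls (of a g hg ig) = cls (of a e he ie) + cls (of a f hf jf) := by
  rw [cls_add, cls_eq]
  refine ⟨Matrix.fromCols e f, Matrix.fromRows e f, ?_, ?_, ?_, ?_⟩
  · rintro i (j | j)
    exacts [he i j, hf i j]
  · rintro (i | i) j
    exacts [he i j, hf i j]
  · refine (Matrix.fromCols_mul_fromRows e f e f).trans ?_
    rw [ie, jf, ← h]; rfl
  · refine (Matrix.fromRows_mul_fromCols e f e f).trans ?_
    rw [ie, jf, hef, hfe]; rfl

theorem cls_of_eq {ι κ : Type} [Fintype ι] [DecidableEq ι] [Fintype κ] [DecidableEq κ] {a : ι → ℤ}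
    {b : κ → ℤ} {e : Matrix ι ι T}
    {f : Matrix κ κ T} (he : gh.Hom a a e) (hf : gh.Hom b b f) (ie : e * e = e) (jf : f * f = f)
    (x : Matrix ι κ T) (y : Matrix κ ι T) (hx : gh.Hom a b x) (hy : gh.Hom b a y)
    (h1 : x * y = e) (h2 : y * x = f) : cls (of a e he ie) = cls (of b f hf jf) :=
  cls_eq.2 ⟨x, y, hx, hy, h1, h2⟩

def free (gh : GH T) {ι : Type} [Fintype ι] [DecidableEq ι] (a : ι → ℤ) : WI gh :=
  of a 1 .one (by simp)

/-- class of the free module -/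
def fr (gh : GH T) : Multiset ℤ →+ M gh where
  toFun P := (P.map fun p => cls (free gh fun _ : Unit => p)).sum
  map_zero' := by simp
  map_add' P Q := by simp

theorem fr_singleton (p : ℤ) : fr gh {p} = cls (free gh fun _ : Unit => p) := by
  exact Multiset.sum_singleton (cls (free gh fun _ : Unit => p))

theorem cls_free {ι : Type} [Fintype ι] [DecidableEq ι] (a : ι → ℤ) :
    cls (free gh a) = fr gh (Finset.univ.val.map a) := by
  have key : ∀ s : Finset ι, ∀ (h1 : gh.Hom a a (Matrix.diagonal fun i => if i ∈ s then (1 : T) else 0))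
      h2, cls (of a (Matrix.diagonal fun i => if i ∈ s then (1 : T) else 0) h1 h2)
        = fr gh (s.val.map a) := by
    intro s
    induction s using Finset.induction_on with
    | empty =>
      intro h1 h2
      rw [cls_zero]
      · exact (map_zero (fr gh)).symm
      · change Matrix.diagonal _ = (0 : Matrix ι ι T)
        simp
    | insert i s his ih =>
      intro h1 h2
      have hd : ∀ s : Finset ι, gh.Hom a a (Matrix.diagonal fun i => if i ∈ s then (1 : T) else 0) := by
        intro s i j
        by_cases hij : i = j
        · subst hij
          rw [Matrix.diagonal_apply_eq]
          split_ifs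
          · simpa using gh.one
          · exact zero_mem _
        · rw [Matrix.diagonal_apply_ne _ hij]; exact zero_mem _
      have hi : ∀ s : Finset ι, (Matrix.diagonal fun i => if i ∈ s then (1 : T) else 0) *
          (Matrix.diagonal fun i => if i ∈ s then (1 : T) else 0) = 
          (Matrix.diagonal fun i => if i ∈ s then (1 : T) else 0) := by
        intro s; rw [Matrix.diagonal_mul_diagonal]; congr 1; ext i; split_ifs <;> simp
      rw [cls_of_add a _ _ _ (hd {i}) (hd s) h1 (hi _) (hi _) h2, ih, Finset.insert_val_of_notMem his,
        Multiset.map_cons, ← Multiset.singleton_add, map_add, fr_singleton]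
      · congr 1
        refine cls_of_eq _ _ _ _ (Matrix.of fun j _ => if j = i then 1 else 0)
          (Matrix.of fun _ j => if j = i then 1 else 0) ?_ ?_ ?_ ?_
        · intro j _
          simp only [Matrix.of_apply]
          split_ifs with h
          · subst h; simpa using gh.one
          · exact zero_mem _
        · intro _ j
          simp only [Matrix.of_apply]
          split_ifs with h
          · subst h; simpa using gh.one
          · exact zero_mem _
        · ext j l
          simp [Matrix.mul_apply, Matrix.diagonal_apply]
          grind
        · ext j l
          simp [Matrix.mul_apply]
      · rw [Matrix.diagonal_mul_diagonal]; ext j l; simp [Matrix.diagonal_apply]; grind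
      · rw [Matrix.diagonal_mul_diagonal]; ext j l; simp [Matrix.diagonal_apply]; grind
      · ext j l; simp [Matrix.diagonal_apply]; grind
  have h1 : (Matrix.diagonal fun i => if i ∈ (Finset.univ : Finset ι) then (1 : T) else 0) = 1 := by
    simp
  have := key Finset.univ (by rw [h1]; exact .one) (by rw [h1]; simp)
  rw [← this]
  simp only [free, h1]

theorem exists_free (P : Multiset ℤ) : ∃ (l : ℕ) (a : Fin l → ℤ), Finset.univ.val.map a = P := by
  refine ⟨P.toList.length, P.toList.get, ?_⟩
  conv_rhs => rw [← Multiset.coe_toList P]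
  rw [Fin.univ_val_map, List.ofFn_get]

theorem cls_compl {ι : Type} [Fintype ι] [DecidableEq ι] {a : ι → ℤ} {e : Matrix ι ι T}
    (he : gh.Hom a a e) (ie : e * e = e) (hf : gh.Hom a a (1 - e)) (jf : (1 - e) * (1 - e) = 1 - e) :
    cls (of a e he ie) + cls (of a (1 - e) hf jf) = fr gh (Finset.univ.val.map a) := by
  rw [← cls_free, free, ← cls_of_add]
  · rw [mul_sub, ie]; simp
  · rw [sub_mul, ie]; simp
  · simp

end WI
end AdjFac

namespace AdjFac
namespace Gr
variable {S T : Type} [CommRing S] [CommRing T] [IsDomain T] [Algebra S T]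
  (gr : Gr S) (s : S) (hs : gr.c 0 s = s)

theorem pow_hom {gr : Gr S} {s : S} (hs : gr.c 0 s = s) (D : ℕ) : gr.c 0 (s ^ D) = s ^ D := by
  induction D with
  | zero => simpa using gr.one
  | succ D ih => rw [pow_succ, gr.mul 0 0 _ _ ih, sub_zero, hs]

theorem c_mul_zero {gr : Gr S} {z : S} (hz : gr.c 0 z = z) (k : ℤ) (x : S) :
    gr.c k (z * x) = z * gr.c k x := by
  rw [gr.mul _ _ _ _ hz, sub_zero]

/-- localized grading -/
def toGH (T : Type) [CommRing T] [IsDomain T] [Algebra S T] : GH T where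
  H k := 
    { carrier := {x | ∃ D p, gr.c k p = p ∧ algebraMap S T (s ^ D) * x = algebraMap S T p}
      zero_mem' := ⟨0, 0, by simp, by simp⟩
      add_mem' := by
        rintro x y ⟨D, p, hp, hx⟩ ⟨D', p', hp', hx'⟩
        refine ⟨D + D', s ^ D' * p + s ^ D * p', ?_, ?_⟩
        · rw [map_add, c_mul_zero (pow_hom hs _), c_mul_zero (pow_hom hs _), hp, hp']
        · rw [map_add, map_mul, map_mul, ← hx, ← hx', pow_add, map_mul]; ring
      neg_mem' := by
        rintro x ⟨D, p, hp, hx⟩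
        exact ⟨D, -p, by rw [map_neg, hp], by rw [mul_neg, hx, map_neg]⟩ }
  one := ⟨0, 1, gr.one, by simp⟩
  mul := by
    rintro i j x y ⟨D, p, hp, hx⟩ ⟨D', p', hp', hx'⟩
    refine ⟨D + D', p * p', ?_, ?_⟩
    · rw [gr.mul _ _ _ _ hp, add_sub_cancel_left, hp']
    · rw [map_mul, ← hx, ← hx', pow_add, map_mul]; ring

variable {gr s hs}

theorem mem_H {k : ℤ} {x : T} : x ∈ (gr.toGH s hs T).H k ↔
    ∃ D p, gr.c k p = p ∧ algebraMap S T (s ^ D) * x = algebraMap S T p := Iff.rfl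

theorem mem_H_of_hom {k : ℤ} {p : S} (hp : gr.c k p = p) :
    algebraMap S T p ∈ (gr.toGH s hs T).H k := mem_H.2 ⟨0, p, hp, by simp⟩

theorem hom_of_mem_H (hinj : Function.Injective (algebraMap S T)) (h0 : s ≠ 0)
    {k : ℤ} {x : T} (hx : x ∈ (gr.toGH s hs T).H k) {D : ℕ} {p : S}
    (h : algebraMap S T (s ^ D) * x = algebraMap S T p) : gr.c k p = p := by
  obtain ⟨D', p', hp', h'⟩ := hx
  have e1 : s ^ D' * p = s ^ D * p' := by
    apply hinj
    rw [map_mul, map_mul, ← h, ← h']; ring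
  have : IsDomain S := hinj.isDomain (algebraMap S T)
  apply mul_left_cancel₀ (pow_ne_zero D' h0)
  rw [← c_mul_zero (pow_hom hs _), e1, c_mul_zero (pow_hom hs _), hp']

theorem exists_clear {ι κ : Type} [Fintype ι] [Fintype κ] {a : ι → ℤ} {b : κ → ℤ}
    {M : Matrix ι κ T} (hM : (gr.toGH s hs T).Hom a b M) :
    ∃ (D : ℕ) (A : Matrix ι κ S), gr.HomM a b A ∧
      ∀ i j, algebraMap S T (A i j) = algebraMap S T (s ^ D) * M i j := by
  choose D p hp h using fun i j => mem_H.1 (hM i j)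
  refine ⟨∑ i, ∑ j, D i j, Matrix.of fun i j => s ^ ((∑ i, ∑ j, D i j) - D i j) * p i j, ?_, ?_⟩
  · intro i j
    rw [Matrix.of_apply, c_mul_zero (pow_hom hs _), hp]
  · intro i j
    rw [Matrix.of_apply, map_mul, ← h, ← mul_assoc, ← map_mul, ← pow_add, Nat.sub_add_cancel]
    exact (Finset.single_le_sum (f := fun j => D i j) (fun _ _ => Nat.zero_le _)
      (Finset.mem_univ j)).trans
      (Finset.single_le_sum (f := fun i => ∑ j, D i j) (fun _ _ => Nat.zero_le _)
      (Finset.mem_univ i))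

theorem map_mulVec_alg {ι κ : Type} [Fintype κ] (A : Matrix ι κ S) (x : κ → S) (i : ι) :
    algebraMap S T (A.mulVec x i) =
      ((A.map (algebraMap S T)).mulVec (fun j => algebraMap S T (x j))) i := by
  simp [Matrix.mulVec, dotProduct]

theorem FFR.stab (hinj : Function.Injective (algebraMap S T)) (h0 : s ≠ 0)
    (hu : ∃ t : T, algebraMap S T s * t = 1) (l : ℕ) :
    ∀ (ι : Type) [Fintype ι] [DecidableEq ι] (a : ι → ℤ) (N : Submodule S (ι → S)),
    gr.FFR l ι a N → ∀ (ε : Matrix ι ι T) (he : (gr.toGH s hs T).Hom a a ε) (ie : ε * ε = ε),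
    (∃ D : ℕ, ∀ j, ∃ x ∈ N, ∀ i, algebraMap S T (x i) = algebraMap S T (s ^ D) * ε i j) →
    (∀ x ∈ N, ε.mulVec (fun i => algebraMap S T (x i)) = fun i => algebraMap S T (x i)) →
    ∃ P Q : Multiset ℤ, WI.cls (WI.of a ε he ie) + WI.fr _ Q = WI.fr _ P := by
  obtain ⟨t, ht⟩ := hu
  have hsD : ∀ D : ℕ, algebraMap S T (s ^ D) * t ^ D = 1 := by
    intro D; rw [map_pow, ← mul_pow, ht, one_pow]
  have hcan : ∀ (D : ℕ) (x y : T), algebraMap S T (s ^ D) * x = algebraMap S T (s ^ D) * y → x = y := by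
    intro D x y h
    calc x = algebraMap S T (s ^ D) * t ^ D * x := by rw [hsD, one_mul]
      _ = t ^ D * (algebraMap S T (s ^ D) * x) := by ring
      _ = algebraMap S T (s ^ D) * t ^ D * y := by rw [h]; ring
      _ = y := by rw [hsD, one_mul]
  induction l with
  | zero =>
    intro ι _ _ a N hN ε he ie ⟨D, hD⟩ hx
    have hN : N = ⊥ := hN
    refine ⟨0, 0, ?_⟩
    rw [WI.cls_zero, map_zero, zero_add]
    change ε = 0
    ext i j
    obtain ⟨x, hxN, hx⟩ := hD j
    rw [hN, Submodule.mem_bot] at hxN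
    apply hcan D
    rw [← hx, hxN]; simp
  | succ l ih =>
    intro ι _ _ a N hN ε he ie ⟨D, hD⟩ hx
    obtain ⟨κ, _, b, M, hM, hr, hker⟩ := hN
    classical
    choose x hxN hx' using hD
    set φ := M.map (algebraMap S T) with hφ
    have h1 : ∀ j, ∃ y : κ → S, (∀ i, gr.c (b i - a j) (y i) = y i) ∧ M.mulVec y = x j := by
      intro j
      have := hxN j
      rw [← hr] at this
      obtain ⟨y, hy⟩ := this
      refine ⟨gr.vc b (a j) y, ?_, ?_⟩
      · intro i; simp only [vc]; rw [gr.cc, if_pos rfl]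
      · rw [← vc_mulVec hM]
        rw [Matrix.mulVecLin_apply] at hy
        rw [hy]
        funext i
        exact hom_of_mem_H hinj h0 (he i j) (hx' j i).symm
    choose y hy hMy using h1
    let τ : Matrix κ ι T := Matrix.of fun i j => t ^ D * algebraMap S T (y j i)
    have hτ : (gr.toGH s hs T).Hom b a τ := by
      intro i j
      refine mem_H.2 ⟨D, y j i, hy j i, ?_⟩
      simp only [τ, Matrix.of_apply]
      rw [← mul_assoc, hsD, one_mul]
    have hφH : (gr.toGH s hs T).Hom a b φ := fun i j => mem_H_of_hom (hM i j)
    have hφτ : φ * τ = ε := by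
      ext i j
      apply hcan D
      rw [← hx' j i, ← hMy, map_mulVec_alg]
      simp only [τ, Matrix.mul_apply, Matrix.of_apply, Matrix.mulVec, dotProduct, Finset.mul_sum, ← hφ]
      refine Finset.sum_congr rfl fun l _ => ?_
      calc _ = (algebraMap S T (s ^ D) * t ^ D) * (φ i l * algebraMap S T (y j l)) := by ring
        _ = _ := by rw [hsD, one_mul]
    have hεφ : ε * φ = φ := by
      ext i j
      have hmem : M.mulVec (Pi.single j 1) ∈ N := by
        rw [← hr]; exact ⟨_, rfl⟩
      have := congrFun (hx _ hmem) i
      rw [Matrix.mulVec_single_one] at this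
      exact this
    have hπ : (τ * φ) * (τ * φ) = τ * φ := by
      calc (τ * φ) * (τ * φ) = τ * ((φ * τ) * φ) := by simp only [Matrix.mul_assoc]
        _ = _ := by rw [hφτ, hεφ]
    have hπ' : (1 - τ * φ) * (1 - τ * φ) = 1 - τ * φ := by
      rw [sub_mul, mul_sub, mul_sub, hπ]; simp
    have hH := hτ.mul hφH
    have hH' := GH.Hom.sub GH.Hom.one hH
    obtain ⟨P, Q, hPQ⟩ := ih κ b _ hker (1 - τ * φ) hH' hπ' (by
      obtain ⟨D', A, hA, hA'⟩ := exists_clear hH'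
      refine ⟨D', fun j => ⟨fun i => A i j, ?_, fun i => hA' i j⟩⟩
      rw [LinearMap.mem_ker, Matrix.mulVecLin_apply]
      funext i
      apply hinj
      rw [map_mulVec_alg, ← hφ]
      simp only [hA', Pi.zero_apply, map_zero]
      have : (φ * (1 - τ * φ) : Matrix ι κ T) i j = 0 := by
        rw [Matrix.mul_sub, ← Matrix.mul_assoc, hφτ, hεφ]; simp
      rw [Matrix.mul_apply] at this
      simp only [Matrix.mulVec, dotProduct]
      calc _ = algebraMap S T (s ^ D') * ∑ l, φ i l * (1 - τ * φ : Matrix κ κ T) l j := by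
            rw [Finset.mul_sum]; exact Finset.sum_congr rfl fun l _ => by ring
        _ = 0 := by rw [this, mul_zero]) (by
      intro z hz
      rw [LinearMap.mem_ker, Matrix.mulVecLin_apply] at hz
      have : φ.mulVec (fun i => algebraMap S T (z i)) = 0 := by
        funext i
        rw [hφ, ← map_mulVec_alg, hz]; simp
      rw [Matrix.sub_mulVec, ← Matrix.mulVec_mulVec, this]
      simp)
    refine ⟨Finset.univ.val.map b + Q, P, ?_⟩
    have e1 : WI.cls (WI.of a ε he ie) = WI.cls (WI.of b (τ * φ) hH hπ) :=
      WI.cls_of_eq _ _ _ _ φ τ hφH hτ hφτ rfl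
    rw [map_add, ← WI.cls_compl hH hπ hH' hπ', e1, ← hPQ, add_assoc]

theorem HFFR.stab (h : gr.HFFR) (hinj : Function.Injective (algebraMap S T)) (h0 : s ≠ 0)
    (hu : ∃ t : T, algebraMap S T s * t = 1) (E : WI (gr.toGH s hs T)) :
    ∃ P Q : Multiset ℤ, WI.cls E + WI.fr _ Q = WI.fr _ P := by
  obtain ⟨D, A, hA, hA'⟩ := exists_clear E.hom
  obtain ⟨l, hl⟩ := h E.ι E.a (LinearMap.range A.mulVecLin) (by
    rintro _ ⟨x, rfl⟩ β
    rw [Matrix.mulVecLin_apply, vc_mulVec hA]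
    exact ⟨_, rfl⟩)
  refine FFR.stab (hs := hs) hinj h0 hu l E.ι E.a _ hl E.e E.hom E.idem ⟨D, fun j => ?_⟩ ?_
  · refine ⟨A.mulVec (Pi.single j 1), ⟨_, rfl⟩, fun i => ?_⟩
    rw [Matrix.mulVec_single_one]
    exact hA' i j
  · rintro _ ⟨x, rfl⟩
    have : A.map (algebraMap S T) = algebraMap S T (s ^ D) • E.e := by
      ext i j; simp [hA']
    have h2 : (fun i => algebraMap S T ((A.mulVecLin x) i)) = 
      (A.map (algebraMap S T)).mulVec (fun j => algebraMap S T (x j)) := by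
      funext i; rw [Matrix.mulVecLin_apply, map_mulVec_alg]
    rw [h2, Matrix.mulVec_mulVec, this, Matrix.mul_smul, E.idem]

end Gr
end AdjFac

namespace AdjFac

section CB
variable {T : Type} [CommRing T]

theorem det_mul_rows {ι : Type} [Fintype ι] [DecidableEq ι] {m : ℕ} (M : Matrix (Fin m) ι T)
    (N : Matrix ι (Fin m) T) :
    (M * N).det = ∑ J : Fin m → ι, (∏ k, M k (J k)) * (N.submatrix J id).det := by
  have h : (M * N) = fun k => ∑ j, M k j • N j := by
    funext k l
    simp [Matrix.mul_apply]
  rw [h]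
  change Matrix.detRowAlternating.toMultilinearMap _ = _
  rw [MultilinearMap.map_sum]
  refine Finset.sum_congr rfl fun J _ => ?_
  rw [MultilinearMap.map_smul_univ]
  rfl

theorem det_perm_rows {ι : Type} {m : ℕ} (N : Matrix ι (Fin m) T) (J : Fin m → ι)
    (σ : Equiv.Perm (Fin m)) : (N.submatrix (J ∘ σ) id).det
      = (Equiv.Perm.sign σ : ℤ) * (N.submatrix J id).det := by
  have := Matrix.det_permute σ (N.submatrix J id)
  rw [← this]; rfl

theorem cauchyBinet {ι : Type} [Fintype ι] [DecidableEq ι] {m : ℕ} (M : Matrix (Fin m) ι T)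
    (N : Matrix ι (Fin m) T) :
    ∑ J : Fin m → ι, (M.submatrix id J).det * (N.submatrix J id).det
      = (m.factorial : T) * (M * N).det := by
  have h1 : ∀ J : Fin m → ι, (M.submatrix id J).det * (N.submatrix J id).det =
      ∑ σ : Equiv.Perm (Fin m), (∏ k, M k ((J ∘ σ) k)) * (N.submatrix (J ∘ σ) id).det := by
    intro J
    rw [← Matrix.det_transpose (M.submatrix id J), Matrix.det_apply, Finset.sum_mul]
    refine Finset.sum_congr rfl fun σ _ => ?_
    rw [det_perm_rows]
    simp only [Matrix.transpose_apply, Matrix.submatrix_apply, id, Function.comp]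
    rw [Units.smul_def, zsmul_eq_mul]
    ring
  simp only [h1]
  rw [Finset.sum_comm]
  have h2 : ∀ σ : Equiv.Perm (Fin m), ∑ J : Fin m → ι, (∏ k, M k ((J ∘ σ) k)) * (N.submatrix (J ∘ σ) id).det
      = (M * N).det := by
    intro σ
    rw [det_mul_rows]
    exact Fintype.sum_equiv (Equiv.arrowCongr σ.symm (Equiv.refl ι)) _ _ (fun J => by
      rfl)
  simp only [h2]
  simp [Fintype.card_perm]

/-- compound matrices -/
def cmp (m : ℕ) {ι κ : Type} (A : Matrix ι κ T) : Matrix (Fin m → ι) (Fin m → κ) T :=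
  Matrix.of fun I J => (A.submatrix I J).det

theorem cmp_mul (m : ℕ) {ι κ μ : Type} [Fintype κ] [DecidableEq κ] (A : Matrix ι κ T) (B : Matrix κ μ T) :
    cmp m A * cmp m B = (m.factorial : T) • cmp m (A * B) := by
  ext I K
  rw [Matrix.mul_apply, Matrix.smul_apply, smul_eq_mul]
  simp only [cmp, Matrix.of_apply]
  rw [Matrix.submatrix_mul A B I id K Function.bijective_id, ← cauchyBinet]
  rfl

theorem GH.prod_mem (gh : GH T) {ι : Type} (s : Finset ι) (x : ι → T) (w : ι → ℤ)
    (h : ∀ i ∈ s, x i ∈ gh.H (w i)) : ∏ i ∈ s, x i ∈ gh.H (∑ i ∈ s, w i) := by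
  classical
  induction s using Finset.induction_on with
  | empty => simpa using gh.one
  | insert i s hi ih =>
    rw [Finset.prod_insert hi, Finset.sum_insert hi]
    exact gh.mul (h i (by simp)) (ih fun j hj => h j (by simp [hj]))

theorem GH.Hom.cmp {gh : GH T} (m : ℕ) {ι κ : Type} {a : ι → ℤ} {b : κ → ℤ} {A : Matrix ι κ T}
    (hA : gh.Hom a b A) :
    gh.Hom (fun I : Fin m → ι => ∑ k, a (I k)) (fun J : Fin m → κ => ∑ k, b (J k)) (cmp m A) := by
  intro I J
  simp only [AdjFac.cmp, Matrix.of_apply]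
  rw [Matrix.det_apply]
  refine AddSubgroup.sum_mem _ fun σ _ => ?_
  rw [Units.smul_def]
  refine AddSubgroup.zsmul_mem _ ?_ _
  have := gh.prod_mem Finset.univ (fun k => A.submatrix I J (σ k) k)
    (fun k => a (I (σ k)) - b (J k)) (fun k _ => hA _ _)
  rw [Finset.sum_sub_distrib] at this
  rwa [Equiv.sum_comp σ (fun k => a (I k))] at this

theorem GH.Hom.smul {gh : GH T} {ι κ : Type} {a : ι → ℤ} {b : κ → ℤ} {A : Matrix ι κ T}
    (hA : gh.Hom a b A) {c : T} (hc : c ∈ gh.H 0) : gh.Hom a b (c • A) := by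
  intro i j
  have := gh.mul hc (hA i j)
  rwa [zero_add] at this

end CB

namespace WI
variable {T : Type} [Field T] [CharZero T] {gh : GH T}

/-- weight shift -/
def shift (q : ℤ) (E : WI gh) : WI gh :=
  ⟨E.ι, E.ft, E.de, fun i => E.a i + q, E.e, fun i j => by
    have := E.hom i j
    rwa [← add_sub_add_right_eq_sub _ _ q] at this, E.idem⟩

theorem Eqv.shift {E F : WI gh} (h : Eqv E F) (q : ℤ) : Eqv (shift q E) (shift q F) := by
  obtain ⟨x, y, hx, hy, h1, h2⟩ := h
  refine ⟨x, y, fun i j => ?_, fun i j => ?_, h1, h2⟩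
  · have := hx i j
    rwa [← add_sub_add_right_eq_sub _ _ q] at this
  · have := hy i j
    rwa [← add_sub_add_right_eq_sub _ _ q] at this

/-- shift on classes -/
def sh (q : ℤ) : M gh →+ M gh where
  toFun := Quotient.map (shift q) (fun _ _ h => h.shift q)
  map_zero' := Quotient.sound (eqv_zero _ rfl)
  map_add' := by
    rintro ⟨E⟩ ⟨F⟩
    refine Quotient.sound (Eqv.of_equiv (Equiv.refl _) ?_ ?_)
    · rintro (i | i) <;> rfl
    · rintro (i | i) (j | j) <;> rfl

theorem sh_cls (q : ℤ) (E : WI gh) : sh q (cls E) = cls (shift q E) := rfl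

theorem sh_fr (q : ℤ) (P : Multiset ℤ) : sh q (fr gh P) = fr gh (P.map (· + q)) := by
  induction P using Multiset.induction_on with
  | empty => simp
  | cons p P ih =>
    rw [Multiset.map_cons, ← Multiset.singleton_add, ← Multiset.singleton_add, map_add, map_add,
      map_add, ih, fr_singleton, fr_singleton]
    rfl

variable (hQ : ∀ m : ℕ, (m : T)⁻¹ ∈ gh.H 0)

/-- exterior powers -/
def lam (m : ℕ) (E : WI gh) : WI gh :=
  of (fun I : Fin m → E.ι => ∑ k, E.a (I k)) (((m.factorial : ℕ) : T)⁻¹ • cmp m E.e)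
    ((E.hom.cmp m).smul (hQ _)) (by
      rw [Matrix.smul_mul, Matrix.mul_smul, cmp_mul, E.idem, smul_smul, smul_smul,
        inv_mul_cancel_right₀]
      exact_mod_cast Nat.factorial_ne_zero m)

theorem Eqv.lam {E F : WI gh} (h : Eqv E F) (m : ℕ) : Eqv (lam hQ m E) (lam hQ m F) := by
  obtain ⟨x, y, hx, hy, h1, h2⟩ := h
  have h0 : ((m.factorial : ℕ) : T) ≠ 0 := by exact_mod_cast Nat.factorial_ne_zero m
  refine ⟨((m.factorial : ℕ) : T)⁻¹ • cmp m x, ((m.factorial : ℕ) : T)⁻¹ • cmp m y, 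
    (hx.cmp m).smul (hQ _), (hy.cmp m).smul (hQ _), ?_, ?_⟩
  · refine (Matrix.smul_mul _ (cmp m x) (((m.factorial : ℕ) : T)⁻¹ • cmp m y)).trans ?_
    rw [Matrix.mul_smul, cmp_mul, h1, inv_smul_smul₀ h0]; rfl
  · refine (Matrix.smul_mul _ (cmp m y) (((m.factorial : ℕ) : T)⁻¹ • cmp m x)).trans ?_
    rw [Matrix.mul_smul, cmp_mul, h2, inv_smul_smul₀ h0]; rfl

theorem lam_zero (E : WI gh) : cls (lam hQ 0 E) = fr gh {0} := by
  rw [fr_singleton]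
  refine cls_of_eq _ _ _ _ (Matrix.of fun _ _ => 1) (Matrix.of fun _ _ => 1) ?_ ?_ ?_ ?_
  · intro i j; simpa using gh.one
  · intro i j; simpa using gh.one
  · ext i j; simp [Matrix.mul_apply, cmp]
  · ext i j; simp [Matrix.mul_apply]

end WI
end AdjFac

namespace AdjFac

section comb
variable {T : Type} [CommRing T] {ι : Type} [Fintype ι] [DecidableEq ι]

theorem sum_nostar {m : ℕ} (G : (Fin m → ι ⊕ Unit) → T) (hG : ∀ J k, J k = Sum.inr () → G J = 0) :
    ∑ J, G J = ∑ J : Fin m → ι, G (fun k => Sum.inl (J k)) := by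
  refine (Fintype.sum_of_injective (fun (J : Fin m → ι) k => (Sum.inl (J k) : ι ⊕ Unit)) ?_ _ _ ?_ ?_).symm
  · intro J J' h
    funext k
    simpa using congrFun h k
  · intro J hJ
    by_contra hne
    apply hJ
    have : ∀ k, ∃ i, J k = Sum.inl i := by
      intro k
      rcases h : J k with i | u
      · exact ⟨i, rfl⟩
      · exact absurd (hG J k h) hne
    choose f hf using this
    exact ⟨f, funext fun k => (hf k).symm⟩
  · intro J; rfl

theorem sum_star {m : ℕ} (F : (Fin (m + 1) → ι ⊕ Unit) → T)
    (hF : ∀ J, ¬ Function.Injective J → F J = 0)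
    (hσ : ∀ J (σ : Equiv.Perm (Fin (m + 1))), F (J ∘ σ) = F J) :
    ∑ J, F J = ∑ J : Fin (m + 1) → ι, F (fun k => Sum.inl (J k)) +
      ((m + 1 : ℕ) : T) * ∑ J : Fin m → ι, F (Fin.cons (Sum.inr ()) fun k => Sum.inl (J k)) := by
  have h1 : ∀ J, F J = (if ∀ k, J k ≠ Sum.inr () then F J else 0) +
      ∑ k, if J k = Sum.inr () then F J else 0 := by
    intro J
    by_cases hJ : Function.Injective J
    · by_cases h : ∀ k, J k ≠ Sum.inr ()
      · rw [if_pos h, Finset.sum_eq_zero, add_zero]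
        intro k _; rw [if_neg (h k)]
      · rw [if_neg h, zero_add]
        push Not at h
        obtain ⟨k, hk⟩ := h
        rw [Finset.sum_eq_single k, if_pos hk]
        · intro l _ hl
          rw [if_neg]
          intro h; exact hl (hJ (h.trans hk.symm))
        · simp
    · simp [hF J hJ]
  have h2 : ∀ k, ∑ J, (if J k = Sum.inr () then F J else 0) =
      ∑ J : Fin m → ι, F (Fin.cons (Sum.inr ()) fun k => Sum.inl (J k)) := by
    intro k
    have e1 : ∑ J, (if J k = Sum.inr () then F J else 0) = ∑ J, (if J 0 = Sum.inr () then F J else 0) := by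
      refine Fintype.sum_equiv (Equiv.arrowCongr (Equiv.swap 0 k) (Equiv.refl _)) _ _ (fun J => ?_)
      have : (Equiv.arrowCongr (Equiv.swap 0 k) (Equiv.refl (ι ⊕ Unit))) J = J ∘ (Equiv.swap 0 k) := by
        rfl
      rw [this, hσ]
      simp
    rw [e1, ← (Fin.consEquiv fun _ => ι ⊕ Unit).sum_comp, Fintype.sum_prod_type]
    simp only [Fin.consEquiv_apply, Fin.cons_zero]
    rw [Fintype.sum_sum_type]
    simp only [reduceCtorEq, if_false, Finset.sum_const_zero, zero_add, if_true, Finset.univ_unique,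
      Finset.sum_singleton, PUnit.default_eq_unit]
    refine sum_nostar (fun J => F (Fin.cons (Sum.inr ()) J)) ?_
    intro J l hl
    apply hF
    intro hinj
    have := @hinj 0 l.succ (by simp [hl])
    exact absurd this.symm (Fin.succ_ne_zero l)
  calc ∑ J, F J = ∑ J, (if ∀ k, J k ≠ Sum.inr () then F J else 0) +
        ∑ J, ∑ k, (if J k = Sum.inr () then F J else 0) := by
        rw [← Finset.sum_add_distrib]; exact Finset.sum_congr rfl fun J _ => h1 J
    _ = _ := by
      congr 1
      · rw [sum_nostar]
        · simp
        · intro J k hk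
          rw [if_neg]; push Not; exact ⟨k, hk⟩
      · rw [Finset.sum_comm]
        simp only [h2]
        simp
end comb

namespace WI
variable {T : Type} [Field T] [CharZero T] {gh : GH T}
variable (hQ : ∀ m : ℕ, (m : T)⁻¹ ∈ gh.H 0)

theorem lam_sum_unit (E : WI gh) (q : ℤ) (m : ℕ) :
    cls (lam hQ (m + 1) (E.sum (free gh fun _ : Unit => q))) =
      cls (lam hQ (m + 1) E) + cls (shift q (lam hQ m E)) := by
  rw [cls_add, cls_eq]
  let ι := E.ι
  let g : Matrix (ι ⊕ Unit) (ι ⊕ Unit) T := Matrix.fromBlocks E.e 0 0 1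
  have hg : gh.Hom (Sum.elim E.a fun _ => q) (Sum.elim E.a fun _ => q) g := 
    GH.Hom.fromBlocks E.hom .zero .zero .one
  have ig : g * g = g := by
    simp only [g]; rw [Matrix.fromBlocks_multiply]; simp [E.idem]
  let emb : (Fin (m + 1) → ι) ⊕ (Fin m → ι) → (Fin (m + 1) → ι ⊕ Unit) :=
    Sum.elim (fun J k => Sum.inl (J k)) (fun J => Fin.cons (Sum.inr ()) fun k => Sum.inl (J k))
  let c : T := (((m + 1).factorial : ℕ) : T)⁻¹
  let c' : T := ((m.factorial : ℕ) : T)⁻¹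
  have f0 : (((m + 1).factorial : ℕ) : T) ≠ 0 := by exact_mod_cast Nat.factorial_ne_zero _
  have f1 : ((m.factorial : ℕ) : T) ≠ 0 := by exact_mod_cast Nat.factorial_ne_zero _
  have hc : c ∈ gh.H 0 := hQ _
  have hc' : c' ∈ gh.H 0 := hQ _
  let x : Matrix (Fin (m + 1) → ι ⊕ Unit) ((Fin (m + 1) → ι) ⊕ (Fin m → ι)) T :=
    Matrix.of fun I α => c * cmp (m + 1) g I (emb α)
  let y : Matrix ((Fin (m + 1) → ι) ⊕ (Fin m → ι)) (Fin (m + 1) → ι ⊕ Unit) T :=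
    Matrix.of fun α I => (Sum.elim (fun _ => c) (fun _ => c') α : T) * cmp (m + 1) g (emb α) I
  let A : (Fin (m + 1) → ι ⊕ Unit) → ℤ := fun I => ∑ k, (Sum.elim E.a (fun _ => q) : ι ⊕ Unit → ℤ) (I k)
  let B : (Fin (m + 1) → ι) ⊕ (Fin m → ι) → ℤ :=
    Sum.elim (fun J => ∑ k, E.a (J k)) (fun J => ∑ k, E.a (J k) + q)
  have hAB : ∀ α, A (emb α) = B α := by
    rintro (J | J)
    · simp [A, B, emb]
    · simp [A, B, emb, Fin.sum_univ_succ, add_comm]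
  have hx : gh.Hom A B x := by
    intro I α
    have := gh.mul hc (hg.cmp (m + 1) I (emb α))
    rw [zero_add] at this
    rw [← hAB]
    exact this
  have hy : gh.Hom B A y := by
    intro α I
    have h1 : (Sum.elim (fun _ => c) (fun _ => c') α : T) ∈ gh.H 0 := by
      rcases α with α | α
      exacts [hc, hc']
    have := gh.mul h1 (hg.cmp (m + 1) (emb α) I)
    rw [zero_add] at this
    rw [← hAB]
    exact this
  have cm : ∀ I K, ∑ J, cmp (m + 1) g I J * cmp (m + 1) g J K =
      (((m + 1).factorial : ℕ) : T) * cmp (m + 1) g I K := by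
    intro I K
    have := congrFun (congrFun (cmp_mul (m + 1) g g) I) K
    rw [ig, Matrix.mul_apply] at this
    exact this
  have hxy : x * y = c • cmp (m + 1) g := by
    ext I K
    have h1 := sum_star (fun J => cmp (m + 1) g I J * cmp (m + 1) g J K) (by
      intro J hJ
      rw [Function.not_injective_iff] at hJ
      obtain ⟨k, l, hkl, hne⟩ := hJ
      simp only [cmp, Matrix.of_apply]
      rw [Matrix.det_zero_of_column_eq (M := g.submatrix I J) hne, zero_mul]
      intro i; simp [hkl]) (by
      intro J σ
      simp only [cmp, Matrix.of_apply]
      have e1 := Matrix.det_permute σ (g.submatrix J K)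
      have e2 := Matrix.det_permute' σ (g.submatrix I J)
      simp only [Matrix.submatrix_submatrix, Function.comp_id, id] at e1 e2
      have e3 : K ∘ id = K := rfl
      have e4 : I ∘ id = I := rfl
      rw [show (g.submatrix (J ∘ σ) K).det = _ from e1, show (g.submatrix I (J ∘ σ)).det = _ from e2]
      rcases Int.units_eq_one_or (Equiv.Perm.sign σ) with h | h <;> rw [h] <;> simp)
    rw [cm] at h1
    rw [Matrix.mul_apply, Fintype.sum_sum_type, Matrix.smul_apply, smul_eq_mul]
    simp only [x, y, emb, Matrix.of_apply, Sum.elim_inl, Sum.elim_inr]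
    have h2 : cmp (m + 1) g I K = c * ((((m + 1).factorial : ℕ) : T) * cmp (m + 1) g I K) := by
      rw [← mul_assoc, inv_mul_cancel₀ f0, one_mul]
    rw [h2, h1, mul_add, mul_add, Finset.mul_sum, Finset.mul_sum]
    have h3 : c * (c * (((m + 1 : ℕ)) : T)) = c * c' := by
      simp only [c, c']
      rw [Nat.factorial_succ]
      push_cast
      have : ((m : T) + 1) ≠ 0 := by exact_mod_cast Nat.succ_ne_zero m
      field_simp
    rw [← mul_assoc, ← mul_assoc, mul_assoc c c, h3, Finset.mul_sum]
    congr 1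
    · exact Finset.sum_congr rfl fun J _ => by ring
    · exact Finset.sum_congr rfl fun J _ => by ring
  have hyx : y * x = Matrix.fromBlocks (c • cmp (m + 1) E.e) 0 0 (c' • cmp m E.e) := by
    have h1 : ∀ α β, (y * x) α β = (Sum.elim (fun _ => c) (fun _ => c') α : T) * cmp (m + 1) g (emb α) (emb β) := by
      intro α β
      rw [Matrix.mul_apply]
      simp only [x, y, Matrix.of_apply]
      calc _ = (Sum.elim (fun _ => c) (fun _ => c') α : T) * c * ∑ J, cmp (m + 1) g (emb α) J * cmp (m + 1) g J (emb β) := by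
            rw [Finset.mul_sum]; exact Finset.sum_congr rfl fun J _ => by ring
        _ = _ := by
          rw [cm, mul_assoc, ← mul_assoc c, inv_mul_cancel₀ f0, one_mul]
    ext α β
    rw [h1]
    rcases α with J | J <;> rcases β with K | K
    · simp only [Sum.elim_inl, Matrix.fromBlocks_apply₁₁, Matrix.smul_apply, smul_eq_mul]
      rfl
    · rw [Matrix.fromBlocks_apply₁₂, Matrix.zero_apply]
      simp only [cmp, Matrix.of_apply]
      rw [Matrix.det_eq_zero_of_column_eq_zero 0, mul_zero]
      intro i; simp [emb, g]
    · rw [Matrix.fromBlocks_apply₂₁, Matrix.zero_apply]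
      simp only [cmp, Matrix.of_apply]
      rw [Matrix.det_eq_zero_of_row_eq_zero 0, mul_zero]
      intro i; simp [emb, g]
    · rw [Matrix.fromBlocks_apply₂₂, Sum.elim_inr, Matrix.smul_apply, smul_eq_mul]
      congr 1
      simp only [cmp, Matrix.of_apply]
      rw [Matrix.det_succ_row_zero, Fin.sum_univ_succ, Finset.sum_eq_zero, add_zero]
      · simp only [emb, g, Sum.elim_inr, Matrix.submatrix_apply, Fin.cons_zero, Fin.val_zero, pow_zero, one_mul,
          Matrix.fromBlocks_apply₂₂, Matrix.one_apply_eq, Matrix.submatrix_submatrix]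
        congr 1
      · intro i _; simp [emb, g]
  exact ⟨x, y, hx, hy, hxy, hyx⟩

end WI
end AdjFac

namespace AdjFac
namespace WI
variable {T : Type} [Field T] [CharZero T] {gh : GH T}
variable (hQ : ∀ m : ℕ, (m : T)⁻¹ ∈ gh.H 0)

def laM (m : ℕ) : M gh → M gh := Quotient.map (lam hQ m) (fun _ _ h => h.lam hQ m)

theorem laM_cls (m : ℕ) (E : WI gh) : laM hQ m (cls E) = cls (lam hQ m E) := rfl

theorem laM_zero (c : M gh) : laM hQ 0 c = fr gh {0} := by
  obtain ⟨E⟩ := c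
  exact lam_zero hQ E

theorem laM_add (c : M gh) (q : ℤ) (m : ℕ) :
    laM hQ (m + 1) (c + fr gh {q}) = laM hQ (m + 1) c + sh q (laM hQ m c) := by
  obtain ⟨E⟩ := c
  rw [fr_singleton]
  exact lam_sum_unit hQ E q m

theorem laM_of_zero (m : ℕ) : laM hQ (m + 1) (0 : M gh) = 0 := by
  change laM hQ (m + 1) (cls (zero gh)) = 0
  rw [laM_cls]
  apply cls_zero
  change _ • cmp (m + 1) (zero gh).e = 0
  ext I J
  exact (I 0).elim

theorem exists_chi {A : Type} [CommRing A] (θ : ℤ → A) 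
    (hadd : ∀ p q, θ (p + q) = θ p * θ q)
    (htoep : ∀ P Q, fr gh P = fr gh Q → (P.map θ).sum = (Q.map θ).sum)
    (hstab : ∀ E : WI gh, ∃ P Q : Multiset ℤ, cls E + fr gh Q = fr gh P) :
    ∃ χ : M gh →+ A, (∀ P, χ (fr gh P) = (P.map θ).sum) ∧ ∀ q c, χ (sh q c) = θ q * χ c := by
  have hs : ∀ c : M gh, ∃ P Q : Multiset ℤ, c + fr gh Q = fr gh P := by
    rintro ⟨E⟩; exact hstab E
  choose P Q h using hs
  have key : ∀ (c : M gh) P' Q', c + fr gh Q' = fr gh P' →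
      ((P c).map θ).sum - ((Q c).map θ).sum = (P'.map θ).sum - (Q'.map θ).sum := by
    intro c P' Q' h'
    have : fr gh (P c + Q') = fr gh (P' + Q c) := by
      rw [map_add, map_add, ← h, ← h']; abel
    have := htoep _ _ this
    rw [Multiset.map_add, Multiset.map_add, Multiset.sum_add, Multiset.sum_add] at this
    linear_combination this
  refine ⟨⟨⟨fun c => ((P c).map θ).sum - ((Q c).map θ).sum, ?_⟩, ?_⟩, ?_, ?_⟩
  · rw [key 0 0 0 (by simp)]; simp
  · intro c d
    refine (key (c + d) (P c + P d) (Q c + Q d) (by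
      rw [map_add, map_add, ← h, ← h]; abel)).trans ?_
    change _ = (_ - _) + (_ - _)
    simp only [Multiset.map_add, Multiset.sum_add]; ring
  · intro P'
    refine (key _ P' 0 (by simp)).trans ?_
    simp
  · intro q c
    refine (key _ ((P c).map (· + q)) ((Q c).map (· + q)) ?_).trans ?_
    · rw [← sh_fr, ← sh_fr, ← h, map_add]
    · change _ = θ q * (_ - _)
      simp only [Multiset.map_map, Function.comp_def, hadd, Multiset.sum_map_mul_right]
      ring

open PowerSeries in
theorem lam_series {A : Type} [CommRing A] (θ : ℤ → A) (h0 : θ 0 = 1) (χ : M gh →+ A)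
    (hfr : ∀ P, χ (fr gh P) = (P.map θ).sum) (hsh : ∀ q c, χ (sh q c) = θ q * χ c)
    (E : WI gh) (P Q : Multiset ℤ) (h : cls E + fr gh Q = fr gh P) :
    PowerSeries.mk (fun m => χ (cls (lam hQ m E))) *
      (Q.map fun q => 1 + C (θ q) * (X : A⟦X⟧)).prod = (P.map fun q => 1 + C (θ q) * (X : A⟦X⟧)).prod := by
  let L : M gh → A⟦X⟧ := fun c => PowerSeries.mk fun m => χ (laM hQ m c)
  have hz : L 0 = 1 := by
    ext m
    rcases m with _ | m
    · simp [L, laM_zero, hfr, h0]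
    · simp [L, laM_of_zero, coeff_one]
  have hstep : ∀ c q, L (c + fr gh {q}) = L c * (1 + C (θ q) * X) := by
    intro c q
    ext m
    rw [mul_add, mul_one, ← mul_assoc, map_add]
    rcases m with _ | m
    · simp [L, laM_zero]
    · rw [coeff_succ_mul_X, mul_comm (L c), coeff_C_mul]
      simp only [L, coeff_mk]
      rw [laM_add, map_add, hsh]
  have hall : ∀ (c : M gh) (Q : Multiset ℤ), L (c + fr gh Q) =
      L c * (Q.map fun q => 1 + C (θ q) * (X : A⟦X⟧)).prod := by
    intro c Q
    induction Q using Multiset.induction_on with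
    | empty => simp
    | cons q Q ih =>
      rw [← Multiset.singleton_add, add_comm {q} Q, map_add, ← add_assoc, hstep, ih]
      simp [mul_assoc]
  have e1 := hall (cls E) Q
  have e2 := hall 0 P
  rw [h] at e1
  rw [zero_add, hz, one_mul] at e2
  rw [← e2, e1]
  rfl

theorem lam_eq_zero (m : ℕ) (E : WI gh) (h : E.e.rank < m) : cls (lam hQ m E) = 0 := by
  apply cls_zero
  change (_ : T) • cmp m E.e = 0
  have : cmp m E.e = 0 := by
    ext I J
    simp only [cmp, Matrix.of_apply, Matrix.zero_apply]
    by_contra hne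
    have h1 : (E.e.submatrix I J).rank = m := by
      have := Matrix.rank_of_isUnit (E.e.submatrix I J) (by
        rw [Matrix.isUnit_iff_isUnit_det]; exact isUnit_iff_ne_zero.2 hne)
      simpa using this
    have h2 : (E.e.submatrix I J).rank ≤ E.e.rank := by
      have e : E.e.submatrix I J = (1 : Matrix E.ι E.ι T).submatrix I id * E.e * (1 : Matrix E.ι E.ι T).submatrix id J := by
        ext i j
        simp [Matrix.mul_apply, Matrix.one_apply]
      rw [e]
      exact (Matrix.rank_mul_le_left _ _).trans (Matrix.rank_mul_le_right _ _)
    omega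
  rw [this, smul_zero]

theorem rank_of_trace {ι : Type} [Fintype ι] [DecidableEq ι] (e : Matrix ι ι T) (he : e * e = e)
    (d : ℕ) (ht : e.trace = d) : e.rank = d := by
  have hid : IsIdempotentElem (Matrix.toLin' e) := by
    change Matrix.toLin' e ∘ₗ Matrix.toLin' e = _
    rw [← Matrix.toLin'_mul, he]
  have h1 := (LinearMap.IsIdempotentElem.isProj_range _ hid).trace
  rw [Matrix.trace_toLin'_eq, ht] at h1
  have h2 : e.rank = Module.finrank T (LinearMap.range (Matrix.toLin' e)) := rfl
  rw [h2]
  exact_mod_cast h1.symm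

end WI
end AdjFac

namespace AdjFac
namespace Toep
open MvPolynomial

variable {n : ℕ}

abbrev V (n : ℕ) := MvPolynomial (Fin n) ℂ
abbrev S (n : ℕ) := MvPolynomial (Fin n ⊕ Fin n) ℂ

/-- higher derivatives -/
noncomputable def dd (β : Fin n →₀ ℕ) : V n →ₗ[ℂ] V n :=
  (basisMonomials (Fin n) ℂ).constr ℂ fun γ =>
    monomial (γ - β) (((∏ i, (γ i).descFactorial (β i) : ℕ) : ℂ))

theorem dd_monomial (β γ : Fin n →₀ ℕ) (c : ℂ) : dd β (monomial γ c) =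
    monomial (γ - β) (c * ((∏ i, (γ i).descFactorial (β i) : ℕ) : ℂ)) := by
  have : monomial γ c = c • (basisMonomials (Fin n) ℂ γ) := by
    simp [smul_monomial]
  rw [this, map_smul, dd, Module.Basis.constr_basis, smul_monomial, smul_eq_mul]

theorem vext {f g : V n →ₗ[ℂ] V n} (h : ∀ γ, f (monomial γ 1) = g (monomial γ 1)) : f = g := by
  refine (basisMonomials (Fin n) ℂ).ext fun γ => ?_
  simpa using h γ

theorem dd_zero : dd (0 : Fin n →₀ ℕ) = LinearMap.id := by
  refine vext fun γ => ?_
  simp [dd_monomial]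

/-- partial derivative as a linear map -/
noncomputable def pd (i : Fin n) : V n →ₗ[ℂ] V n := (pderiv i).toLinearMap

theorem pd_apply (i : Fin n) (p : V n) : pd i p = pderiv i p := rfl

theorem dd_succ (β : Fin n →₀ ℕ) (i : Fin n) : dd (β + Finsupp.single i 1) = pd i ∘ₗ dd β := by
  refine vext fun γ => ?_
  simp only [LinearMap.comp_apply, dd_monomial, pd_apply, pderiv_monomial, one_mul]
  rw [tsub_add_eq_tsub_tsub]
  congr 1
  have h : ∏ j, (γ j).descFactorial ((β + Finsupp.single i 1 : Fin n →₀ ℕ) j) =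
      (∏ j, (γ j).descFactorial (β j)) * (γ i - β i) := by
    rw [← Finset.mul_prod_erase _ _ (Finset.mem_univ i),
      ← Finset.mul_prod_erase _ (fun j => (γ j).descFactorial (β j)) (Finset.mem_univ i)]
    have e : ∏ x ∈ Finset.univ.erase i, (γ x).descFactorial ((β + Finsupp.single i 1 : Fin n →₀ ℕ) x) =
        ∏ x ∈ Finset.univ.erase i, (γ x).descFactorial (β x) := by
      refine Finset.prod_congr rfl fun j hj => ?_
      have : i ≠ j := (Finset.ne_of_mem_erase hj).symm
      simp [Finsupp.single_apply, this]
    rw [e]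
    simp [Nat.descFactorial_succ]
    ring
  rw [h, Finsupp.tsub_apply]
  push_cast
  rfl

/-- left and right parts of an exponent -/
noncomputable def aL (m : Fin n ⊕ Fin n →₀ ℕ) : Fin n →₀ ℕ := m.comapDomain Sum.inl Sum.inl_injective.injOn
noncomputable def aR (m : Fin n ⊕ Fin n →₀ ℕ) : Fin n →₀ ℕ := m.comapDomain Sum.inr Sum.inr_injective.injOn

/-- quantization of a monomial -/
noncomputable def opm (N : ℕ) (m : Fin n ⊕ Fin n →₀ ℕ) : V n →ₗ[ℂ] V n :=
  ((N : ℂ)⁻¹ ^ (aR m).degree) • (LinearMap.mulLeft ℂ (monomial (aL m) (1 : ℂ)) ∘ₗ dd (aR m))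

noncomputable def op (N : ℕ) : S n →ₗ[ℂ] (V n →ₗ[ℂ] V n) :=
  (basisMonomials (Fin n ⊕ Fin n) ℂ).constr ℂ (opm N)

theorem op_monomial (N : ℕ) (m : Fin n ⊕ Fin n →₀ ℕ) (c : ℂ) : op N (monomial m c) = c • opm N m := by
  have : monomial m c = c • (basisMonomials (Fin n ⊕ Fin n) ℂ m) := by
    simp [smul_monomial]
  rw [this, map_smul, op, Module.Basis.constr_basis]

theorem aL_add_inl (m : Fin n ⊕ Fin n →₀ ℕ) (i : Fin n) :
    aL (Finsupp.single (Sum.inl i) 1 + m) = Finsupp.single i 1 + aL m := by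
  ext j; simp [aL, Finsupp.single_apply]
theorem aR_add_inl (m : Fin n ⊕ Fin n →₀ ℕ) (i : Fin n) :
    aR (Finsupp.single (Sum.inl i) 1 + m) = aR m := by
  ext j; simp [aR, Finsupp.single_apply]
theorem aL_add_inr (m : Fin n ⊕ Fin n →₀ ℕ) (i : Fin n) :
    aL (Finsupp.single (Sum.inr i) 1 + m) = aL m := by
  ext j; simp [aL, Finsupp.single_apply]
theorem aR_add_inr (m : Fin n ⊕ Fin n →₀ ℕ) (i : Fin n) :
    aR (Finsupp.single (Sum.inr i) 1 + m) = aR m + Finsupp.single i 1 := by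
  ext j; simp [aR, Finsupp.single_apply, add_comm]
theorem aL_sub_inl (m : Fin n ⊕ Fin n →₀ ℕ) (i : Fin n) :
    aL (m - Finsupp.single (Sum.inl i) 1) = aL m - Finsupp.single i 1 := by
  ext j; simp [aL, Finsupp.single_apply]
theorem aR_sub_inl (m : Fin n ⊕ Fin n →₀ ℕ) (i : Fin n) :
    aR (m - Finsupp.single (Sum.inl i) 1) = aR m := by
  ext j; simp [aR, Finsupp.single_apply]

theorem op_one (N : ℕ) : op N (1 : S n) = LinearMap.id := by
  rw [show (1 : S n) = monomial 0 1 from rfl, op_monomial, one_smul, opm]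
  have h1 : aL (0 : Fin n ⊕ Fin n →₀ ℕ) = 0 := by ext; simp [aL]
  have h2 : aR (0 : Fin n ⊕ Fin n →₀ ℕ) = 0 := by ext; simp [aR]
  rw [h1, h2, dd_zero]
  refine vext fun γ => ?_
  simp

theorem op_inl (N : ℕ) (i : Fin n) (x : S n) :
    op N (X (Sum.inl i) * x) = LinearMap.mulLeft ℂ (X i) ∘ₗ op N x := by
  induction x using MvPolynomial.induction_on' with
  | monomial m c =>
    rw [X, monomial_mul, one_mul, op_monomial, op_monomial, opm, opm, aL_add_inl, aR_add_inl]
    refine vext fun γ => ?_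
    simp only [LinearMap.comp_apply, LinearMap.smul_apply, LinearMap.mulLeft_apply, mul_smul_comm]
    rw [X, ← mul_assoc, monomial_mul, one_mul]
  | add p q hp hq => rw [mul_add, map_add, map_add, hp, hq, LinearMap.comp_add]

theorem op_inr (N : ℕ) (i : Fin n) (x : S n) :
    op N (X (Sum.inr i) * x) = (N : ℂ)⁻¹ • (pd i ∘ₗ op N x - op N (pderiv (Sum.inl i) x)) := by
  induction x using MvPolynomial.induction_on' with
  | monomial m c =>
    rw [X, monomial_mul, one_mul, op_monomial, op_monomial, pderiv_monomial, op_monomial, opm, opm, opm,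
      aL_add_inr, aR_add_inr, aL_sub_inl, aR_sub_inl, dd_succ]
    refine vext fun γ => ?_
    have hm : (m (Sum.inl i) : ℂ) = (aL m i : ℕ) := rfl
    have hd : (aR m + Finsupp.single i 1).degree = (aR m).degree + 1 := by
      simp
    simp only [LinearMap.comp_apply, LinearMap.smul_apply, LinearMap.mulLeft_apply, LinearMap.sub_apply,
      map_smul, hd, hm]
    rw [pd_apply, pd_apply, Derivation.leibniz, pderiv_monomial, one_mul]
    have e : monomial (aL m - Finsupp.single i 1) ((aL m i : ℕ) : ℂ) =
      ((aL m i : ℕ) : ℂ) • monomial (aL m - Finsupp.single i 1) (1 : ℂ) := by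
      rw [smul_monomial, smul_eq_mul, mul_one]
    rw [e]
    simp only [smul_eq_mul, mul_smul_comm, smul_add, smul_smul, smul_sub, pow_succ]
    rw [mul_comm (dd (aR m) _) (monomial (aL m - _) _)] 
    module
  | add p q hp hq =>
    rw [mul_add, map_add, map_add, map_add, map_add, hp, hq, LinearMap.comp_add, ← smul_add]
    congr 1
    abel

end Toep
end AdjFac

namespace AdjFac
namespace Toep
open MvPolynomial

variable {n : ℕ}

noncomputable def nrm (p : V n) : ℝ := ∑ m ∈ p.support, ‖coeff m p‖

theorem nrm_eq {p : V n} {s : Finset (Fin n →₀ ℕ)} (h : p.support ⊆ s) : nrm p = ∑ m ∈ s, ‖coeff m p‖ := by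
  refine Finset.sum_subset h fun m _ hm => ?_
  rw [notMem_support_iff.1 hm, norm_zero]

theorem nrm_nonneg (p : V n) : 0 ≤ nrm p := Finset.sum_nonneg fun _ _ => norm_nonneg _

theorem nrm_add (p q : V n) : nrm (p + q) ≤ nrm p + nrm q := by
  classical
  rw [nrm_eq (support_add (p := p) (q := q)), nrm_eq (p := p) Finset.subset_union_left,
    nrm_eq (p := q) (s := p.support ∪ q.support) Finset.subset_union_right, ← Finset.sum_add_distrib]
  exact Finset.sum_le_sum fun m _ => by rw [coeff_add]; exact norm_add_le _ _

theorem nrm_smul (c : ℂ) (p : V n) : nrm (c • p) = ‖c‖ * nrm p := by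
  rw [nrm_eq (p := c • p) (s := p.support) (support_smul), nrm, Finset.mul_sum]
  exact Finset.sum_congr rfl fun m _ => by rw [coeff_smul, smul_eq_mul, norm_mul]

theorem nrm_zero : nrm (0 : V n) = 0 := by simp [nrm]

theorem nrm_sum {ι : Type} (s : Finset ι) (f : ι → V n) : nrm (∑ i ∈ s, f i) ≤ ∑ i ∈ s, nrm (f i) := by
  classical
  induction s using Finset.induction_on with
  | empty => simp [nrm_zero]
  | insert i s hi ih =>
    rw [Finset.sum_insert hi, Finset.sum_insert hi]
    exact (nrm_add _ _).trans (by linarith)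

theorem nrm_monomial (m : Fin n →₀ ℕ) (c : ℂ) : nrm (monomial m c) = ‖c‖ := by
  classical
  rw [nrm_eq (s := {m}) support_monomial_subset]
  simp

theorem eq_zero_of_nrm {p : V n} (h : nrm p = 0) : p = 0 := by
  ext m
  rw [coeff_zero]
  by_contra hne
  have := (Finset.sum_eq_zero_iff_of_nonneg (fun _ _ => norm_nonneg _)).1 h m (mem_support_iff.2 hne)
  exact hne (norm_eq_zero.1 this)

theorem apply_eq_sum (A : V n →ₗ[ℂ] V n) (p : V n) :
    A p = ∑ m ∈ p.support, coeff m p • A (monomial m 1) := by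
  conv_lhs => rw [p.as_sum]
  rw [map_sum]
  refine Finset.sum_congr rfl fun m _ => ?_
  rw [← map_smul, smul_monomial, smul_eq_mul, mul_one]

/-- polynomials with degrees in a set -/
def DS (Z : Set ℤ) : Submodule ℂ (V n) where
  carrier := {p | ∀ m, coeff m p ≠ 0 → ((m.degree : ℕ) : ℤ) ∈ Z}
  zero_mem' := by intro m h; simp at h
  add_mem' := by
    intro p q hp hq m h
    by_cases h1 : coeff m p = 0
    · apply hq; intro h2; apply h; rw [coeff_add, h1, h2, add_zero]
    · exact hp m h1
  smul_mem' := by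
    intro c p hp m h
    apply hp; intro h2; apply h; rw [coeff_smul, h2, smul_zero]

theorem mem_DS {Z : Set ℤ} {p : V n} : p ∈ DS Z ↔ ∀ m, coeff m p ≠ 0 → ((m.degree : ℕ) : ℤ) ∈ Z := Iff.rfl

theorem monomial_mem_DS {Z : Set ℤ} {m : Fin n →₀ ℕ} {c : ℂ} (h : c ≠ 0 → ((m.degree : ℕ) : ℤ) ∈ Z) :
    monomial m c ∈ DS Z := by
  classical
  intro m' h'
  rw [coeff_monomial] at h'
  split_ifs at h' with e
  · subst e; exact h h'
  · exact absurd rfl h'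

theorem map_DS {Z Z' : Set ℤ} {A : V n →ₗ[ℂ] V n} (h : ∀ m : Fin n →₀ ℕ, ((m.degree : ℕ) : ℤ) ∈ Z →
    A (monomial m 1) ∈ DS Z') {p : V n} (hp : p ∈ DS Z) : A p ∈ DS Z' := by
  rw [apply_eq_sum]
  refine Submodule.sum_mem _ fun m hm => Submodule.smul_mem _ _ (h m (hp m (mem_support_iff.1 hm)))

theorem map_nrm {Z : Set ℤ} {C : ℝ} {A : V n →ₗ[ℂ] V n} (h : ∀ m : Fin n →₀ ℕ, ((m.degree : ℕ) : ℤ) ∈ Z →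
    nrm (A (monomial m 1)) ≤ C) {p : V n} (hp : p ∈ DS Z) : nrm (A p) ≤ C * nrm p := by
  rw [apply_eq_sum]
  refine (nrm_sum _ _).trans ?_
  rw [nrm, Finset.mul_sum]
  refine Finset.sum_le_sum fun m hm => ?_
  rw [nrm_smul, mul_comm]
  exact mul_le_mul_of_nonneg_right (h m (hp m (mem_support_iff.1 hm))) (norm_nonneg _)

/-- bounded families -/
def Bd (A : ℕ → V n →ₗ[ℂ] V n) : Prop :=
  ∀ K : ℕ, ∃ (C : ℝ) (K' : ℕ), 0 ≤ C ∧ ∀ N : ℕ, 1 ≤ N → ∀ p ∈ DS (Set.Iic ((N : ℤ) + K)),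
    nrm (A N p) ≤ C * nrm p ∧ A N p ∈ DS (Set.Iic ((N : ℤ) + K'))

theorem DS_mono {Z Z' : Set ℤ} (h : Z ⊆ Z') : (DS Z : Submodule ℂ (V n)) ≤ DS Z' :=
  fun _ hp m hm => h (hp m hm)

theorem Bd.comp {A B : ℕ → V n →ₗ[ℂ] V n} (hA : Bd A) (hB : Bd B) : Bd fun N => A N ∘ₗ B N := by
  intro K
  obtain ⟨C, K', hC, h⟩ := hB K
  obtain ⟨C2, K2, hC2, h2⟩ := hA K'
  refine ⟨C2 * C, K2, by positivity, fun N hN p hp => ?_⟩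
  obtain ⟨a, b⟩ := h N hN p hp
  obtain ⟨c, d⟩ := h2 N hN _ b
  refine ⟨c.trans ?_, d⟩
  rw [mul_assoc]
  exact mul_le_mul_of_nonneg_left a hC2

theorem Bd.add {A B : ℕ → V n →ₗ[ℂ] V n} (hA : Bd A) (hB : Bd B) : Bd fun N => A N + B N := by
  intro K
  obtain ⟨C, K', hC, h⟩ := hB K
  obtain ⟨C2, K2, hC2, h2⟩ := hA K
  refine ⟨C2 + C, K2 + K', by positivity, fun N hN p hp => ?_⟩
  obtain ⟨a, b⟩ := h N hN p hp
  obtain ⟨c, d⟩ := h2 N hN _ hp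
  refine ⟨?_, ?_⟩
  · rw [LinearMap.add_apply, add_mul]
    exact (nrm_add _ _).trans (by linarith)
  · refine Submodule.add_mem _ (DS_mono (Set.Iic_subset_Iic.2 ?_) d) (DS_mono (Set.Iic_subset_Iic.2 ?_) b)
    · push_cast; omega
    · push_cast; omega

theorem Bd.smul {A : ℕ → V n →ₗ[ℂ] V n} (hA : Bd A) (c : ℕ → ℂ) (D : ℝ) (hc : ∀ N ≥ 1, ‖c N‖ ≤ D) :
    Bd fun N => c N • A N := by
  intro K
  obtain ⟨C2, K2, hC2, h2⟩ := hA K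
  have hD : 0 ≤ D := (norm_nonneg _).trans (hc 1 le_rfl)
  refine ⟨D * C2, K2, by positivity, fun N hN p hp => ?_⟩
  obtain ⟨c, d⟩ := h2 N hN _ hp
  refine ⟨?_, Submodule.smul_mem _ _ d⟩
  rw [LinearMap.smul_apply, nrm_smul, mul_assoc]
  exact mul_le_mul (hc N hN) c (nrm_nonneg _) hD

theorem Bd.sub {A B : ℕ → V n →ₗ[ℂ] V n} (hA : Bd A) (hB : Bd B) : Bd fun N => A N - B N := by
  have := hA.add (hB.smul (fun _ => (-1 : ℂ)) 1 (by simp))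
  have e : (fun N => A N - B N) = fun N => A N + (-1 : ℂ) • B N := by
    refine _root_.funext fun N => ?_
    rw [sub_eq_add_neg]; congr 1; exact (neg_one_smul ℂ (B N)).symm
  rw [e]; exact this

theorem Bd.zero : Bd (fun _ => (0 : V n →ₗ[ℂ] V n)) := fun K =>
  ⟨0, 0, le_rfl, fun N _ p _ => ⟨by simp [nrm_zero], Submodule.zero_mem _⟩⟩

theorem Bd.sum {ι : Type} (s : Finset ι) {A : ι → ℕ → V n →ₗ[ℂ] V n} (hA : ∀ i ∈ s, Bd (A i)) :
    Bd fun N => ∑ i ∈ s, A i N := by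
  classical
  induction s using Finset.induction_on with
  | empty => simpa using Bd.zero
  | insert i s hi ih =>
    simp only [Finset.sum_insert hi]
    exact (hA i (by simp)).add (ih fun j hj => hA j (by simp [hj]))

theorem opm_apply (N : ℕ) (m : Fin n ⊕ Fin n →₀ ℕ) (γ : Fin n →₀ ℕ) : opm N m (monomial γ 1) =
    monomial (aL m + (γ - aR m))
      ((N : ℂ)⁻¹ ^ (aR m).degree * ((∏ i, (γ i).descFactorial (aR m i) : ℕ) : ℂ)) := by
  simp only [opm, LinearMap.smul_apply, LinearMap.comp_apply, dd_monomial, LinearMap.mulLeft_apply,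
    monomial_mul, one_mul, smul_monomial, smul_eq_mul]

theorem desc_le (β γ : Fin n →₀ ℕ) : (∏ i, (γ i).descFactorial (β i)) ≤ γ.degree ^ β.degree := by
  have : γ.degree ^ β.degree = ∏ i, γ.degree ^ β i := by
    rw [Finset.prod_pow_eq_pow_sum, Finsupp.degree_eq_sum β]
  rw [this]
  exact Finset.prod_le_prod' fun i _ => (Nat.descFactorial_le_pow _ _).trans
    (Nat.pow_le_pow_left (Finsupp.le_degree i γ) _)

theorem desc_ne {β γ : Fin n →₀ ℕ} (h : (∏ i, (γ i).descFactorial (β i)) ≠ 0) : β ≤ γ := by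
  intro i
  by_contra hlt
  apply h
  exact Finset.prod_eq_zero (Finset.mem_univ i) (Nat.descFactorial_eq_zero_iff_lt.2 (not_le.1 hlt))

theorem Bd.opm (m : Fin n ⊕ Fin n →₀ ℕ) : Bd fun N => opm N m := by
  intro K
  refine ⟨((1 : ℝ) + K) ^ (aR m).degree, K + (aL m).degree, by positivity, fun N hN p hp => ⟨?_, ?_⟩⟩
  · refine map_nrm (Z := Set.Iic ((N : ℤ) + K)) (fun γ hγ => ?_) hp
    rw [opm_apply, nrm_monomial, norm_mul, norm_pow, norm_inv, Complex.norm_natCast, Complex.norm_natCast]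
    have h1 : ((∏ i, (γ i).descFactorial (aR m i) : ℕ) : ℝ) ≤ ((N : ℝ) + K) ^ (aR m).degree := by
      have h2 : γ.degree ≤ N + K := by
        have : ((γ.degree : ℕ) : ℤ) ≤ (N : ℤ) + K := hγ
        omega
      have := (desc_le (aR m) γ).trans (Nat.pow_le_pow_left h2 _)
      exact_mod_cast this
    have hN' : (1 : ℝ) ≤ N := by exact_mod_cast hN
    calc _ ≤ (N : ℝ)⁻¹ ^ (aR m).degree * ((N : ℝ) + K) ^ (aR m).degree :=
          mul_le_mul_of_nonneg_left h1 (by positivity)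
      _ = (1 + K / N : ℝ) ^ (aR m).degree := by
          rw [← mul_pow]; congr 1; field_simp
      _ ≤ _ := by
        refine pow_le_pow_left₀ (by positivity) ?_ _
        have : (K : ℝ) / N ≤ K := div_le_self (by positivity) hN'
        linarith
  · refine map_DS (Z := Set.Iic ((N : ℤ) + K)) (fun γ hγ => ?_) hp
    rw [opm_apply]
    apply monomial_mem_DS
    intro _
    have : ((γ.degree : ℕ) : ℤ) ≤ (N : ℤ) + K := hγ
    have h2 : (γ - aR m).degree ≤ γ.degree := Finsupp.degree_mono tsub_le_self
    simp only [Set.mem_Iic, map_add]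
    push_cast
    omega

theorem Bd.op (x : S n) : Bd fun N => op N x := by
  induction x using MvPolynomial.induction_on' with
  | monomial m c =>
    simp only [op_monomial]
    exact (Bd.opm m).smul (fun _ => c) ‖c‖ (by simp)
  | add p q hp hq => simp only [map_add]; exact hp.add hq

theorem Bd.pd (i : Fin n) : Bd fun N => (N : ℂ)⁻¹ • pd i := by
  have := Bd.op (n := n) (X (Sum.inr i))
  have h : ∀ N, Toep.op N (X (Sum.inr i) : S n) = (N : ℂ)⁻¹ • Toep.pd i := by
    intro N
    have := op_inr N i (1 : S n)
    rw [mul_one, op_one] at this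
    rw [this]; simp
  simpa [h] using this

/-- families of order 1/N -/
def Sm (A : ℕ → V n →ₗ[ℂ] V n) : Prop := ∃ B, Bd B ∧ ∀ N, A N = (N : ℂ)⁻¹ • B N

theorem Sm.add {A B : ℕ → V n →ₗ[ℂ] V n} (hA : Sm A) (hB : Sm B) : Sm fun N => A N + B N := by
  obtain ⟨A', h, h'⟩ := hA
  obtain ⟨B', k, k'⟩ := hB
  exact ⟨_, h.add k, fun N => by beta_reduce; rw [h', k', smul_add]⟩

theorem Sm.sum {ι : Type} (s : Finset ι) {A : ι → ℕ → V n →ₗ[ℂ] V n} (hA : ∀ i ∈ s, Sm (A i)) :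
    Sm fun N => ∑ i ∈ s, A i N := by
  classical
  induction s using Finset.induction_on with
  | empty => exact ⟨_, Bd.zero, by simp⟩
  | insert i s hi ih =>
    simp only [Finset.sum_insert hi]
    exact (hA i (by simp)).add (ih fun j hj => hA j (by simp [hj]))

theorem Sm.comp_left {A B : ℕ → V n →ₗ[ℂ] V n} (hA : Bd A) (hB : Sm B) : Sm fun N => A N ∘ₗ B N := by
  obtain ⟨B', k, k'⟩ := hB
  exact ⟨_, hA.comp k, fun N => by beta_reduce; rw [k', LinearMap.comp_smul]⟩

theorem Sm.comp_right {A B : ℕ → V n →ₗ[ℂ] V n} (hA : Bd A) (hB : Sm B) : Sm fun N => B N ∘ₗ A N := by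
  obtain ⟨B', k, k'⟩ := hB
  exact ⟨_, k.comp hA, fun N => by beta_reduce; rw [k', LinearMap.smul_comp]⟩

theorem Sm.op_mul (x : S n) : ∀ y : S n, Sm fun N => op N (x * y) - op N x ∘ₗ op N y := by
  induction x using MvPolynomial.induction_on with
  | C a =>
    intro y
    refine ⟨_, Bd.zero, fun N => ?_⟩
    beta_reduce
    rw [← smul_eq_C_mul, show (C a : S n) = a • 1 by rw [smul_eq_C_mul, mul_one], map_smul, map_smul, op_one]
    ext; simp
  | add p q hp hq =>
    intro y
    have := (hp y).add (hq y)
    convert this using 2 with N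
    rw [add_mul, map_add, map_add, LinearMap.add_comp]; abel
  | mul_X p i hp =>
    intro y
    -- first the generator
    have hX : ∀ y : S n, Sm fun N => op N (X i * y) - op N (X i) ∘ₗ op N y := by
      intro y
      rcases i with i | i
      · refine ⟨_, Bd.zero, fun N => ?_⟩
        have h1 := op_inl N i (1 : S n)
        rw [mul_one, op_one, LinearMap.comp_id] at h1
        beta_reduce
        rw [op_inl, h1]; simp
      · refine ⟨fun N => - op N (pderiv (Sum.inl i) y), ?_, fun N => ?_⟩
        · simpa using Bd.zero.sub (Bd.op (pderiv (Sum.inl i) y))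
        · have h1 := op_inr N i (1 : S n)
          rw [mul_one, op_one, LinearMap.comp_id] at h1
          beta_reduce
          rw [op_inr, h1]
          simp [smul_sub, LinearMap.smul_comp]
    obtain h1 := hp (X i * y)
    obtain h2 := Sm.comp_left (Bd.op p) (hX y)
    obtain ⟨B, h3, h3'⟩ := Sm.comp_right (Bd.op y) (hp (X i))
    have h4 : Sm fun N => -((op N (p * X i) - op N p ∘ₗ op N (X i)) ∘ₗ op N y) :=
      ⟨fun N => - B N, by simpa using Bd.zero.sub h3, fun N => by beta_reduce; rw [smul_neg, ← h3']⟩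
    convert (h1.add h2).add h4 using 2 with N
    ext
    simp [mul_assoc]

end Toep
end AdjFac

namespace AdjFac
namespace Toep
open MvPolynomial

variable {n : ℕ}

theorem Sm.bound {A : ℕ → V n →ₗ[ℂ] V n} (hA : Sm A) (K : ℕ) : ∃ C : ℝ, 0 ≤ C ∧ ∀ N : ℕ, 1 ≤ N →
    ∀ p ∈ DS (Set.Iic ((N : ℤ) + K)), nrm (A N p) ≤ C / N * nrm p := by
  obtain ⟨B, hB, h⟩ := hA
  obtain ⟨C, K', hC, hh⟩ := hB K
  refine ⟨C, hC, fun N hN p hp => ?_⟩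
  have := (hh N hN p hp).1
  rw [h, LinearMap.smul_apply, nrm_smul, norm_inv, Complex.norm_natCast, div_eq_inv_mul, mul_assoc]
  exact mul_le_mul_of_nonneg_left this (by positivity)

noncomputable def ss (n : ℕ) : S n := ∑ i, X (Sum.inl i) * X (Sum.inr i)

theorem op_ss_monomial (N : ℕ) (γ : Fin n →₀ ℕ) :
    op N (ss n) (monomial γ 1) = ((γ.degree : ℂ) / N) • monomial γ 1 := by
  have hi : ∀ i : Fin n, op N (X (Sum.inl i) * X (Sum.inr i)) (monomial γ 1) =
      ((γ i : ℂ) / N) • monomial γ 1 := by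
    intro i
    have h1 := op_inr N i (1 : S n)
    rw [mul_one, op_one] at h1
    rw [op_inl, h1]
    simp only [LinearMap.comp_apply, LinearMap.smul_apply, LinearMap.mulLeft_apply, LinearMap.sub_apply,
      pd_apply, LinearMap.id_apply, pderiv_monomial, Derivation.map_one_eq_zero, map_zero,
      LinearMap.zero_apply, sub_zero, one_mul, smul_monomial, X, monomial_mul, smul_eq_mul, mul_one]
    rcases Nat.eq_zero_or_pos (γ i) with h | h
    · simp [h]
    · rw [add_tsub_cancel_of_le (by simpa using Nat.succ_le_of_lt h)]
      congr 1
      rw [div_eq_inv_mul]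
  rw [ss, map_sum, LinearMap.sum_apply, Finset.sum_congr rfl fun i _ => hi i, ← Finset.sum_smul,
    ← Finset.sum_div, Finsupp.degree_eq_sum]
  push_cast
  rfl

theorem op_ss (N : ℕ) (z : ℤ) (p : V n) (hp : p ∈ DS {z}) :
    op N (ss n) p = ((z : ℂ) / N) • p := by
  rw [apply_eq_sum]
  conv_rhs => rw [p.as_sum]
  rw [Finset.smul_sum]
  refine Finset.sum_congr rfl fun m hm => ?_
  rw [op_ss_monomial]
  have : ((m.degree : ℕ) : ℤ) = z := hp m (mem_support_iff.1 hm)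
  rw [← this]
  simp only [smul_monomial, smul_eq_mul, mul_one]
  congr 1
  push_cast
  ring

theorem DS_Iic {N : ℕ} {b : ℤ} {K : ℕ} (h : -b ≤ K) {p : V n} (hp : p ∈ DS {(N : ℤ) - b}) :
    p ∈ DS (Set.Iic ((N : ℤ) + K)) := by
  refine DS_mono ?_ hp
  intro z hz
  rw [Set.mem_singleton_iff] at hz
  rw [Set.mem_Iic]; omega

theorem op_ss_pow (r : ℕ) (b : ℤ) : ∃ C : ℝ, 0 ≤ C ∧ ∀ N : ℕ, 1 ≤ N → ∀ p : V n, p ∈ DS {(N : ℤ) - b} →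
    nrm (op N (ss n ^ r) p - p) ≤ C / N * nrm p := by
  induction r with
  | zero =>
    refine ⟨0, le_rfl, fun N hN p hp => ?_⟩
    rw [pow_zero, op_one]; simp [nrm_zero]
  | succ r ih =>
    obtain ⟨C, hC, h⟩ := ih
    obtain ⟨C', hC', h'⟩ := (Sm.op_mul (ss n ^ r) (ss n)).bound b.natAbs
    refine ⟨(1 + |(b : ℝ)|) * C + |(b : ℝ)| + C', by positivity, fun N hN p hp => ?_⟩
    have hN' : (1 : ℝ) ≤ N := by exact_mod_cast hN
    have hN0 : (N : ℂ) ≠ 0 := by exact_mod_cast (by omega : N ≠ 0)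
    have e1 := h N hN p hp
    have e2 := h' N hN p (DS_Iic (by omega) hp)
    have e3 : op N (ss n ^ (r + 1)) p - p = (1 - (b : ℂ) / N) • (op N (ss n ^ r) p - p) +
        ((-((b : ℂ) / N)) • p + (op N (ss n ^ r * ss n) - op N (ss n ^ r) ∘ₗ op N (ss n)) p) := by
      rw [LinearMap.sub_apply, LinearMap.comp_apply, op_ss N _ p hp, map_smul, pow_succ]
      have : ((((N : ℤ) - b : ℤ) : ℂ)) / N = 1 - (b : ℂ) / N := by
        push_cast; field_simp
      rw [this]
      module
    rw [e3]
    refine (nrm_add _ _).trans ((add_le_add le_rfl (nrm_add _ _)).trans ?_)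
    rw [nrm_smul, nrm_smul, norm_neg]
    have n1 : ‖(b : ℂ) / N‖ = |(b : ℝ)| / N := by
      rw [norm_div, Complex.norm_natCast, Complex.norm_intCast]
    have n2 : ‖1 - (b : ℂ) / N‖ ≤ 1 + |(b : ℝ)| := by
      refine (norm_sub_le _ _).trans ?_
      rw [n1, norm_one]
      have := div_le_self (abs_nonneg (b : ℝ)) hN'
      linarith
    have h3 := mul_le_mul n2 e1 (nrm_nonneg _) (by positivity)
    rw [n1]
    calc _ ≤ (1 + |(b : ℝ)|) * (C / N * nrm p) + (|(b : ℝ)| / N * nrm p + C' / N * nrm p) := by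
          linarith
      _ = _ := by ring

/-- homogeneity, extracted from a grading -/
noncomputable def wt (m : Fin n ⊕ Fin n →₀ ℕ) : ℤ := (((aR m).degree : ℕ) : ℤ) - (((aL m).degree : ℕ) : ℤ)

def wv : Fin n ⊕ Fin n → ℤ := Sum.elim (fun _ => -1) (fun _ => 1)


theorem aL_add (m m' : Fin n ⊕ Fin n →₀ ℕ) : aL (m + m') = aL m + aL m' := by
  ext j; simp [aL]
theorem aR_add (m m' : Fin n ⊕ Fin n →₀ ℕ) : aR (m + m') = aR m + aR m' := by
  ext j; simp [aR]
theorem wt_add (m m' : Fin n ⊕ Fin n →₀ ℕ) : wt (m + m') = wt m + wt m' := by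
  simp only [wt, aL_add, aR_add, map_add]; push_cast; ring
theorem wt_zero : wt (0 : Fin n ⊕ Fin n →₀ ℕ) = 0 := by
  have := wt_add (0 : Fin n ⊕ Fin n →₀ ℕ) 0
  rw [add_zero] at this; omega
theorem wt_single (i : Fin n ⊕ Fin n) : wt (Finsupp.single i 1) = wv i := by
  rcases i with i | i
  · have h1 := aL_add_inl (0 : Fin n ⊕ Fin n →₀ ℕ) i
    have h2 := aR_add_inl (0 : Fin n ⊕ Fin n →₀ ℕ) i
    have h3 : aL (0 : Fin n ⊕ Fin n →₀ ℕ) = 0 := by ext; simp [aL]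
    have h4 : aR (0 : Fin n ⊕ Fin n →₀ ℕ) = 0 := by ext; simp [aR]
    rw [add_zero] at h1 h2
    rw [wt, h1, h2, h3, h4]; simp [wv]
  · have h1 := aL_add_inr (0 : Fin n ⊕ Fin n →₀ ℕ) i
    have h2 := aR_add_inr (0 : Fin n ⊕ Fin n →₀ ℕ) i
    have h3 : aL (0 : Fin n ⊕ Fin n →₀ ℕ) = 0 := by ext; simp [aL]
    have h4 : aR (0 : Fin n ⊕ Fin n →₀ ℕ) = 0 := by ext; simp [aR]
    rw [add_zero] at h1 h2
    rw [wt, h1, h2, h3, h4]; simp [wv]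

theorem wt_monomial {gr : Gr (S n)} (hC : ∀ r, gr.c 0 (C r) = C r) (hX : ∀ i, gr.c (wv i) (X i) = X i)
    (m : Fin n ⊕ Fin n →₀ ℕ) : ∀ (c : ℂ),
    gr.c (wt m) (monomial m c) = monomial m c := by
  have hadd : ∀ f g : Fin n ⊕ Fin n →₀ ℕ, (∀ (c : ℂ), gr.c (wt f) (monomial f c) = monomial f c) →
      (∀ (c : ℂ), gr.c (wt g) (monomial g c) = monomial g c) →
      ∀ (c : ℂ), gr.c (wt (f + g)) (monomial (f + g) c) = monomial (f + g) c := by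
    intro f g hf hg c
    have : monomial (f + g) c = monomial f 1 * monomial g c := by rw [monomial_mul, one_mul]
    rw [this, gr.mul _ _ _ _ (hf 1), wt_add, add_sub_cancel_left, hg]
  have hz : ∀ (c : ℂ), gr.c (wt (0 : Fin n ⊕ Fin n →₀ ℕ)) (monomial (0 : Fin n ⊕ Fin n →₀ ℕ) c) = monomial (0 : Fin n ⊕ Fin n →₀ ℕ) c := by
    intro c; rw [wt_zero]; exact hC c
  induction m using Finsupp.induction_linear with
  | zero => exact hz
  | add f g hf hg => exact hadd f g hf hg
  | single i b =>
    induction b with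
    | zero => rw [Finsupp.single_zero]; exact hz
    | succ b ih =>
      rw [Finsupp.single_add]
      refine hadd _ _ ih fun c => ?_
      rw [wt_single, ← C_mul_X_eq_monomial, Gr.c_mul_zero (hC c), hX]

theorem hom_supp {gr : Gr (S n)} (hC : ∀ r, gr.c 0 (C r) = C r) (hX : ∀ i, gr.c (wv i) (X i) = X i)
    {k : ℤ} {x : S n} (hx : gr.c k x = x) {m : Fin n ⊕ Fin n →₀ ℕ} (hm : coeff m x ≠ 0) : wt m = k := by
  classical
  by_contra hne
  apply hm
  rw [← hx]
  conv_lhs => rw [x.as_sum]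
  rw [map_sum, coeff_sum]
  refine Finset.sum_eq_zero fun m' _ => ?_
  by_cases h : m' = m
  · subst h
    rw [Gr.c_zero_of_hom (Ne.symm hne) (wt_monomial hC hX _ _), coeff_zero]
  · by_cases h2 : wt m' = k
    · rw [← h2, wt_monomial hC hX, coeff_monomial, if_neg h]
    · rw [Gr.c_zero_of_hom (Ne.symm h2) (wt_monomial hC hX _ _), coeff_zero]

theorem opm_DS (N : ℕ) (m : Fin n ⊕ Fin n →₀ ℕ) (z : ℤ) (p : V n) (hp : p ∈ DS {z}) :
    opm N m p ∈ DS {z - wt m} := by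
  refine map_DS (Z := {z}) (fun γ hγ => ?_) hp
  rw [opm_apply]
  apply monomial_mem_DS
  intro h
  have h1 : (∏ i, (γ i).descFactorial (aR m i)) ≠ 0 := by
    intro h2; apply h; rw [h2]; simp
  have h2 := desc_ne h1
  have h3 : (γ - aR m).degree + (aR m).degree = γ.degree := by
    rw [← map_add, tsub_add_cancel_of_le h2]
  have : ((γ.degree : ℕ) : ℤ) = z := hγ
  rw [Set.mem_singleton_iff, map_add, wt]
  push_cast
  omega

theorem op_DS {gr : Gr (S n)} (hC : ∀ r, gr.c 0 (C r) = C r) (hX : ∀ i, gr.c (wv i) (X i) = X i)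
    {k : ℤ} {x : S n} (hx : gr.c k x = x) (N : ℕ) (z : ℤ) (p : V n) (hp : p ∈ DS {z}) :
    op N x p ∈ DS {z - k} := by
  rw [x.as_sum, map_sum, LinearMap.sum_apply]
  refine Submodule.sum_mem _ fun m hm => ?_
  rw [op_monomial, LinearMap.smul_apply, ← hom_supp hC hX hx (mem_support_iff.1 hm)]
  exact Submodule.smul_mem _ _ (opm_DS N m z p hp)

theorem inj_large {ι κ : Type} [Fintype ι] [Fintype κ] [DecidableEq κ] (b : κ → ℤ)
    (A : Matrix ι κ (S n)) (B : Matrix κ ι (S n)) (r : ℕ) (h : B * A = ss n ^ r • (1 : Matrix κ κ (S n))) :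
    ∃ N0 : ℕ, ∀ N ≥ N0, ∀ p : κ → V n, (∀ j, p j ∈ DS {(N : ℤ) - b j}) →
      (∀ i, ∑ j, op N (A i j) (p j) = 0) → p = 0 := by
  classical
  choose C1 hC1 h1 using fun j => op_ss_pow (n := n) r (b j)
  choose C2 hC2 h2 using fun (j l : κ) => (Sm.sum Finset.univ (A := fun i N => op N (B j i * A i l) -
    op N (B j i) ∘ₗ op N (A i l)) fun i _ => Sm.op_mul (B j i) (A i l)).bound (b l).natAbs
  set D : ℝ := ∑ j, (C1 j + ∑ l, C2 j l) with hD
  have hD0 : 0 ≤ D := Finset.sum_nonneg fun j _ => add_nonneg (hC1 j) (Finset.sum_nonneg fun l _ => hC2 j l)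
  obtain ⟨N0, hN0⟩ := exists_nat_gt D
  refine ⟨N0 + 1, fun N hN p hp hz => ?_⟩
  have hN1 : 1 ≤ N := by omega
  have hNr : (0 : ℝ) < N := by exact_mod_cast hN1
  have hND : D < N := hN0.trans (by exact_mod_cast (by omega : N0 < N))
  set t := ∑ j, nrm (p j) with ht
  have ht0 : 0 ≤ t := Finset.sum_nonneg fun _ _ => nrm_nonneg _
  have hle : ∀ j, nrm (p j) ≤ t := fun j =>
    Finset.single_le_sum (f := fun j => nrm (p j)) (fun _ _ => nrm_nonneg _) (Finset.mem_univ j)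
  have key : ∀ j, op N (ss n ^ r) (p j) =
      ∑ l, (∑ i, (op N (B j i * A i l) - op N (B j i) ∘ₗ op N (A i l))) (p l) := by
    intro j
    have e1 : ∀ l, (∑ i, (op N (B j i * A i l) - op N (B j i) ∘ₗ op N (A i l))) (p l) =
        op N ((B * A : Matrix κ κ (S n)) j l) (p l) - ∑ i, op N (B j i) (op N (A i l) (p l)) := by
      intro l
      rw [Matrix.mul_apply, map_sum, LinearMap.sum_apply, LinearMap.sum_apply, ← Finset.sum_sub_distrib]
      rfl
    rw [Finset.sum_congr rfl fun l _ => e1 l, Finset.sum_sub_distrib, Finset.sum_comm]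
    have e2 : ∑ i, ∑ l, op N (B j i) (op N (A i l) (p l)) = 0 := by
      refine Finset.sum_eq_zero fun i _ => ?_
      rw [← map_sum, hz, map_zero]
    rw [e2, sub_zero, h, Finset.sum_eq_single j]
    · simp
    · intro l _ hl
      simp [Matrix.one_apply_ne hl.symm]
    · simp
  have hj : ∀ j, nrm (p j) ≤ (C1 j + ∑ l, C2 j l) / N * t := by
    intro j
    have e : p j = (-1 : ℂ) • (op N (ss n ^ r) (p j) - p j) + op N (ss n ^ r) (p j) := by module
    calc nrm (p j) ≤ nrm ((-1 : ℂ) • (op N (ss n ^ r) (p j) - p j)) + nrm (op N (ss n ^ r) (p j)) := by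
          conv_lhs => rw [e]
          exact nrm_add _ _
      _ ≤ C1 j / N * t + ∑ l, C2 j l / N * t := by
          refine add_le_add ?_ ?_
          · rw [nrm_smul, norm_neg, norm_one, one_mul]
            exact (h1 j N hN1 _ (hp j)).trans
              (mul_le_mul_of_nonneg_left (hle j) (div_nonneg (hC1 j) hNr.le))
          · rw [key]
            refine (nrm_sum _ _).trans (Finset.sum_le_sum fun l _ => ?_)
            exact (h2 j l N hN1 (p l) (DS_Iic (by omega) (hp l))).trans
              (mul_le_mul_of_nonneg_left (hle l) (div_nonneg (hC2 j l) hNr.le))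
      _ = _ := by rw [← Finset.sum_mul, ← Finset.sum_div]; ring
  have hsum : t ≤ D / N * t := by
    rw [hD, Finset.sum_div, Finset.sum_mul]
    exact Finset.sum_le_sum fun j _ => hj j
  have hlt : D / N < 1 := (div_lt_one hNr).2 hND
  have ht' : t = 0 := by nlinarith
  refine _root_.funext fun j => eq_zero_of_nrm (le_antisymm ((hle j).trans ht'.le) (nrm_nonneg _))

/-- dimension of the degree `z` piece -/
noncomputable def dm (n : ℕ) (z : ℤ) : ℕ := Module.finrank ℂ (DS {z} : Submodule ℂ (V n))

theorem DS_eq (z : ℤ) : (DS {z} : Submodule ℂ (V n)) =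
    restrictSupport ℂ {m : Fin n →₀ ℕ | ((m.degree : ℕ) : ℤ) = z} := by
  ext p
  rw [mem_restrictSupport_iff, mem_DS]
  constructor
  · intro h m hm
    exact h m (mem_support_iff.1 hm)
  · intro h m hm
    exact h (mem_support_iff.2 hm)

theorem fin_set (z : ℤ) : {m : Fin n →₀ ℕ | ((m.degree : ℕ) : ℤ) = z} =
    if 0 ≤ z then ((Finset.univ.finsuppAntidiag z.toNat : Finset (Fin n →₀ ℕ)) : Set (Fin n →₀ ℕ)) else ∅ := by
  ext m
  split_ifs with h
  · simp only [Set.mem_setOf_eq, Finset.mem_coe, Finset.mem_finsuppAntidiag, Finset.subset_univ, and_true,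
      Finsupp.degree_eq_sum]
    have e : Finset.univ.sum ⇑m = ∑ i, m i := rfl
    rw [e]
    omega
  · simp only [Set.mem_setOf_eq, Set.mem_empty_iff_false, iff_false]
    omega

instance finDS (z : ℤ) : Module.Finite ℂ (DS {z} : Submodule ℂ (V n)) := by
  rw [DS_eq, fin_set]
  have : Finite ↑(if 0 ≤ z then ((Finset.univ.finsuppAntidiag z.toNat : Finset (Fin n →₀ ℕ)) : Set (Fin n →₀ ℕ)) else ∅) := by
    split_ifs
    · exact Finset.finite_toSet _
    · exact Set.finite_empty
  exact Module.Finite.of_basis (basisRestrictSupport ℂ _)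

theorem dm_eq (z : ℤ) : dm n z = if 0 ≤ z then (n + z.toNat - 1).choose z.toNat else 0 := by
  rw [dm, DS_eq, Module.finrank_eq_nat_card_basis (basisRestrictSupport ℂ _), fin_set]
  split_ifs with h
  · have := Finset.card_finsuppAntidiag_nat_eq_choose (s := (Finset.univ : Finset (Fin n))) z.toNat
    rw [Finset.card_univ, Fintype.card_fin] at this
    rw [← this, Nat.card_coe_set_eq, Set.ncard_coe_finset]
  · simp

theorem dim_le {gr : Gr (S n)} (hC : ∀ r, gr.c 0 (C r) = C r) (hX : ∀ i, gr.c (wv i) (X i) = X i)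
    {ι κ : Type} [Fintype ι] [Fintype κ] [DecidableEq κ] (a : ι → ℤ) (b : κ → ℤ)
    (A : Matrix ι κ (S n)) (hA : gr.HomM a b A)
    (B : Matrix κ ι (S n)) (r : ℕ) (h : B * A = ss n ^ r • (1 : Matrix κ κ (S n))) :
    ∃ N0 : ℕ, ∀ N ≥ N0, ∑ j, dm n ((N : ℤ) - b j) ≤ ∑ i, dm n ((N : ℤ) - a i) := by
  obtain ⟨N0, h0⟩ := inj_large b A B r h
  refine ⟨N0, fun N hN => ?_⟩
  let f : (∀ j, (DS {(N : ℤ) - b j} : Submodule ℂ (V n))) →ₗ[ℂ] (∀ i, (DS {(N : ℤ) - a i} : Submodule ℂ (V n))) :=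
    LinearMap.pi fun i => LinearMap.codRestrict _
      (∑ j, (op N (A i j) ∘ₗ Submodule.subtype _) ∘ₗ LinearMap.proj j) (by
        intro p
        rw [LinearMap.sum_apply]
        refine Submodule.sum_mem _ fun j _ => ?_
        have := op_DS hC hX (hA i j) N _ _ (p j).2
        rw [show (N : ℤ) - b j - (a i - b j) = N - a i by ring] at this
        exact this)
  have hf : Function.Injective f := by
    rw [← LinearMap.ker_eq_bot, LinearMap.ker_eq_bot']
    intro p hp
    have h1 := h0 N hN (fun j => (p j : V n)) (fun j => (p j).2) (fun i => by
      have := congrArg Subtype.val (congrFun hp i)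
      simpa [f] using this)
    refine _root_.funext fun j => Subtype.ext ?_
    exact congrFun h1 j
  have := LinearMap.finrank_le_finrank_of_injective hf
  rwa [Module.finrank_pi_fintype, Module.finrank_pi_fintype] at this

end Toep
end AdjFac

namespace AdjFac
namespace Toep

theorem coeff_Xpow_G {n : ℕ} (hn : 0 < n) (k M : ℕ) :
    PowerSeries.coeff M ((PowerSeries.X : PowerSeries ℤ) ^ k * (PowerSeries.invOneSubPow ℤ n).val) =
      (dm n ((M : ℤ) - k) : ℤ) := by
  rw [PowerSeries.coeff_X_pow_mul', dm_eq, PowerSeries.invOneSubPow_val_eq_mk_sub_one_add_choose_of_pos _ _ hn,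
    PowerSeries.coeff_mk]
  by_cases h : k ≤ M
  · rw [if_pos h, if_pos (by omega)]
    have : ((M : ℤ) - k).toNat = M - k := by omega
    rw [this, show n + (M - k) - 1 = n - 1 + (M - k) by omega, ← Nat.choose_symm_add]
  · rw [if_neg h, if_neg (by omega)]; rfl

theorem sum_eq {n : ℕ} (hn : 0 < n) {A : Type} [CommRing A] (θ : ℤ → A) (h0 : θ 0 = 1)
    (hadd : ∀ p q, θ (p + q) = θ p * θ q) (hz : (θ 1 - 1) ^ n = 0) (P Q : Multiset ℤ)
    (h : ∃ N0 : ℕ, ∀ N ≥ N0, (P.map fun p => dm n ((N : ℤ) - p)).sum = (Q.map fun p => dm n ((N : ℤ) - p)).sum) :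
    (P.map θ).sum = (Q.map θ).sum := by
  obtain ⟨N0, hN⟩ := h
  have hR : ∃ R : ℕ, ∀ p ∈ P + Q, 0 ≤ p + (R : ℤ) := by
    refine ⟨((P + Q).map Int.natAbs).sum, fun p hp => ?_⟩
    have := Multiset.single_le_sum (fun x _ => Nat.zero_le x) _ (Multiset.mem_map_of_mem Int.natAbs hp)
    omega
  obtain ⟨R, hR⟩ := hR
  let F : Multiset ℤ → Polynomial ℤ := fun P => (P.map fun p : ℤ => (Polynomial.X : Polynomial ℤ) ^ (p + (R : ℤ)).toNat).sum
  have hθ : ∀ k : ℕ, θ k = θ 1 ^ k := by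
    intro k
    induction k with
    | zero => simpa using h0
    | succ k ih => push_cast; rw [hadd, ih, pow_succ]
  have hF : ∀ P : Multiset ℤ, (∀ p ∈ P, 0 ≤ p + (R : ℤ)) → 
      θ (-R) * Polynomial.aeval (θ 1) (F P) = (P.map θ).sum := by
    intro P hP
    have e : θ (-R) * Polynomial.aeval (θ 1) (F P) = 
      (P.map fun p => θ (-R) * θ 1 ^ (p + (R : ℤ)).toNat).sum := by
      simp only [F, map_multiset_sum, Multiset.map_map, Function.comp_def, map_pow, Polynomial.aeval_X,
        Multiset.sum_map_mul_left]
    rw [e]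
    congr 1
    refine Multiset.map_congr rfl fun p hp => ?_
    rw [← hθ, ← hadd]
    congr 1
    have := hP p hp
    omega
  have hG : ∀ P : Multiset ℤ, (∀ p ∈ P, 0 ≤ p + (R : ℤ)) → ∀ M : ℕ,
      PowerSeries.coeff M ((F P : PowerSeries ℤ) * (PowerSeries.invOneSubPow ℤ n).val) =
      (((P.map fun p => dm n ((M : ℤ) - R - p)).sum : ℕ) : ℤ) := by
    intro P hP M
    have e1 : (F P : PowerSeries ℤ) = (P.map fun p => (PowerSeries.X : PowerSeries ℤ) ^ (p + (R : ℤ)).toNat).sum := by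
      change Polynomial.coeToPowerSeries.ringHom (F P) = _
      simp only [F, map_multiset_sum, Multiset.map_map, Function.comp_def, map_pow,
        Polynomial.coeToPowerSeries.ringHom_apply, Polynomial.coe_X]
    rw [e1, ← Multiset.sum_map_mul_right, map_multiset_sum, Multiset.map_map]
    push_cast
    rw [Multiset.map_map]
    congr 1
    refine Multiset.map_congr rfl fun p hp => ?_
    have := hP p hp
    simp only [Function.comp_def]
    rw [coeff_Xpow_G hn]
    congr 2
    omega
  have hP : ∀ p ∈ P, 0 ≤ p + (R : ℤ) := fun p hp => hR p (Multiset.mem_add.2 (Or.inl hp))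
  have hQ : ∀ p ∈ Q, 0 ≤ p + (R : ℤ) := fun p hp => hR p (Multiset.mem_add.2 (Or.inr hp))
  set f := F P - F Q with hf
  set g : PowerSeries ℤ := (f : PowerSeries ℤ) * (PowerSeries.invOneSubPow ℤ n).val with hg
  have hgz : ∀ M ≥ N0 + R, PowerSeries.coeff M g = 0 := by
    intro M hM
    rw [hg, hf, Polynomial.coe_sub, sub_mul, map_sub, hG P hP, hG Q hQ]
    have := hN (M - R) (by omega)
    rw [Nat.cast_sub (by omega)] at this
    rw [this, sub_self]
  have hq : ((g.trunc (N0 + R) : Polynomial ℤ) : PowerSeries ℤ) = g := by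
    ext M
    rw [Polynomial.coeff_coe, PowerSeries.coeff_trunc]
    split_ifs with hM
    · rfl
    · rw [hgz M (by omega)]
  have hfac : f = g.trunc (N0 + R) * (1 - Polynomial.X) ^ n := by
    apply Polynomial.coe_injective
    rw [Polynomial.coe_mul, hq, Polynomial.coe_pow, show ((1 - Polynomial.X : Polynomial ℤ) : PowerSeries ℤ) = 1 - PowerSeries.X by
        rw [Polynomial.coe_sub, Polynomial.coe_one, Polynomial.coe_X],
      ← PowerSeries.invOneSubPow_inv_eq_one_sub_pow, hg, mul_assoc, Units.val_inv, mul_one]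
  have hev : Polynomial.aeval (θ 1) f = 0 := by
    rw [hfac, map_mul, map_pow, map_sub, map_one, Polynomial.aeval_X, ← neg_sub, neg_pow, hz]; simp
  rw [← hF P hP, ← hF Q hQ]
  rw [hf, map_sub, sub_eq_zero] at hev
  rw [hev]

open MvPolynomial in
theorem htoep {n : ℕ} (hn : 0 < n) {gr : Gr (S n)} (hC : ∀ r, gr.c 0 (C r) = C r) (hX : ∀ i, gr.c (wv i) (X i) = X i)
    (hs : gr.c 0 (ss n) = ss n) {T : Type} [Field T] [Algebra (S n) T]
    (hinj : Function.Injective (algebraMap (S n) T))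
    {A : Type} [CommRing A] (θ : ℤ → A) (h0 : θ 0 = 1)
    (hadd : ∀ p q, θ (p + q) = θ p * θ q) (hz : (θ 1 - 1) ^ n = 0) (P Q : Multiset ℤ)
    (h : WI.fr (gr.toGH (ss n) hs T) P = WI.fr (gr.toGH (ss n) hs T) Q) : (P.map θ).sum = (Q.map θ).sum := by
  refine sum_eq hn θ h0 hadd hz P Q ?_
  obtain ⟨l, a, rfl⟩ := WI.exists_free P
  obtain ⟨l', b, rfl⟩ := WI.exists_free Q
  rw [← WI.cls_free, ← WI.cls_free, WI.cls_eq] at h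
  obtain ⟨x, y, hx, hy, hxy, hyx⟩ := h
  change Matrix (Fin l) (Fin l') T at x
  change Matrix (Fin l') (Fin l) T at y
  change (x * y : Matrix (Fin l) (Fin l) T) = 1 at hxy
  change (y * x : Matrix (Fin l') (Fin l') T) = 1 at hyx
  obtain ⟨D, A', hA, hA'⟩ := Gr.exists_clear (ι := Fin l) (κ := Fin l') hx
  obtain ⟨D', B, hB, hB'⟩ := Gr.exists_clear (ι := Fin l') (κ := Fin l) hy
  have eA : A'.map (algebraMap (S n) T) = algebraMap (S n) T (ss n ^ D) • x := by
    ext i j; exact hA' i j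
  have eB : B.map (algebraMap (S n) T) = algebraMap (S n) T (ss n ^ D') • y := by
    ext i j; exact hB' i j
  have e1 : A' * B = ss n ^ (D + D') • (1 : Matrix (Fin l) (Fin l) (S n)) := by
    apply Matrix.map_injective hinj
    beta_reduce
    rw [Matrix.map_mul, eA, eB, Matrix.smul_mul, Matrix.mul_smul, hxy, smul_smul, ← map_mul, ← pow_add]
    ext i j
    by_cases hij : i = j <;> simp [Matrix.one_apply, hij]
  have e2 : B * A' = ss n ^ (D + D') • (1 : Matrix (Fin l') (Fin l') (S n)) := by
    apply Matrix.map_injective hinj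
    beta_reduce
    rw [Matrix.map_mul, eA, eB, Matrix.smul_mul, Matrix.mul_smul, hyx, smul_smul, ← map_mul, ← pow_add,
      add_comm D']
    ext i j
    by_cases hij : i = j <;> simp [Matrix.one_apply, hij]
  obtain ⟨N1, h1⟩ := dim_le hC hX a b A' hA B _ e2
  obtain ⟨N2, h2⟩ := dim_le hC hX b a B hB A' _ e1
  refine ⟨N1 + N2, fun N hN => ?_⟩
  rw [Multiset.map_map, Multiset.map_map]
  exact le_antisymm (h2 N (by omega)) (h1 N (by omega))

end Toep
end AdjFac

namespace AdjFac
namespace Num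
open PowerSeries

theorem exists_ring (n : ℕ) (hn : 0 < n) : ∃ (A : Type) (_ : CommRing A) (θ π : ℤ → A) (z : A) (ε : A →+* ℤ),
    θ 0 = 1 ∧ (∀ p q, θ (p + q) = θ p * θ q) ∧ (θ 1 - 1) ^ n = 0 ∧ (∀ p, θ p - 1 = z * π p) ∧
    (∀ p, ε (π p) = p) ∧ ∀ m < n, ∀ x, z ^ m * x = 0 → ε x = 0 := by
  let I : Ideal ℤ⟦X⟧ := Ideal.span {X ^ n}
  have hu : IsUnit (1 + X : ℤ⟦X⟧) := by
    rw [PowerSeries.isUnit_iff_constantCoeff]; simp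
  obtain ⟨u, hu⟩ := hu
  have hc : ∀ p : ℤ, constantCoeff ((u ^ p : (ℤ⟦X⟧)ˣ) : ℤ⟦X⟧) = 1 := by
    intro p
    have h1 : Units.map (constantCoeff (R := ℤ)).toMonoidHom u = 1 := by
      ext; simp [hu]
    have h2 : Units.map (constantCoeff (R := ℤ)).toMonoidHom (u ^ p) = 1 := by
      rw [map_zpow, h1, one_zpow]
    exact congrArg Units.val h2
  have hd : ∀ p : ℤ, ∃ g : ℤ⟦X⟧, ((u ^ p : (ℤ⟦X⟧)ˣ) : ℤ⟦X⟧) - 1 = X * g := by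
    intro p
    apply PowerSeries.X_dvd_iff.2
    rw [map_sub, hc, map_one, sub_self]
  choose g hg using hd
  have hgc : ∀ p, constantCoeff (g p) = p := by
    have hadd : ∀ p q, constantCoeff (g (p + q)) = constantCoeff (g p) + constantCoeff (g q) := by
      intro p q
      have : g (p + q) = ((u ^ p : (ℤ⟦X⟧)ˣ) : ℤ⟦X⟧) * g q + g p := by
        apply mul_left_cancel₀ (PowerSeries.X_ne_zero (R := ℤ))
        rw [mul_add, ← hg, mul_left_comm, ← hg, ← hg, zpow_add, Units.val_mul]; ring
      rw [this, map_add, map_mul, hc, one_mul, add_comm]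
    have h1 : constantCoeff (g 1) = 1 := by
      have : g 1 = 1 := by
        apply mul_left_cancel₀ (PowerSeries.X_ne_zero (R := ℤ))
        rw [← hg, zpow_one, hu]; ring
      rw [this, map_one]
    let φ : ℤ →+ ℤ := AddMonoidHom.mk' (fun p => constantCoeff (g p)) hadd
    intro p
    have : φ = AddMonoidHom.id ℤ := by
      ext; exact h1
    exact DFunLike.congr_fun this p
  refine ⟨ℤ⟦X⟧ ⧸ I, inferInstance, fun p => Ideal.Quotient.mk I ((u ^ p : (ℤ⟦X⟧)ˣ) : ℤ⟦X⟧),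
    fun p => Ideal.Quotient.mk I (g p), Ideal.Quotient.mk I X,
    Ideal.Quotient.lift I (constantCoeff (R := ℤ)) ?_, ?_, ?_, ?_, ?_, ?_, ?_⟩
  · intro a ha
    obtain ⟨b, rfl⟩ := Ideal.mem_span_singleton'.1 ha
    simp [hn.ne']
  · simp
  · intro p q; beta_reduce; rw [zpow_add, Units.val_mul, map_mul]
  · beta_reduce; rw [zpow_one, hu, ← map_one (Ideal.Quotient.mk I), ← map_sub, ← map_pow, Ideal.Quotient.eq_zero_iff_mem]
    rw [add_sub_cancel_left]
    exact Ideal.mem_span_singleton_self _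
  · intro p
    rw [← map_mul, ← hg, map_sub, map_one]
  · intro p
    rw [Ideal.Quotient.lift_mk, hgc]
  · intro m hm x hx
    obtain ⟨x, rfl⟩ := Ideal.Quotient.mk_surjective x
    rw [← map_pow, ← map_mul, Ideal.Quotient.eq_zero_iff_mem, Ideal.mem_span_singleton] at hx
    rw [Ideal.Quotient.lift_mk, ← PowerSeries.X_dvd_iff]
    obtain ⟨y, hy⟩ := hx
    refine ⟨X ^ (n - m - 1) * y, ?_⟩
    apply mul_left_cancel₀ (pow_ne_zero m (PowerSeries.X_ne_zero (R := ℤ)))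
    rw [hy, ← mul_assoc, ← mul_assoc, ← pow_succ, ← pow_add]
    congr 2; omega

/-- the product attached to a multiset -/
noncomputable def pr {A : Type} [CommRing A] (θ : ℤ → A) (P : Multiset ℤ) : A⟦X⟧ :=
  (P.map fun q => 1 + C (θ q) * (X : A⟦X⟧)).prod

variable {A : Type} [CommRing A]

theorem pr_cons (θ : ℤ → A) (p : ℤ) (P : Multiset ℤ) : pr θ (p ::ₘ P) = (1 + C (θ p) * X) * pr θ P := by
  simp [pr]

theorem pr_add (θ : ℤ → A) (P Q : Multiset ℤ) : pr θ (P + Q) = pr θ P * pr θ Q := by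
  simp [pr]

theorem pr_cc (θ : ℤ → A) (P : Multiset ℤ) : constantCoeff (pr θ P) = 1 := by
  induction P using Multiset.induction_on with
  | empty => simp [pr]
  | cons p P ih => rw [pr_cons, map_mul, ih]; simp

theorem pr_unit (θ : ℤ → A) (P : Multiset ℤ) : IsUnit (pr θ P) := by
  rw [PowerSeries.isUnit_iff_constantCoeff, pr_cc]; exact isUnit_one

theorem pr_map {B : Type} [CommRing B] (φ : A →+* B) (θ : ℤ → A) (P : Multiset ℤ) :
    PowerSeries.map φ (pr θ P) = pr (fun p => φ (θ p)) P := by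
  induction P using Multiset.induction_on with
  | empty => simp [pr]
  | cons p P ih => rw [pr_cons, pr_cons, map_mul, ih]; simp

theorem pr_rescale (z : A) (θ : ℤ → A) (P : Multiset ℤ) :
    rescale z (pr θ P) = pr (fun p => z * θ p) P := by
  induction P using Multiset.induction_on with
  | empty => simp [pr]
  | cons p P ih =>
    rw [pr_cons, pr_cons, map_mul, ih]; congr 1
    ext i
    rw [coeff_rescale]
    rcases i with _ | _ | i
    · simp
    · simp [coeff_one]
    · simp [coeff_one, coeff_succ_mul_X, coeff_C]

/-- polynomial version -/
noncomputable def pp (θ : ℤ → A) (P : Multiset ℤ) : Polynomial A :=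
  (P.map fun q => 1 + Polynomial.C (θ q) * (Polynomial.X : Polynomial A)).prod

theorem pp_cons (θ : ℤ → A) (p : ℤ) (P : Multiset ℤ) :
    pp θ (p ::ₘ P) = (1 + Polynomial.C (θ p) * Polynomial.X) * pp θ P := by
  simp [pp]

theorem pp_coe (θ : ℤ → A) (P : Multiset ℤ) : (pp θ P : A⟦X⟧) = pr θ P := by
  induction P using Multiset.induction_on with
  | empty => simp [pp, pr]
  | cons p P ih => rw [pr_cons, pp_cons, Polynomial.coe_mul, ih]; simp

theorem pp_aeval (θ : ℤ → A) (P : Multiset ℤ) (v : A⟦X⟧) (hv : (1 - X) * v = 1) :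
    (1 - X) ^ P.card * Polynomial.aeval (X * v) (pp θ P) = pr (fun p => θ p - 1) P := by
  induction P using Multiset.induction_on with
  | empty => simp [pp, pr]
  | cons p P ih =>
    rw [pr_cons, pp_cons, map_mul, ← ih, Multiset.card_cons, pow_succ]
    simp only [map_add, map_one, map_mul, Polynomial.aeval_C, Polynomial.aeval_X, map_sub]
    change _ * ((1 + C (θ p) * (X * v)) * _) = _
    have : (1 - X) * (1 + C (θ p) * (X * v)) = 1 + (C (θ p) - 1) * X := by
      linear_combination (C (θ p) * X) * hv
    rw [← this]; ring

theorem numeric {n : ℕ} (θ π : ℤ → A) (z : A) (ε : A →+* ℤ) (hθ : ∀ p, θ p - 1 = z * π p)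
    (hε : ∀ p, ε (π p) = p) (hreg : ∀ m < n, ∀ x, z ^ m * x = 0 → ε x = 0)
    (d : ℕ) (P Q : Multiset ℤ) (hcard : P.card = Q.card + d) (w : ℕ → A) (hw : ∀ m, d < m → w m = 0)
    (h : PowerSeries.mk w * pr θ Q = pr θ P) (f : ℤ⟦X⟧)
    (hf : f * pr (fun p => p) Q = pr (fun p => p) P) (m : ℕ) (hdm : d < m) (hmn : m < n) :
    coeff m f = 0 := by
  let W : Polynomial A := ∑ i ∈ Finset.range (d + 1), Polynomial.C (w i) * Polynomial.X ^ i
  have hW : (W : A⟦X⟧) = PowerSeries.mk w := by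
    ext i
    rw [Polynomial.coeff_coe, coeff_mk]
    simp only [W, Polynomial.finsetSum_coeff, Polynomial.coeff_C_mul_X_pow]
    rw [Finset.sum_ite_eq]
    split_ifs with hi
    · rfl
    · rw [hw i (by simpa using hi)]
  have hpoly : W * pp θ Q = pp θ P := by
    apply Polynomial.coe_injective
    rw [Polynomial.coe_mul, pp_coe, pp_coe, hW, h]
  let v : A⟦X⟧ := PowerSeries.mk 1
  have hv : (1 - X) * v = 1 := by rw [mul_comm]; exact mk_one_mul_one_sub_eq_one A
  let G : A⟦X⟧ := (1 - X) ^ d * Polynomial.aeval (X * v) W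
  have hG : G * pr (fun p => θ p - 1) Q = pr (fun p => θ p - 1) P := by
    rw [← pp_aeval θ Q v hv, ← pp_aeval θ P v hv, ← hpoly, map_mul, hcard, pow_add]
    ring
  have hGm : coeff m G = 0 := by
    have : G = ((∑ i ∈ Finset.range (d + 1), Polynomial.C (w i) * (Polynomial.X ^ i * (1 - Polynomial.X) ^ (d - i)) : Polynomial A) : A⟦X⟧) := by
      rw [← Polynomial.coeToPowerSeries.ringHom_apply]
      simp only [G, W, map_sum, map_mul, Finset.mul_sum, map_pow, Polynomial.aeval_C, Polynomial.aeval_X,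
        Polynomial.coeToPowerSeries.ringHom_apply, Polynomial.coe_C, Polynomial.coe_X, map_sub, map_one]
      apply Finset.sum_congr rfl
      intro i hi
      have hi' : i ≤ d := by simpa [Nat.lt_succ_iff] using hi
      change (1 - X) ^ d * (C (w i) * (X * v) ^ i) = _
      have e : (1 - X : A⟦X⟧) ^ d = (1 - X) ^ (d - i) * (1 - X) ^ i := by rw [← pow_add]; congr 1; omega
      have e2 : (1 - X : A⟦X⟧) ^ i * v ^ i = 1 := by rw [← mul_pow, hv, one_pow]
      rw [e, mul_pow]
      linear_combination ((1 - X) ^ (d - i) * C (w i) * X ^ i) * e2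
    rw [this, Polynomial.coeff_coe]
    apply Polynomial.coeff_eq_zero_of_natDegree_lt
    refine lt_of_le_of_lt (Polynomial.natDegree_sum_le_of_forall_le (n := d) _ _ fun i hi => ?_) hdm
    have hi' : i ≤ d := by simpa [Nat.lt_succ_iff] using hi
    compute_degree
    omega
  obtain ⟨c, hc⟩ := pr_unit π Q
  let F : A⟦X⟧ := pr π P * (c⁻¹ : (A⟦X⟧)ˣ)
  have hF : F * pr π Q = pr π P := by
    rw [← hc]; simp [F]
  have h1 : rescale z F = G := by
    have e := congrArg (rescale z) hF
    rw [map_mul, pr_rescale, pr_rescale] at e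
    simp only [hθ] at hG
    exact (pr_unit (fun p => z * π p) Q).mul_right_cancel (e.trans hG.symm)
  have h2 : PowerSeries.map ε F = f := by
    have e := congrArg (PowerSeries.map ε) hF
    rw [map_mul, pr_map, pr_map] at e
    simp only [hε] at e
    exact (pr_unit _ Q).mul_right_cancel (e.trans hf.symm)
  rw [← h2, coeff_map]
  apply hreg m hmn
  rw [← coeff_rescale, h1, hGm]

end Num
end AdjFac

namespace AdjFac
namespace WI
variable {T : Type} [CommRing T] {gh : GH T}

/-- the trace on classes -/
noncomputable def tr (gh : GH T) : M gh →+ T where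
  toFun := Quotient.lift (fun E : WI gh => E.e.trace) (by
    rintro E F ⟨x, y, -, -, h1, h2⟩
    change E.e.trace = F.e.trace
    rw [← h1, ← h2, Matrix.trace_mul_comm])
  map_zero' := by
    change Matrix.trace (0 : Matrix _ _ T) = 0
    exact Matrix.trace_zero _ _
  map_add' := by
    rintro ⟨E⟩ ⟨F⟩
    change Matrix.trace (Matrix.fromBlocks E.e 0 0 F.e) = E.e.trace + F.e.trace
    simp [Matrix.trace, Fintype.sum_sum_type]

theorem tr_cls (E : WI gh) : tr gh (cls E) = E.e.trace := rfl

theorem tr_fr (P : Multiset ℤ) : tr gh (fr gh P) = P.card := by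
  induction P using Multiset.induction_on with
  | empty => simp
  | cons p P ih =>
    rw [← Multiset.singleton_add, map_add, map_add, ih, fr_singleton, tr_cls, Multiset.card_add]
    have : (free gh fun _ : Unit => p).e = (1 : Matrix Unit Unit T) := rfl
    have h2 : (free gh fun _ : Unit => p).e.trace = 1 := by
      change Matrix.trace (1 : Matrix Unit Unit T) = 1
      simp
    rw [h2]; simp

end WI

open Num PowerSeries in
theorem KT {n : ℕ} (hn : 0 < n) {gr : Gr (Toep.S n)} (hF : gr.HFFR)
    (hC : ∀ r, gr.c 0 (MvPolynomial.C r) = MvPolynomial.C r)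
    (hX : ∀ i, gr.c (Toep.wv i) (MvPolynomial.X i) = MvPolynomial.X i)
    (hs : gr.c 0 (Toep.ss n) = Toep.ss n) (h0 : Toep.ss n ≠ 0) {T : Type} [Field T] [CharZero T] [Algebra (Toep.S n) T]
    (hinj : Function.Injective (algebraMap (Toep.S n) T))
    (hQ : ∀ m : ℕ, (m : T)⁻¹ ∈ (gr.toGH (Toep.ss n) hs T).H 0)
    (E F : WI (gr.toGH (Toep.ss n) hs T)) (d d' : ℕ) (hd : E.e.trace = d) (hd' : F.e.trace = d')
    (h : WI.cls E + WI.cls F + WI.fr _ {1} = WI.fr _ (Multiset.replicate n 0)) :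
    ∃ (P Q P' Q' : Multiset ℤ) (f e : ℤ⟦X⟧),
      f * pr (fun p => p) Q = pr (fun p => p) P ∧ e * pr (fun p => p) Q' = pr (fun p => p) P' ∧
      (∀ m, d < m → m < n → coeff m f = 0) ∧ (∀ m, d' < m → m < n → coeff m e = 0) ∧
      ∀ m, 0 < m → m < n → coeff m (f * e * (1 + X)) = 0 := by
  obtain ⟨A, _, θ, π, z, ε, ht0, hadd, hz, hπ, hε, hreg⟩ := exists_ring n hn
  have hu : ∃ t : T, algebraMap (Toep.S n) T (Toep.ss n) * t = 1 :=
    ⟨_, mul_inv_cancel₀ (fun hh => h0 (hinj (by rw [hh, map_zero])))⟩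
  have hstab := fun E => hF.stab (hs := hs) hinj h0 hu E
  obtain ⟨χ, hfr, hsh⟩ := WI.exists_chi θ hadd
    (fun P Q hPQ => Toep.htoep hn hC hX hs hinj θ ht0 hadd hz P Q hPQ) hstab
  have main : ∀ (E : WI (gr.toGH (Toep.ss n) hs T)) (d : ℕ), E.e.trace = d → ∀ P Q,
      WI.cls E + WI.fr _ Q = WI.fr _ P → ∀ f : ℤ⟦X⟧, f * pr (fun p => p) Q = pr (fun p => p) P →
      ∀ m, d < m → m < n → coeff m f = 0 := by
    intro E d hd P Q hPQ f hf
    have hcard : P.card = Q.card + d := by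
      have := congrArg (WI.tr _) hPQ
      rw [map_add, WI.tr_fr, WI.tr_fr, WI.tr_cls, hd] at this
      have h2 : d + Q.card = P.card := by exact_mod_cast this
      omega
    have hr := WI.rank_of_trace E.e E.idem d hd
    refine numeric θ π z ε hπ hε hreg d P Q hcard _ ?_
      (WI.lam_series hQ θ ht0 χ hfr hsh E P Q hPQ) f hf
    intro m hm
    beta_reduce
    rw [WI.lam_eq_zero hQ m E (by omega), map_zero]
  obtain ⟨P, Q, hE⟩ := hstab E
  obtain ⟨P', Q', hE'⟩ := hstab F
  obtain ⟨u, hu⟩ := pr_unit (fun p : ℤ => p) Q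
  obtain ⟨u', hu'⟩ := pr_unit (fun p : ℤ => p) Q'
  have hf : (pr (fun p : ℤ => p) P * (u⁻¹ : (ℤ⟦X⟧)ˣ)) * pr (fun p : ℤ => p) Q = pr (fun p : ℤ => p) P := by
    rw [← hu]; simp
  have he : (pr (fun p : ℤ => p) P' * (u'⁻¹ : (ℤ⟦X⟧)ˣ)) * pr (fun p : ℤ => p) Q' = pr (fun p : ℤ => p) P' := by
    rw [← hu']; simp
  refine ⟨P, Q, P', Q', _, _, hf, he, main E d hd P Q hE _ hf, main F d' hd' P' Q' hE' _ he, ?_⟩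
  generalize (pr (fun p : ℤ => p) P * (u⁻¹ : (ℤ⟦X⟧)ˣ)) = f at hf
  generalize (pr (fun p : ℤ => p) P' * (u'⁻¹ : (ℤ⟦X⟧)ˣ)) = e at he
  refine main (WI.zero _) 0 ?_ (P + P' + {1}) (Q + Q' + Multiset.replicate n 0) ?_ _ ?_
  · change Matrix.trace (0 : Matrix _ _ T) = _
    rw [Matrix.trace_zero]; simp
  · rw [WI.cls_zero rfl, zero_add]
    simp only [map_add]
    rw [← h, ← hE, ← hE']; abel
  · have h1 : pr (fun p : ℤ => p) {1} = 1 + X := by simp [pr]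
    have h2 : pr (fun p : ℤ => p) (Multiset.replicate n 0) = 1 := by simp [pr]
    simp only [pr_add]
    rw [h1, h2, ← hf, ← he]; ring

end AdjFac

namespace AdjFac
namespace NT
open PowerSeries Num

variable {r : ℕ} [Fact r.Prime]

/-- truncated logarithmic derivative -/
noncomputable def L (r : ℕ) (P : Multiset ℤ) : Polynomial (ZMod r) :=
  (P.map fun p : ℤ => Polynomial.C (p : ZMod r) * ∑ i ∈ Finset.range (r - 1),
    (Polynomial.C (-(p : ZMod r)) * Polynomial.X) ^ i).sum

theorem L_cons (p : ℤ) (P : Multiset ℤ) : L r (p ::ₘ P) = Polynomial.C (p : ZMod r) * ∑ i ∈ Finset.range (r - 1),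
    (Polynomial.C (-(p : ZMod r)) * Polynomial.X) ^ i + L r P := by
  simp only [L, Multiset.map_cons, Multiset.sum_cons]

theorem L_deg (P : Multiset ℤ) : (L r P).natDegree ≤ r - 2 := by
  induction P using Multiset.induction_on with
  | empty => simp [L]
  | cons p P ih =>
    rw [L_cons]
    refine (Polynomial.natDegree_add_le _ _).trans (max_le ?_ ih)
    refine (Polynomial.natDegree_C_mul_le _ _).trans ?_
    refine Polynomial.natDegree_sum_le_of_forall_le _ _ fun i hi => ?_
    have hi2 : i ≤ r - 2 := by have := Finset.mem_range.1 hi; omega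
    refine le_trans ?_ hi2
    compute_degree

theorem L_one (p : ℤ) : (1 + Polynomial.C (p : ZMod r) * Polynomial.X) * (Polynomial.C (p : ZMod r) * ∑ i ∈ Finset.range (r - 1),
    (Polynomial.C (-(p : ZMod r)) * Polynomial.X) ^ i) = Polynomial.C (p : ZMod r) * (1 - Polynomial.X ^ (r - 1)) := by
  have hp : (-(p : ZMod r)) * (-(p : ZMod r)) ^ (r - 1) = -(p : ZMod r) := by
    rw [← pow_succ', Nat.sub_add_cancel (Fact.out : r.Prime).one_le, ZMod.pow_card]
  have h1 := mul_neg_geom_sum (Polynomial.C (-(p : ZMod r)) * Polynomial.X) (r - 1)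
  rw [mul_pow, ← map_pow] at h1
  have h2 := congrArg (Polynomial.C : ZMod r →+* _) hp
  simp only [map_mul, map_neg] at h1 h2 ⊢
  linear_combination (Polynomial.C (p : ZMod r)) * h1 + Polynomial.X ^ (r - 1) * h2

theorem pr_deriv (P : Multiset ℤ) : d⁄dX (ZMod r) (pr (fun p : ℤ => (p : ZMod r)) P) * (1 - X ^ (r - 1)) =
    pr (fun p : ℤ => (p : ZMod r)) P * (L r P : (ZMod r)⟦X⟧) := by
  induction P using Multiset.induction_on with
  | empty => simp [pr, L]
  | cons p P ih =>
    rw [pr_cons, L_cons, Derivation.leibniz, Polynomial.coe_add]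
    have h1 := congrArg (fun q : Polynomial (ZMod r) => (q : (ZMod r)⟦X⟧)) (L_one (r := r) p)
    simp only [Polynomial.coe_mul, Polynomial.coe_add, Polynomial.coe_one, Polynomial.coe_C, Polynomial.coe_X,
      Polynomial.coe_sub, Polynomial.coe_pow] at h1 ⊢
    have h2 : d⁄dX (ZMod r) (1 + C (p : ZMod r) * X) = C (p : ZMod r) := by
      rw [map_add, Derivation.leibniz, derivative_C, derivative_X]; simp
    rw [h2, smul_eq_mul, smul_eq_mul]
    linear_combination (1 + C (p : ZMod r) * X) * ih - (pr (fun p : ℤ => (p : ZMod r)) P) * h1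

theorem logd {n d : ℕ} {P Q : Multiset ℤ} {f : ℤ⟦X⟧} (hf : f * pr (fun p => p) Q = pr (fun p => p) P)
    (hc : ∀ m, d < m → m < n → coeff m f = 0) (hd : 0 < d) (hr : r ≤ n - d) :
    ∃ h : Polynomial (ZMod r), h.natDegree ≤ r - 2 ∧
      Polynomial.derivative ((trunc (d + 1) f).map (Int.castRingHom (ZMod r))) * (1 - Polynomial.X ^ (r - 1)) =
        (trunc (d + 1) f).map (Int.castRingHom (ZMod r)) * h := by
  have hr2 : 2 ≤ r := (Fact.out : r.Prime).two_le
  refine ⟨L r P - L r Q, (Polynomial.natDegree_sub_le _ _).trans (max_le (L_deg _) (L_deg _)), ?_⟩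
  set fb := (trunc (d + 1) f).map (Int.castRingHom (ZMod r)) with hfb
  set F := PowerSeries.map (Int.castRingHom (ZMod r)) f with hF
  have hFe : F * pr (fun p : ℤ => (p : ZMod r)) Q = pr (fun p : ℤ => (p : ZMod r)) P := by
    have := congrArg (PowerSeries.map (Int.castRingHom (ZMod r))) hf
    rw [map_mul, pr_map, pr_map] at this
    exact this
  have h1 : d⁄dX (ZMod r) F * (1 - X ^ (r - 1)) = F * ((L r P - L r Q : Polynomial (ZMod r)) : (ZMod r)⟦X⟧) := by
    apply (pr_unit (fun p : ℤ => (p : ZMod r)) Q).mul_right_cancel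
    have e1 := congrArg (d⁄dX (ZMod r)) hFe
    rw [Derivation.leibniz, smul_eq_mul, smul_eq_mul] at e1
    have e2 := pr_deriv (r := r) P
    have e3 := pr_deriv (r := r) Q
    rw [← e1, ← hFe] at e2
    rw [Polynomial.coe_sub]
    linear_combination e2 - F * e3
  have hfbd : fb.natDegree ≤ d := by
    refine Polynomial.natDegree_map_le.trans ?_
    have := natDegree_trunc_lt f d
    omega
  have hfF : ∀ m, m < n → fb.coeff m = coeff m F := by
    intro m hm
    rw [hfb, Polynomial.coeff_map, coeff_trunc, hF, coeff_map]
    split_ifs with h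
    · rfl
    · rw [hc m (by omega) hm]
  ext m
  by_cases hm : m < n - 1
  · have h2 := congrArg (coeff m) h1
    rw [coeff_mul, coeff_mul] at h2
    rw [Polynomial.coeff_mul, Polynomial.coeff_mul]
    refine Eq.trans ?_ (h2.trans ?_)
    · refine Finset.sum_congr rfl fun x hx => ?_
      have hx2 : x.1 + x.2 = m := Finset.HasAntidiagonal.mem_antidiagonal.1 hx
      rw [Polynomial.coeff_derivative, coeff_derivative, hfF _ (by omega)]
      congr 1
      rw [← Polynomial.coeff_coe]; simp
    · refine Finset.sum_congr rfl fun x hx => ?_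
      have hx2 : x.1 + x.2 = m := Finset.HasAntidiagonal.mem_antidiagonal.1 hx
      rw [hfF _ (by omega), Polynomial.coeff_coe]
  · have a1 : (Polynomial.derivative fb).natDegree ≤ d - 1 :=
      (Polynomial.natDegree_derivative_le _).trans (by omega)
    have a2 : (1 - Polynomial.X ^ (r - 1) : Polynomial (ZMod r)).natDegree ≤ r - 1 := by
      compute_degree
    have a3 := L_deg (r := r) P
    have a4 := L_deg (r := r) Q
    have a5 : (L r P - L r Q).natDegree ≤ r - 2 := (Polynomial.natDegree_sub_le _ _).trans (max_le a3 a4)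
    rw [Polynomial.coeff_eq_zero_of_natDegree_lt, Polynomial.coeff_eq_zero_of_natDegree_lt]
    · refine lt_of_le_of_lt Polynomial.natDegree_mul_le ?_
      omega
    · refine lt_of_le_of_lt Polynomial.natDegree_mul_le ?_
      omega

end NT
end AdjFac

namespace AdjFac
namespace NT
open Polynomial

theorem factor {n d d' : ℕ} (hev : Even n) (hn : d + d' + 1 = n) {f e : PowerSeries ℤ}
    (hf0 : PowerSeries.constantCoeff f = 1) (he0 : PowerSeries.constantCoeff e = 1)
    (hf : ∀ m, d < m → m < n → PowerSeries.coeff m f = 0) (he : ∀ m, d' < m → m < n → PowerSeries.coeff m e = 0)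
    (hfe : ∀ m, 0 < m → m < n → PowerSeries.coeff m (f * e * (1 + PowerSeries.X)) = 0) :
    (PowerSeries.trunc (d + 1) f) * (-PowerSeries.trunc (d' + 1) e) * (X + 1) = X ^ n - 1 := by
  set p := PowerSeries.trunc (d + 1) f
  set q := PowerSeries.trunc (d' + 1) e
  have hp : p.natDegree ≤ d := Nat.lt_succ_iff.1 (PowerSeries.natDegree_trunc_lt f d)
  have hq : q.natDegree ≤ d' := Nat.lt_succ_iff.1 (PowerSeries.natDegree_trunc_lt e d')
  have hpc : ∀ m, m < n → p.coeff m = PowerSeries.coeff m f := by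
    intro m hm
    rw [PowerSeries.coeff_trunc]
    split_ifs with h
    · rfl
    · rw [hf m (by omega) hm]
  have hqc : ∀ m, m < n → q.coeff m = PowerSeries.coeff m e := by
    intro m hm
    rw [PowerSeries.coeff_trunc]
    split_ifs with h
    · rfl
    · rw [he m (by omega) hm]
  have hpq : ∀ m, m < n → (p * q).coeff m = PowerSeries.coeff m (f * e) := by
    intro m hm
    rw [coeff_mul, PowerSeries.coeff_mul]
    refine Finset.sum_congr rfl fun x hx => ?_
    have hx2 : x.1 + x.2 = m := Finset.HasAntidiagonal.mem_antidiagonal.1 hx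
    rw [hpc _ (by omega), hqc _ (by omega)]
  have hpqc : ∀ m, m < n → (p * q * (X + 1)).coeff m = PowerSeries.coeff m (f * e * (1 + PowerSeries.X)) := by
    intro m hm
    rw [mul_add, mul_add, coeff_add, map_add, mul_one, mul_one, hpq m hm, add_comm]
    congr 1
    rcases m with _ | m
    · simp
    · rw [coeff_mul_X, PowerSeries.coeff_succ_mul_X, hpq m (by omega)]
  have hdeg : (p * q * (X + 1)).natDegree ≤ n := by
    refine natDegree_mul_le.trans ?_
    have h1 : (p * q).natDegree ≤ d + d' := natDegree_mul_le.trans (by omega)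
    have h2 : (X + 1 : ℤ[X]).natDegree ≤ 1 := by compute_degree
    omega
  obtain ⟨c, hc⟩ : ∃ c : ℤ, p * q * (X + 1) = 1 + C c * X ^ n := by
    refine ⟨(p * q * (X + 1)).coeff n, ?_⟩
    ext m
    rw [coeff_add, coeff_C_mul, coeff_X_pow, coeff_one]
    rcases lt_trichotomy m n with h | h | h
    · rw [hpqc m h, if_neg h.ne]
      rcases Nat.eq_zero_or_pos m with h0 | h0
      · subst h0
        simp [hf0, he0]
      · rw [hfe m h0 h, if_neg h0.ne']; simp
    · rw [h, if_pos rfl, if_neg (by omega)]; simp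
    · rw [coeff_eq_zero_of_natDegree_lt (by omega), if_neg (by omega), if_neg (by omega)]; simp
  have hc1 : c = -1 := by
    have := congrArg (eval (-1)) hc
    simp [hev.neg_one_pow] at this
    omega
  subst hc1
  have : p * -q * (X + 1) = -(p * q * (X + 1)) := by ring
  rw [this, hc]; simp; ring

theorem factor2 {n d d' : ℕ} (hev : Even n) (hn : d + d' + 1 = n) {p q : ℤ[X]} (hp : p.natDegree ≤ d)
    (hq : q.natDegree ≤ d') (h : p * q * (X + 1) = X ^ n - 1) (hd : 2 ≤ d) :
    p.natDegree = d ∧ ∃ t : Finset ℕ, ∃ b : ℤ[X], IsUnit b ∧ p = b * ∏ δ ∈ t, cyclotomic δ ℤ ∧ (∀ δ ∈ t, δ ∣ n) ∧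
      ∃ δ ∈ t, 2 < δ ∧ ∀ δ' ∈ t, δ' ≤ δ := by
  have hn0 : 0 < n := by omega
  have h2n : 2 ∈ n.divisors := Nat.mem_divisors.2 ⟨hev.two_dvd, hn0.ne'⟩
  have hcyc : p * q = 1 * ∏ δ ∈ n.divisors.erase 2, cyclotomic δ ℤ := by
    have h1 := prod_cyclotomic_eq_X_pow_sub_one hn0 ℤ
    rw [← Finset.mul_prod_erase _ _ h2n, ← h, cyclotomic_two] at h1
    have : (X + 1 : ℤ[X]) ≠ 0 := by
      rw [← cyclotomic_two]; exact cyclotomic_ne_zero 2 ℤ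
    apply mul_right_cancel₀ this
    rw [← h1]; ring
  have hne : p * q * (X + 1) ≠ 0 := by
    rw [h]; exact X_pow_sub_C_ne_zero hn0 (1 : ℤ)
  have hpd : p.natDegree = d := by
    have h1 : (p * q * (X + 1)).natDegree = n := by rw [h]; exact natDegree_X_pow_sub_C
    have hx : (X + 1 : ℤ[X]).natDegree ≤ 1 := by compute_degree
    have h3 := (natDegree_mul_le (p := p * q) (q := X + 1))
    have h4 := (natDegree_mul_le (p := p) (q := q))
    omega
  refine ⟨hpd, ?_⟩
  obtain ⟨t, u, b, c, htu, -, hbc, hpt, -⟩ := mul_eq_mul_prime_prod (fun δ hδ =>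
    (cyclotomic.irreducible (Nat.pos_of_mem_divisors (Finset.mem_of_mem_erase hδ))).prime) hcyc
  have hb : IsUnit b := IsUnit.of_mul_eq_one c hbc.symm
  have htn : ∀ δ ∈ t, δ ∣ n ∧ δ ≠ 2 := by
    intro δ hδ
    have : δ ∈ n.divisors.erase 2 := htu ▸ Finset.mem_union_left _ hδ
    exact ⟨Nat.dvd_of_mem_divisors (Finset.mem_of_mem_erase this), (Finset.mem_erase.1 this).1⟩
  refine ⟨t, b, hb, hpt, fun δ hδ => (htn δ hδ).1, ?_⟩
  have hne : t.Nonempty := by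
    rw [Finset.nonempty_iff_ne_empty]
    rintro rfl
    rw [Finset.prod_empty, mul_one] at hpt
    rw [hpt, natDegree_eq_zero_of_isUnit hb] at hpd
    omega
  refine ⟨t.max' hne, t.max'_mem hne, ?_, fun δ hδ => t.le_max' δ hδ⟩
  by_contra hcon
  have hall : ∀ δ ∈ t, δ = 1 := by
    intro δ hδ
    have h1 := t.le_max' δ hδ
    have h2 := Nat.pos_of_dvd_of_pos (htn δ hδ).1 hn0
    have h3 := (htn δ hδ).2
    omega
  have : t = {1} := by
    rw [Finset.eq_singleton_iff_nonempty_unique_mem]; exact ⟨hne, hall⟩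
  rw [this, Finset.prod_singleton] at hpt
  have h5 := (natDegree_mul_le (p := b) (q := cyclotomic 1 ℤ))
  rw [← hpt, natDegree_eq_zero_of_isUnit hb, natDegree_cyclotomic, Nat.totient_one] at h5
  omega

theorem key {r : ℕ} [Fact r.Prime] {p b : ℤ[X]} {t : Finset ℕ} (hb : IsUnit b)
    (hp : p = b * ∏ δ ∈ t, cyclotomic δ ℤ) (ht0 : ∀ δ ∈ t, 0 < δ) {δ : ℕ} (hδ : δ ∈ t) (hmax : ∀ δ' ∈ t, δ' ≤ δ)
    (hrδ : ¬ r ∣ δ) {h : (ZMod r)[X]}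
    (heq : derivative (p.map (Int.castRingHom (ZMod r))) * (1 - X ^ (r - 1)) = p.map (Int.castRingHom (ZMod r)) * h) :
    δ ∣ r - 1 := by
  let K := AlgebraicClosure (ZMod r)
  haveI : CharP K r := charP_of_injective_algebraMap (algebraMap (ZMod r) K).injective r
  have hδK : (δ : K) ≠ 0 := by rwa [Ne, CharP.cast_eq_zero_iff K r]
  haveI : NeZero (δ : K) := ⟨hδK⟩
  obtain ⟨ζ, hζ⟩ := IsAlgClosed.exists_root (cyclotomic δ K) (degree_cyclotomic_pos δ K (ht0 δ hδ)).ne'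
  have hprim : IsPrimitiveRoot ζ δ := isRoot_cyclotomic_iff.1 hζ
  set P : K[X] := p.map (Int.castRingHom K) with hP
  have hPm : (p.map (Int.castRingHom (ZMod r))).map (algebraMap (ZMod r) K) = P := by
    rw [Polynomial.map_map, hP]; congr 1
  have heq2 := congrArg (Polynomial.map (algebraMap (ZMod r) K)) heq
  rw [Polynomial.map_mul, Polynomial.map_mul, ← derivative_map, hPm] at heq2
  obtain ⟨R, hR, hR0⟩ : ∃ R : K[X], P = cyclotomic δ K * R ∧ R.eval ζ ≠ 0 := by
    refine ⟨b.map (Int.castRingHom K) * ∏ δ' ∈ t.erase δ, cyclotomic δ' K, ?_, ?_⟩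
    · rw [hP, hp, Polynomial.map_mul, Polynomial.map_prod, ← Finset.mul_prod_erase _ _ hδ]
      simp only [map_cyclotomic]
      ring
    · rw [eval_mul, eval_prod]
      refine mul_ne_zero ?_ (Finset.prod_ne_zero_iff.2 fun δ' hδ' h0 => ?_)
      · have : IsUnit (eval ζ (b.map (Int.castRingHom K))) := by
          have := hb.map ((evalRingHom ζ).comp (mapRingHom (Int.castRingHom K)))
          simpa using this
        exact this.ne_zero
      · have h1 : ζ ^ δ' = 1 := by
          have h2 : (X ^ δ' - 1 : K[X]).eval ζ = 0 := by
            obtain ⟨w, hw⟩ := cyclotomic.dvd_X_pow_sub_one δ' K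
            rw [hw, eval_mul, h0, zero_mul]
          simpa [sub_eq_zero] using h2
        have h2 := hprim.dvd_of_pow_eq_one _ h1
        have h3 := Nat.le_of_dvd (ht0 δ' (Finset.mem_of_mem_erase hδ')) h2
        have h4 := hmax δ' (Finset.mem_of_mem_erase hδ')
        exact (Finset.mem_erase.1 hδ').1 (le_antisymm h4 h3)
  have hζ0 : eval ζ (cyclotomic δ K) = 0 := hζ
  have hder : eval ζ (derivative (cyclotomic δ K)) ≠ 0 := by
    have := (separable_cyclotomic δ K).eval₂_derivative_ne_zero (RingHom.id K) (x := ζ) (by simpa using hζ0)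
    simpa using this
  have h3 := congrArg (eval ζ) heq2
  rw [eval_mul, eval_mul] at h3
  have h4 : eval ζ P = 0 := by rw [hR, eval_mul, hζ0, zero_mul]
  have h5 : eval ζ (derivative P) ≠ 0 := by
    rw [hR, derivative_mul, eval_add, eval_mul, eval_mul, hζ0, zero_mul, add_zero]
    exact mul_ne_zero hder hR0
  rw [h4, zero_mul] at h3
  have h6 := (mul_eq_zero.1 h3).resolve_left h5
  simp [sub_eq_zero] at h6
  exact hprim.dvd_of_pow_eq_one _ h6.symm

end NT
end AdjFac

namespace AdjFac
namespace NT
open Polynomial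

theorem exists_prime {m : ℕ} (hm : 4 ≤ m) : ∃ q, q.Prime ∧ ¬ q ∣ 2 * m ∧ q ≤ m + 1 := by
  have aux : ∀ N, Odd N → 1 < N → ∃ q, q.Prime ∧ q ∣ N ∧ q ≠ 2 := by
    intro N hN h1
    refine ⟨N.minFac, Nat.minFac_prime h1.ne', N.minFac_dvd, fun h => ?_⟩
    have h2 := N.minFac_dvd
    rw [h] at h2
    exact (Nat.not_even_iff_odd.2 hN) (even_iff_two_dvd.2 h2)
  have fin : ∀ q, q.Prime → q ≠ 2 → (q ∣ m + 1 ∨ q ∣ m - 1) → q.Prime ∧ ¬ q ∣ 2 * m ∧ q ≤ m + 1 := by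
    intro q hq h2 h
    refine ⟨hq, fun h3 => ?_, ?_⟩
    · rcases (Nat.Prime.dvd_mul hq).1 h3 with h4 | h4
      · exact h2 ((Nat.prime_dvd_prime_iff_eq hq Nat.prime_two).1 h4)
      · have : q ∣ 1 := by
          rcases h with h | h
          · exact (Nat.dvd_add_right h4).1 h
          · have h5 : m = (m - 1) + 1 := by omega
            rw [h5] at h4
            exact (Nat.dvd_add_right h).1 h4
        exact hq.one_lt.ne' (Nat.dvd_one.1 this)
    · rcases h with h | h
      · exact Nat.le_of_dvd (by omega) h
      · have := Nat.le_of_dvd (by omega) h; omega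
  rcases Nat.even_or_odd m with he | ho
  · obtain ⟨q, hq, hd, h2⟩ := aux (m + 1) he.add_one (by omega)
    exact ⟨q, fin q hq h2 (Or.inl hd)⟩
  · obtain ⟨j, hj⟩ := ho
    rcases Nat.even_or_odd j with ⟨i, hi⟩ | ⟨i, hi⟩
    · -- m + 1 = 2 (2 i + 1)
      obtain ⟨q, hq, hd, h2⟩ := aux (2 * i + 1) ⟨i, rfl⟩ (by omega)
      refine ⟨q, fin q hq h2 (Or.inl (hd.trans ⟨2, by omega⟩))⟩
    · obtain ⟨q, hq, hd, h2⟩ := aux (2 * i + 1) ⟨i, rfl⟩ (by omega)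
      refine ⟨q, fin q hq h2 (Or.inr (hd.trans ⟨2, by omega⟩))⟩

theorem arith {n δ : ℕ} (hev : Even n) (hn : 8 ≤ n) (hδ : 2 < δ) (hδn : δ ∣ n)
    (h : ∀ r, r.Prime → r ≤ n / 2 + 1 → ¬ r ∣ δ → δ ∣ r - 1) : False := by
  obtain ⟨m, hm⟩ := hev
  obtain ⟨q, hq, hqm, hqle⟩ := exists_prime (m := m) (by omega)
  have hqδ : ¬ q ∣ δ := fun h1 => hqm ((h1.trans hδn).trans ⟨1, by omega⟩)
  have hex : ∃ r, r.Prime ∧ ¬ r ∣ δ := ⟨q, hq, hqδ⟩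
  obtain ⟨hp, hpδ⟩ := Nat.find_spec hex
  have hmin : ∀ r, r.Prime → r < Nat.find hex → r ∣ δ := by
    intro r hr hlt
    by_contra hc
    exact Nat.find_min hex hlt ⟨hr, hc⟩
  have hle : Nat.find hex ≤ q := Nat.find_min' hex ⟨hq, hqδ⟩
  generalize Nat.find hex = ρ at *
  have hd := h ρ hp (by omega) hpδ
  have h2 := hp.two_le
  have hle2 := Nat.le_of_dvd (by omega) hd
  have hne : ρ - 2 ≠ 1 := by omega
  have hmf := Nat.minFac_prime hne
  have hmd := Nat.minFac_dvd (ρ - 2)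
  have h3 : (ρ - 2).minFac ≤ ρ - 2 := Nat.minFac_le (by omega)
  have h4 := (hmin _ hmf (by omega)).trans hd
  have h5 : ρ - 1 = (ρ - 2) + 1 := by omega
  rw [h5] at h4
  have := (Nat.dvd_add_right hmd).1 h4
  exact hmf.one_lt.ne' (Nat.dvd_one.1 this)

theorem six {p b : ℤ[X]} {t : Finset ℕ} (hb : IsUnit b)
    (hp : p = b * ∏ δ ∈ t, cyclotomic δ ℤ) (ht : ∀ δ ∈ t, δ ∣ 6) (h6 : 6 ∈ t) (hpd : p.natDegree = 2)
    {h : (ZMod 2)[X]} (hh : h.natDegree ≤ 0)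
    (heq : derivative (p.map (Int.castRingHom (ZMod 2))) * (1 - X ^ (2 - 1)) = p.map (Int.castRingHom (ZMod 2)) * h) :
    False := by
  have hprod : (∏ δ ∈ t, cyclotomic δ ℤ) = (X ^ 2 - X + 1) * ∏ δ ∈ t.erase 6, cyclotomic δ ℤ := by
    rw [← Finset.mul_prod_erase _ _ h6, cyclotomic_six]
  have hmon : (∏ δ ∈ t.erase 6, cyclotomic δ ℤ).Monic := monic_prod_of_monic _ _ fun δ _ => cyclotomic.monic δ ℤ
  have hm6 : (X ^ 2 - X + 1 : ℤ[X]).Monic := by rw [← cyclotomic_six]; exact cyclotomic.monic 6 ℤ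
  have hd6 : (X ^ 2 - X + 1 : ℤ[X]).natDegree = 2 := by compute_degree!
  have hdeg : (∏ δ ∈ t.erase 6, cyclotomic δ ℤ).natDegree = 0 := by
    have h1 : p.natDegree = b.natDegree + (∏ δ ∈ t, cyclotomic δ ℤ).natDegree := by
      rw [hp]
      exact natDegree_mul hb.ne_zero (by rw [hprod]; exact (hm6.mul hmon).ne_zero)
    rw [hprod, hm6.natDegree_mul hmon, hd6, hpd] at h1
    omega
  rw [hprod, hmon.natDegree_eq_zero.1 hdeg, mul_one] at hp
  obtain ⟨u, hu, rfl⟩ := Polynomial.isUnit_iff.1 hb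
  rw [eq_C_of_natDegree_le_zero hh] at heq
  have hu2 : (u : ZMod 2) ≠ 0 := (hu.map (Int.castRingHom (ZMod 2))).ne_zero
  have hu3 : (u : ZMod 2) = 1 := by
    generalize (u : ZMod 2) = x at hu2; revert hu2; revert x; decide
  have hpm : p.map (Int.castRingHom (ZMod 2)) = X ^ 2 - X + 1 := by
    have hm : Int.castRingHom (ZMod 2) u = 1 := hu3
    rw [hp, Polynomial.map_mul, map_C, hm, C_1, one_mul]; simp
  rw [hpm] at heq
  have h2 := congrArg (coeff · 2) heq
  have h3 := congrArg (coeff · 0) heq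
  have e2 : (2 : ZMod 2) = 0 := by decide
  have hder : derivative (X ^ 2 - X + 1 : (ZMod 2)[X]) = -1 := by
    have : (2 : (ZMod 2)[X]) = 0 := by
      exact CharTwo.two_eq_zero
    simp [this, CharTwo.add_self_eq_zero]
  rw [hder] at h2 h3
  simp [coeff_X, coeff_one] at h2 h3
  rw [← h2] at h3
  exact one_ne_zero h3

theorem nt {n d d' : ℕ} (hev : Even n) (hn : d + d' + 1 = n) (hdd : d ≤ d') {P Q P' Q' : Multiset ℤ} {f e : PowerSeries ℤ}
    (hfP : f * Num.pr (fun p => p) Q = Num.pr (fun p => p) P)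
    (heP : e * Num.pr (fun p => p) Q' = Num.pr (fun p => p) P')
    (hf : ∀ m, d < m → m < n → PowerSeries.coeff m f = 0) (he : ∀ m, d' < m → m < n → PowerSeries.coeff m e = 0)
    (hfe : ∀ m, 0 < m → m < n → PowerSeries.coeff m (f * e * (1 + PowerSeries.X)) = 0) : d ≤ 1 := by
  by_contra hcon
  have hf0 : PowerSeries.constantCoeff f = 1 := by
    have := congrArg PowerSeries.constantCoeff hfP
    rwa [map_mul, Num.pr_cc, Num.pr_cc, mul_one] at this
  have he0 : PowerSeries.constantCoeff e = 1 := by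
    have := congrArg PowerSeries.constantCoeff heP
    rwa [map_mul, Num.pr_cc, Num.pr_cc, mul_one] at this
  have h1 := factor hev hn hf0 he0 hf he hfe
  obtain ⟨hpd, t, b, hb, hpt, htn, δ, hδ, hδ2, hmax⟩ := factor2 hev hn
    (Nat.lt_succ_iff.1 (PowerSeries.natDegree_trunc_lt f d))
    (by rw [natDegree_neg]; exact (Nat.lt_succ_iff.1 (PowerSeries.natDegree_trunc_lt e d'))) h1 (by omega)
  have ht0 : ∀ δ ∈ t, 0 < δ := fun δ hδ => Nat.pos_of_dvd_of_pos (htn δ hδ) (by omega)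
  have hk : ∀ r, r.Prime → r ≤ n / 2 + 1 → ¬ r ∣ δ → δ ∣ r - 1 := by
    intro r hr hle hrd
    haveI : Fact r.Prime := ⟨hr⟩
    obtain ⟨m, hm⟩ := hev
    obtain ⟨h, -, heq⟩ := logd (r := r) hfP hf (by omega) (by omega)
    exact key hb hpt ht0 hδ hmax hrd heq
  rcases Nat.lt_or_ge n 8 with h8 | h8
  · have hn6 : n = 6 := by obtain ⟨m, hm⟩ := hev; omega
    subst hn6
    have hδ6 : δ = 6 := by
      have h2 : 2 ∣ δ := by
        by_contra h2
        have := Nat.le_of_dvd (by norm_num) (hk 2 Nat.prime_two (by norm_num) h2)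
        omega
      have h3 := htn δ hδ
      have h4 := Nat.le_of_dvd (by norm_num) h3
      interval_cases δ <;> omega
    subst hδ6
    haveI : Fact (Nat.Prime 2) := ⟨Nat.prime_two⟩
    obtain ⟨h, hh, heq⟩ := logd (r := 2) hfP hf (by omega) (by omega)
    exact six hb hpt htn hδ (by omega) hh heq
  · exact arith hev h8 hδ2 (htn δ hδ) hk

end NT
end AdjFac

namespace AdjFac
namespace BB
open Polynomial

theorem jacobi {T : Type} [CommRing T] {n : Type} [Fintype n] [DecidableEq n] (M : Matrix n n T[X]) :
    derivative M.det = (M.adjugate * M.map derivative).trace := by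
  have h1 : ∀ i, (M.updateCol i fun j => derivative (M j i)).det = (M.adjugate * M.map derivative) i i := by
    intro i
    rw [← Matrix.cramer_apply, Matrix.cramer_eq_adjugate_mulVec]
    rfl
  simp only [Matrix.trace, Matrix.diag]
  simp only [← h1, Matrix.det_apply']
  rw [Finset.sum_comm, map_sum]
  refine Finset.sum_congr rfl fun σ _ => ?_
  rw [← Finset.mul_sum]
  have : derivative (((Equiv.Perm.sign σ : ℤ) : T[X]) * ∏ i, M (σ i) i) =
      ((Equiv.Perm.sign σ : ℤ) : T[X]) * derivative (∏ i, M (σ i) i) := by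
    rw [derivative_mul, derivative_intCast]; simp
  rw [this, derivative_prod_finset]
  congr 1
  refine Finset.sum_congr rfl fun i _ => ?_
  rw [← Finset.mul_prod_erase _ _ (Finset.mem_univ i), mul_comm, Matrix.updateCol_self]
  congr 1
  refine Finset.prod_congr rfl fun j hj => ?_
  rw [Matrix.updateCol_ne (Finset.ne_of_mem_erase hj)]

/-- coefficient matrices -/
def co {T : Type} [CommRing T] {n : Type} (m : ℕ) (M : Matrix n n T[X]) : Matrix n n T := M.map fun p => p.coeff m

section
variable {T : Type} [CommRing T] {n : Type} [Fintype n]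

theorem co0_mul (M N : Matrix n n T[X]) : co 0 (M * N) = co 0 M * co 0 N := by
  ext i j
  simp [co, Matrix.mul_apply, mul_coeff_zero]

theorem co1_mul (M N : Matrix n n T[X]) : co 1 (M * N) = co 0 M * co 1 N + co 1 M * co 0 N := by
  ext i j
  simp [co, Matrix.mul_apply, mul_coeff_one, Finset.sum_add_distrib]

end

/-- the idempotent -/
theorem core {T : Type} [Field T] {n : Type} [Fintype n] [DecidableEq n] (P : Matrix n n T)
    (hP : P * P = P) (Xz Y Z : Matrix n n T[X])
    (hX0 : co 0 Xz = 1 - P) (hdet : Xz.det = X)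
    (hYZ : Xz.adjugate = Y * Z) (u : T) (hu : u ≠ 0) (d : ℕ) (hY : Y.det = C u * X ^ d) :
    ∃ e : Matrix n n T, e = co 1 Y * (co 0 Z * co 0 Xz) ∧ e * e = e ∧ e * P = 0 ∧ e.trace = d := by
  have h1 : Y * (Z * Xz) = (X : T[X]) • (1 : Matrix n n T[X]) := by
    rw [← Matrix.mul_assoc, ← hYZ, Matrix.adjugate_mul, hdet]
  have h2 : (Z * Xz) * Y = (X : T[X]) • (1 : Matrix n n T[X]) := by
    have hYne : Y.det ≠ 0 := by
      rw [hY]; exact mul_ne_zero (C_ne_zero.2 hu) (pow_ne_zero _ X_ne_zero)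
    have h3 : Y.det • ((Z * Xz) * Y) = Y.det • ((X : T[X]) • (1 : Matrix n n T[X])) := by
      calc Y.det • ((Z * Xz) * Y) = (Y.adjugate * Y) * ((Z * Xz) * Y) := by
            rw [Matrix.adjugate_mul, Matrix.smul_mul, Matrix.one_mul]
        _ = Y.adjugate * (Y * (Z * Xz)) * Y := by simp only [Matrix.mul_assoc]
        _ = (X : T[X]) • (Y.adjugate * Y) := by rw [h1]; simp
        _ = _ := by rw [Matrix.adjugate_mul, smul_comm]
    exact smul_right_injective _ hYne h3
  have c0 : co 0 ((X : T[X]) • (1 : Matrix n n T[X])) = 0 := by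
    ext i j; simp [co]
  have c1 : co 1 ((X : T[X]) • (1 : Matrix n n T[X])) = 1 := by
    ext i j
    by_cases h : i = j
    · subst h; simp [co]
    · simp [co, h]
  have a0 : co 0 Y * (co 0 Z * co 0 Xz) = 0 := by
    rw [← co0_mul, ← co0_mul, h1, c0]
  have b1 : (co 0 Z * co 0 Xz) * co 1 Y + co 1 (Z * Xz) * co 0 Y = 1 := by
    rw [← co0_mul, ← co1_mul, h2, c1]
  refine ⟨_, rfl, ?_, ?_, ?_⟩
  · have : (co 0 Z * co 0 Xz) * co 1 Y = 1 - co 1 (Z * Xz) * co 0 Y := by rw [← b1]; abel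
    calc co 1 Y * (co 0 Z * co 0 Xz) * (co 1 Y * (co 0 Z * co 0 Xz))
        = co 1 Y * (((co 0 Z * co 0 Xz) * co 1 Y) * (co 0 Z * co 0 Xz)) := by simp only [Matrix.mul_assoc]
      _ = co 1 Y * ((co 0 Z * co 0 Xz) - co 1 (Z * Xz) * (co 0 Y * (co 0 Z * co 0 Xz))) := by
          rw [this, Matrix.sub_mul, Matrix.one_mul]; simp only [Matrix.mul_assoc]
      _ = _ := by rw [a0]; simp
  · rw [hX0, Matrix.mul_assoc, Matrix.mul_assoc, Matrix.sub_mul, hP]; simp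
  · have h4 : Y.det • (Z * Xz) = (X : T[X]) • Y.adjugate := by
      calc Y.det • (Z * Xz) = (Y.adjugate * Y) * (Z * Xz) := by
            rw [Matrix.adjugate_mul, Matrix.smul_mul, Matrix.one_mul]
        _ = _ := by rw [Matrix.mul_assoc, h1]; simp
    have h5 : Y.det * ((Z * Xz) * Y.map derivative).trace = X * derivative Y.det := by
      have h9 := congrArg (fun M => (M * Y.map derivative).trace) h4
      simp only [Matrix.smul_mul, Matrix.trace_smul, smul_eq_mul] at h9
      rw [jacobi, h9]
    have h6 : ((Z * Xz) * Y.map derivative).trace = C (d : T) := by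
      have hYne : Y.det ≠ 0 := by
        rw [hY]; exact mul_ne_zero (C_ne_zero.2 hu) (pow_ne_zero _ X_ne_zero)
      apply mul_left_cancel₀ hYne
      rw [h5, hY, derivative_C_mul, derivative_X_pow]
      rcases d with _ | d
      · simp
      · simp [pow_succ]; ring
    have h7 : (co 0 ((Z * Xz) * Y.map derivative)).trace = d := by
      have := congrArg (fun p => coeff p 0) h6
      simpa [Matrix.trace, co] using this
    have h8 : co 0 (Y.map derivative) = co 1 Y := by
      ext i j; simp [co, coeff_derivative]
    rw [Matrix.trace_mul_comm, ← h7, co0_mul, co0_mul, h8]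

end BB
end AdjFac

namespace AdjFac
namespace BB

/-- decomposition of the identity -/
theorem decomp {T : Type} [Field T] {gh : GH T} {n : ℕ} (P e : Matrix (Fin n) (Fin n) T) (x : Matrix (Fin n) Unit T)
    (y : Matrix Unit (Fin n) T) (hx : gh.Hom (fun _ => 0) (fun _ => 1) x) (hy : gh.Hom (fun _ => 1) (fun _ => 0) y)
    (hxy : x * y = P) (hyx : y * x = 1) (he : gh.Hom (fun _ => 0) (fun _ => 0) e) (ie : e * e = e) (heP : e * P = 0)
    (d : ℕ) (htr : e.trace = d) :
    ∃ E F : WI gh, E.e.trace = d ∧ F.e.trace = (n : T) - 1 - d ∧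
      WI.cls E + WI.cls F + WI.fr gh {1} = WI.fr gh (Multiset.replicate n 0) := by
  have hP : P * P = P := by
    rw [← hxy, Matrix.mul_assoc, ← Matrix.mul_assoc y, hyx, Matrix.one_mul]
  have hPh : gh.Hom (fun _ => 0) (fun _ => 0) P := hxy ▸ hx.mul hy
  have trP : P.trace = 1 := by
    rw [← hxy, Matrix.trace_mul_comm, hyx]; simp
  have h1P : (1 - P) * P = 0 := by rw [Matrix.sub_mul, hP]; simp
  have h1e : (1 - e) * e = 0 := by rw [Matrix.sub_mul, ie]; simp
  have he1 : e * (1 - e) = 0 := by rw [Matrix.mul_sub, ie]; simp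
  have h1ee : (1 - e) * (1 - e) = 1 - e := by rw [Matrix.mul_sub, h1e]; simp
  have h1eP : (1 - e) * P = P := by rw [Matrix.sub_mul, heP]; simp
  set F := (1 - P) * (1 - e) with hF
  set Q := P * (1 - e) with hQ
  have hQQ : Q * Q = Q := by
    rw [hQ, Matrix.mul_assoc, ← Matrix.mul_assoc (1 - e), h1eP, ← Matrix.mul_assoc, hP]
  have hFF : F * F = F := by
    have : (1 - e) * (1 - P) = 1 - e - P := by rw [Matrix.mul_sub, h1eP]; simp
    rw [hF, Matrix.mul_assoc, ← Matrix.mul_assoc (1 - e), this, Matrix.sub_mul (1 - e), h1ee, Matrix.mul_sub, ← Matrix.mul_assoc,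
      h1P]; simp
  have hsum : F + Q = 1 - e := by rw [hF, hQ, ← Matrix.add_mul]; simp
  have hFQ : F * Q = 0 := by
    rw [hF, hQ, Matrix.mul_assoc, ← Matrix.mul_assoc (1 - e), h1eP, ← Matrix.mul_assoc, h1P]; simp
  have hQF : Q * F = 0 := by
    have h2 : Q * (1 - e) = Q := by rw [hQ, Matrix.mul_assoc, h1ee]
    have h3 : Q * (F + Q) = Q := by rw [hsum, h2]
    rw [Matrix.mul_add, hQQ] at h3
    simpa using h3
  have hFh : gh.Hom (fun _ => 0) (fun _ => 0) F := (GH.Hom.sub .one hPh).mul (GH.Hom.sub .one he)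
  have hQh : gh.Hom (fun _ => 0) (fun _ => 0) Q := hPh.mul (GH.Hom.sub .one he)
  refine ⟨WI.of _ e he ie, WI.of _ F hFh hFF, htr, ?_, ?_⟩
  · change F.trace = _
    have : F = 1 - P - e + P * e := by rw [hF]; noncomm_ring
    rw [this, Matrix.trace_add, Matrix.trace_mul_comm, heP, Matrix.trace_sub, Matrix.trace_sub, htr, trP]
    simp
  · have hcQ : WI.cls (WI.of _ Q hQh hQQ) = WI.fr gh {1} := by
      rw [WI.fr_singleton]
      refine WI.cls_of_eq _ _ _ _ x (y * (1 - e)) hx (hy.mul (GH.Hom.sub .one he)) ?_ ?_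
      · rw [← Matrix.mul_assoc, hxy]
      · have hex : e * x = 0 := by
          calc e * x = e * (x * (y * x)) := by rw [hyx, Matrix.mul_one]
            _ = e * P * x := by rw [← hxy]; simp only [Matrix.mul_assoc]
            _ = 0 := by rw [heP, Matrix.zero_mul]
        rw [Matrix.mul_assoc, Matrix.sub_mul, hex, Matrix.one_mul, sub_zero, hyx]
    have h1 := WI.cls_of_add (gh := gh) (fun _ => (0 : ℤ)) F Q (1 - e) hFh hQh (GH.Hom.sub .one he) hFF hQQ h1ee hFQ hQF hsum.symm
    rw [add_assoc, ← hcQ, ← h1, WI.cls_compl]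
    congr 1
    simp

end BB
end AdjFac

namespace AdjFac
namespace BB
open Polynomial

theorem det_Xz {T : Type} [Field T] {n : ℕ} (x : Matrix (Fin n) Unit T)
    (y : Matrix Unit (Fin n) T) (hyx : y * x = 1) :
    ((1 - x * y).map C + (X : T[X]) • (x * y).map C).det = X := by
  have h1 : (1 - x * y).map C + (X : T[X]) • (x * y).map C = 1 + x.map C * ((X - 1 : T[X]) • y.map C) := by
    have e1 : (x * y).map C = x.map C * y.map C := Matrix.map_mul
    have e2 : ∀ P : Matrix (Fin n) (Fin n) T, (1 - P).map C = 1 - P.map (C : T →+* T[X]) := by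
      intro P
      ext i j : 2
      by_cases h : i = j
      · subst h; simp [Matrix.map_apply]
      · simp [Matrix.map_apply, h]
    rw [e2, e1, Matrix.mul_smul, sub_smul, one_smul]; abel
  have h2 : y.map C * x.map C = (1 : Matrix Unit Unit T[X]) := by
    rw [← Matrix.map_mul, hyx]; simp
  rw [h1, Matrix.det_one_add_mul_comm, Matrix.smul_mul, h2, Matrix.det_unique]
  simp

theorem main_C {n : ℕ} (hn : 0 < n) (hev : Even n)
    (Y Z : Matrix (Fin n) (Fin n) (MvPolynomial (Fin n × Fin n) ℂ))
    (hYZ : (Matrix.of fun i j => MvPolynomial.X (i, j) : Matrix (Fin n) (Fin n) (MvPolynomial (Fin n × Fin n) ℂ)).adjugate = Y * Z)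
    (u : ℂ) (hu : u ≠ 0) (d d' : ℕ) (hd : d + d' + 1 = n)
    (hdet : Y.det = MvPolynomial.C u *
      (Matrix.of fun i j => MvPolynomial.X (i, j) : Matrix (Fin n) (Fin n) (MvPolynomial (Fin n × Fin n) ℂ)).det ^ d) :
    d ≤ 1 ∨ d' ≤ 1 := by
  obtain ⟨gr, hF, hC, hX⟩ := Gr.exists_gr ℂ (Fin n ⊕ Fin n) Toep.wv
  have hs : gr.c 0 (Toep.ss n) = Toep.ss n := by
    rw [Toep.ss, map_sum]
    refine Finset.sum_congr rfl fun i _ => ?_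
    rw [gr.mul 0 (-1) _ _ (hX (Sum.inl i))]
    congr 1
    exact hX (Sum.inr i)
  have h0 : Toep.ss n ≠ 0 := by
    intro h
    have := congrArg (MvPolynomial.aeval (fun _ => (1 : ℂ))) h
    simp [Toep.ss] at this
    omega
  let T := FractionRing (Toep.S n)
  have hinj : Function.Injective (algebraMap (Toep.S n) T) := IsFractionRing.injective _ _
  haveI : CharZero T := charZero_of_injective_algebraMap hinj
  set gh := gr.toGH (Toep.ss n) hs T with hgh
  let cc : ℂ →+* T := (algebraMap (Toep.S n) T).comp MvPolynomial.C
  have hcc : ∀ r, cc r ∈ gh.H 0 := fun r => Gr.mem_H_of_hom (hC r)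
  have hQ : ∀ m : ℕ, (m : T)⁻¹ ∈ gh.H 0 := by
    intro m
    have := hcc (m : ℂ)⁻¹
    rwa [map_inv₀, map_natCast] at this
  let s : T := algebraMap (Toep.S n) T (Toep.ss n)
  have hs0 : s ≠ 0 := fun h => h0 (hinj (by rw [map_zero]; exact h))
  let x : Matrix (Fin n) Unit T := Matrix.of fun i _ => algebraMap (Toep.S n) T (MvPolynomial.X (Sum.inl i))
  let y : Matrix Unit (Fin n) T := Matrix.of fun _ i => s⁻¹ * algebraMap (Toep.S n) T (MvPolynomial.X (Sum.inr i))
  have hx : gh.Hom (fun _ => 0) (fun _ => 1) x := fun i _ => Gr.mem_H_of_hom (hX (Sum.inl i))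
  have hy : gh.Hom (fun _ => 1) (fun _ => 0) y := by
    intro _ i
    refine Gr.mem_H.2 ⟨1, MvPolynomial.X (Sum.inr i), hX (Sum.inr i), ?_⟩
    rw [pow_one]
    change s * (s⁻¹ * _) = _
    rw [mul_inv_cancel_left₀ hs0]
  have hyx : y * x = 1 := by
    ext i j
    rw [Matrix.mul_apply]
    have : (1 : Matrix Unit Unit T) i j = 1 := by simp
    rw [this]
    simp only [x, y, Matrix.of_apply, mul_assoc, ← map_mul, ← Finset.mul_sum, ← map_sum]
    have h2 : (∑ i : Fin n, MvPolynomial.X (Sum.inr i) * MvPolynomial.X (Sum.inl i) : Toep.S n) = Toep.ss n :=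
      Finset.sum_congr rfl fun i _ => mul_comm _ _
    rw [h2]
    exact inv_mul_cancel₀ hs0
  set P := x * y with hP
  have hPh : gh.Hom (fun _ => 0) (fun _ => 0) P := hx.mul hy
  have hPP : P * P = P := by
    rw [hP, Matrix.mul_assoc, ← Matrix.mul_assoc y, hyx, Matrix.one_mul]
  let Xz : Matrix (Fin n) (Fin n) T[X] := (1 - P).map C + (X : T[X]) • P.map C
  have hXz : Xz.det = X := det_Xz x y hyx
  let φ : MvPolynomial (Fin n × Fin n) ℂ →+* T[X] := MvPolynomial.eval₂Hom (C.comp cc) fun ij => Xz ij.1 ij.2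
  have hφX : (Matrix.of fun i j => MvPolynomial.X (i, j) : Matrix (Fin n) (Fin n) (MvPolynomial (Fin n × Fin n) ℂ)).map φ = Xz := by
    ext i j : 2
    simp [φ]
  have hX0 : co 0 Xz = 1 - P := by
    ext i j
    simp [co, Xz]
  let B : Subring T :=
    { carrier := gh.H 0
      mul_mem' := fun ha hb => by simpa using gh.mul ha hb
      one_mem' := gh.one
      add_mem' := fun ha hb => add_mem ha hb
      zero_mem' := zero_mem _
      neg_mem' := fun ha => neg_mem ha }
  have hXzB : ∀ i j, Xz i j ∈ (Polynomial.mapRingHom B.subtype).range := by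
    intro i j
    have h1 : (1 - P) i j ∈ gh.H 0 := by simpa using (GH.Hom.sub .one hPh) i j
    have h2 : P i j ∈ gh.H 0 := by simpa using hPh i j
    refine ⟨C ⟨_, h1⟩ + X * C ⟨_, h2⟩, ?_⟩
    simp [Xz]
  have hφB : ∀ p, φ p ∈ (Polynomial.mapRingHom B.subtype).range := by
    intro p
    induction p using MvPolynomial.induction_on with
    | C r => exact ⟨C ⟨cc r, hcc r⟩, by simp [φ]⟩
    | add p q hp hq => rw [map_add]; exact add_mem hp hq
    | mul_X p i hp =>
      rw [map_mul]
      refine mul_mem hp ?_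
      simpa [φ] using hXzB i.1 i.2
  have hcoef : ∀ (q : T[X]) m, q ∈ (Polynomial.mapRingHom B.subtype).range → q.coeff m ∈ gh.H 0 := by
    rintro _ m ⟨q, rfl⟩
    rw [coe_mapRingHom, coeff_map]
    exact (q.coeff m).2
  obtain ⟨e, he, ie, heP, htr⟩ := core P hPP Xz (Y.map φ) (Z.map φ) hX0 hXz (by
      rw [← hφX, ← Matrix.map_mul, ← hYZ]
      exact (φ.map_adjugate _).symm) (cc u) (by
      intro h; exact hu (cc.injective (by rw [h, map_zero]))) d (by
      have : (Y.map φ).det = φ Y.det := (φ.map_det _).symm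
      rw [this, hdet, map_mul, map_pow, φ.map_det]
      change _ * (Matrix.map _ φ).det ^ d = _
      rw [hφX, hXz]
      simp [φ])
  have hhe : gh.Hom (fun _ => 0) (fun _ => 0) e := by
    have hc : ∀ (M : Matrix (Fin n) (Fin n) (MvPolynomial (Fin n × Fin n) ℂ)) m,
        gh.Hom (fun _ => 0) (fun _ => 0) (co m (M.map φ)) := by
      intro M m i j
      rw [sub_self]
      exact hcoef _ m (hφB _)
    have hx0 : gh.Hom (fun _ => 0) (fun _ => 0) (co 0 Xz) := by
      rw [hX0]; exact GH.Hom.sub .one hPh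
    rw [he]
    exact (hc Y 1).mul ((hc Z 0).mul hx0)
  obtain ⟨E, F, hE, hF', hcls⟩ := decomp P e x y hx hy rfl hyx hhe ie heP d htr
  have hF2 : F.e.trace = (d' : T) := by
    have hnT : (n : T) = d + d' + 1 := by
      exact_mod_cast congrArg (Nat.cast : ℕ → T) hd.symm
    rw [hF', hnT]; ring
  obtain ⟨P1, Q1, P2, Q2, f, g, hf, hg, h1, h2, h3⟩ := KT hn hF hC hX hs h0 hinj hQ E F d d' hE hF2 hcls
  rcases le_total d d' with hle | hle
  · exact Or.inl (NT.nt hev hd hle hf hg h1 h2 h3)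
  · refine Or.inr (NT.nt hev (by omega) hle hg hf h2 h1 ?_)
    intro m hm hmn
    rw [mul_comm g f]; exact h3 m hm hmn

end BB
end AdjFac

namespace AdjFac
namespace AA
open MvPolynomial

theorem gen_det_prime (K : Type*) [Field K] (m : ℕ) :
    Prime (Matrix.mvPolynomialX (Fin (m+1)) (Fin (m+1)) K).det := by
  induction m with
  | zero =>
    have : (Matrix.mvPolynomialX (Fin (0+1)) (Fin (0+1)) K).det = X (0,0) := by
      simp [Matrix.mvPolynomialX]
    rw [this]
    exact MvPolynomial.X_prime
  | succ m ih =>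
    set M := Matrix.mvPolynomialX (Fin (m+2)) (Fin (m+2)) K with hM
    let g : Fin (m+2) × Fin (m+2) → MvPolynomial (Fin (m+2) × Fin (m+2)) K :=
      fun p => if p = (0,0) then 0 else X p
    let N : Matrix (Fin (m+2)) (Fin (m+2)) (MvPolynomial (Fin (m+2) × Fin (m+2)) K) :=
      Matrix.of fun i j => g (i, j)
    let s : Fin (m+1) × Fin (m+1) → Fin (m+2) × Fin (m+2) := fun p => (p.1.succ, p.2.succ)
    have hs : Function.Injective s := by
      rintro ⟨a, b⟩ ⟨c, d⟩ h
      simpa [s] using h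
    set a := MvPolynomial.rename s (Matrix.mvPolynomialX (Fin (m+1)) (Fin (m+1)) K).det with ha
    have hap : Prime a := by
      have e1 : a = rename ((↑) : Set.range s → _)
          (renameEquiv K (Equiv.ofInjective s hs) (Matrix.mvPolynomialX (Fin (m+1)) (Fin (m+1)) K).det) := by
        rw [renameEquiv_apply, rename_rename]; rfl
      rw [e1, prime_rename_iff]
      exact (MulEquiv.prime_iff (renameEquiv K (Equiv.ofInjective s hs))).2 ih
    have ha2 : a = (M.submatrix Fin.succ Fin.succ).det := by
      rw [ha, AlgHom.map_det]
      congr 1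
      ext i j : 2
      simp [M, s, Matrix.mvPolynomialX]
    have hdet : M.det = a * X (0,0) + N.det := by
      rw [Matrix.det_succ_row_zero, Matrix.det_succ_row_zero N, Fin.sum_univ_succ]
      conv_rhs => rw [Fin.sum_univ_succ]
      have e : ∀ j : Fin (m+2), N.submatrix Fin.succ j.succAbove = M.submatrix Fin.succ j.succAbove := by
        intro j; ext i l : 2
        simp [N, M, g, Matrix.mvPolynomialX, Prod.ext_iff]
      have e2 : ∀ j : Fin (m+1), N 0 j.succ = M 0 j.succ := by
        intro j
        simp [N, M, g, Matrix.mvPolynomialX, Prod.ext_iff]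
      have e3 : N 0 0 = 0 := by simp [N, g]
      have e4 : M 0 0 = X (0,0) := by simp [M, Matrix.mvPolynomialX]
      simp only [e, e2, e3, e4, ha2, Fin.succAbove_zero]
      rw [Fin.val_zero, pow_zero]
      ring
    have hN : N.det = MvPolynomial.bind₁ g M.det := by
      rw [AlgHom.map_det]
      congr 1
      ext i j : 2
      simp [M, N, Matrix.mvPolynomialX]
    have hNv : ((0 : Fin (m+2)), (0 : Fin (m+2))) ∉ N.det.vars := by
      rw [hN]
      intro h
      have := MvPolynomial.vars_bind₁ g _ h
      rw [Finset.mem_biUnion] at this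
      obtain ⟨p, -, hp⟩ := this
      by_cases hp0 : p = (0,0)
      · simp [g, hp0] at hp
      · simp [g, hp0] at hp
        exact hp0 hp.symm
    have hav : ((0 : Fin (m+2)), (0 : Fin (m+2))) ∉ a.vars := by
      intro h
      have := MvPolynomial.vars_rename _ _ h
      rw [Finset.mem_image] at this
      obtain ⟨p, -, hp⟩ := this
      simp [s] at hp
    have hrel : IsRelPrime a N.det := by
      rw [hap.irreducible.isRelPrime_iff_not_dvd]
      rintro ⟨q, hq⟩
      let σ : Equiv.Perm (Fin (m+2)) := Equiv.swap 0 1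
      let P : Matrix (Fin (m+2)) (Fin (m+2)) K := σ.permMatrix K
      let v : Fin (m+2) × Fin (m+2) → K := fun p => P p.1 p.2
      have h1 : MvPolynomial.eval v N.det = P.det := by
        rw [RingHom.map_det]
        congr 1
        ext i j : 2
        by_cases hij : (i, j) = (0, 0)
        · obtain ⟨rfl, rfl⟩ := Prod.ext_iff.1 hij
          simp [N, g, P, σ]
        · change eval v (if (i, j) = (0, 0) then 0 else X (i, j)) = P i j
          rw [if_neg hij, eval_X]
      have h2 : MvPolynomial.eval v a = 0 := by
        rw [ha2, RingHom.map_det]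
        refine Matrix.det_eq_zero_of_row_eq_zero 0 fun j => ?_
        simp [M, Matrix.mvPolynomialX, v, P, σ]
        try exact (Fin.succ_ne_zero _).symm
      rw [hq, map_mul, h2, zero_mul, Matrix.det_permutation] at h1
      simp [σ] at h1
    rw [hdet]
    exact (MvPolynomial.irreducible_mul_X_add a N.det (0,0) hap.ne_zero hav hNv hrel).prime

end AA
end AdjFac

namespace AdjFac
namespace AA
open MvPolynomial

theorem gen_map {m : ℕ} {R S : Type*} [CommRing R] [CommRing S] (f : R →+* S) :
    (Matrix.mvPolynomialX (Fin m) (Fin m) R).map (MvPolynomial.map f) =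
      Matrix.mvPolynomialX (Fin m) (Fin m) S := by
  ext i j : 2
  simp [Matrix.mvPolynomialX]

theorem gen_det_map {m : ℕ} {R S : Type*} [CommRing R] [CommRing S] (f : R →+* S) :
    MvPolynomial.map f (Matrix.mvPolynomialX (Fin m) (Fin m) R).det =
      (Matrix.mvPolynomialX (Fin m) (Fin m) S).det := by
  rw [← gen_map f, RingHom.map_det]; rfl

/-- Divisors of a power of the generic determinant over a domain. -/
theorem divisor {k : Type*} [CommRing k] [IsDomain k] {n : ℕ} (hn : 0 < n) (N : ℕ)
    (f g : MvPolynomial (Fin n × Fin n) k)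
    (h : f * g = (Matrix.mvPolynomialX (Fin n) (Fin n) k).det ^ N) :
    ∃ (u u' : k) (d d' : ℕ), u * u' = 1 ∧ d + d' = N ∧
      f = C u * (Matrix.mvPolynomialX (Fin n) (Fin n) k).det ^ d ∧
      g = C u' * (Matrix.mvPolynomialX (Fin n) (Fin n) k).det ^ d' := by
  obtain ⟨m, rfl⟩ : ∃ m, n = m + 1 := ⟨n - 1, by omega⟩
  set t := (Matrix.mvPolynomialX (Fin (m+1)) (Fin (m+1)) k).det with ht
  let K := FractionRing k
  let ι : k →+* K := algebraMap k K
  have hι : Function.Injective ι := IsFractionRing.injective k K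
  have hp := gen_det_prime K m
  rw [← gen_det_map ι, ← ht] at hp
  have h1 : MvPolynomial.map ι f ∣ (MvPolynomial.map ι t) ^ N :=
    ⟨MvPolynomial.map ι g, by rw [← map_mul, h, map_pow]⟩
  obtain ⟨d, hd, hass⟩ := (dvd_prime_pow hp N).1 h1
  obtain ⟨w, hw⟩ := hass.symm
  obtain ⟨c, hc, hcw⟩ := MvPolynomial.isUnit_iff_eq_C_of_isReduced.1 w.isUnit
  let v : Fin (m+1) × Fin (m+1) → k := fun p => (1 : Matrix (Fin (m+1)) (Fin (m+1)) k) p.1 p.2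
  have hvt : eval v t = 1 := by
    rw [ht, Matrix.eval_det_mvPolynomialX]
    exact Matrix.det_one
  have hev : ∀ p : MvPolynomial (Fin (m+1) × Fin (m+1)) k,
      eval (fun i => ι (v i)) (MvPolynomial.map ι p) = ι (eval v p) := by
    intro p
    rw [eval_map, eval₂_comp]; rfl
  have hcf : c = ι (eval v f) := by
    rw [← hev, ← hw, map_mul, map_pow, hev, hvt, hcw]
    simp
  have hf : f = C (eval v f) * t ^ d := by
    apply MvPolynomial.map_injective ι hι
    rw [← hw, hcw, hcf, map_mul, map_pow, map_C, mul_comm]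
  have huu : eval v f * eval v g = 1 := by
    rw [← map_mul, h, map_pow, hvt, one_pow]
  have ht0 : t ≠ 0 := Matrix.det_mvPolynomialX_ne_zero _ _
  refine ⟨eval v f, eval v g, d, N - d, huu, by omega, hf, ?_⟩
  have hne : t ^ d ≠ 0 := pow_ne_zero _ ht0
  apply mul_left_cancel₀ hne
  have h2 : C (eval v f) * (t ^ d * g) = t ^ N := by
    rw [← mul_assoc, ← hf, h]
  have h3 : C (eval v g) * C (eval v f) = (1 : MvPolynomial (Fin (m+1) × Fin (m+1)) k) := by
    rw [← map_mul, mul_comm, huu, map_one]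
  calc t ^ d * g = (C (eval v g) * C (eval v f)) * (t ^ d * g) := by rw [h3, one_mul]
    _ = C (eval v g) * t ^ N := by rw [mul_assoc, h2]
    _ = C (eval v g) * t ^ (d + (N - d)) := by rw [Nat.add_sub_cancel' hd]
    _ = _ := by rw [pow_add]; ring

/-- A finitely generated `ℚ`-algebra that is nonzero has a complex point. -/
theorem exists_hom (A : Type*) [CommRing A] [Nontrivial A] [Algebra ℚ A] [Algebra.FiniteType ℚ A] :
    Nonempty (A →+* ℂ) := by
  obtain ⟨M, hM⟩ := Ideal.exists_maximal A
  letI : Field (A ⧸ M) := Ideal.Quotient.field M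
  haveI : Algebra.FiniteType ℚ (A ⧸ M) :=
    Algebra.FiniteType.of_surjective (Ideal.Quotient.mkₐ ℚ M) (Ideal.Quotient.mkₐ_surjective ℚ M)
  haveI : Module.Finite ℚ (A ⧸ M) := finite_of_finite_type_of_isJacobsonRing ℚ (A ⧸ M)
  haveI : Algebra.IsAlgebraic ℚ (A ⧸ M) := inferInstance
  let φ : (A ⧸ M) →ₐ[ℚ] ℂ := IsAlgClosed.lift
  exact ⟨φ.toRingHom.comp (Ideal.Quotient.mk M)⟩

theorem main_k {k : Type*} [CommRing k] [IsDomain k] [CharZero k] {n : ℕ} (hn : 0 < n) (hev : Even n)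
    (Y Z : Matrix (Fin n) (Fin n) (MvPolynomial (Fin n × Fin n) k))
    (hYZ : (Matrix.mvPolynomialX (Fin n) (Fin n) k).adjugate = Y * Z)
    (u u' : k) (hu : u * u' = 1) (d d' : ℕ) (hd : d + d' + 1 = n)
    (hdet : Y.det = MvPolynomial.C u * (Matrix.mvPolynomialX (Fin n) (Fin n) k).det ^ d) :
    d ≤ 1 ∨ d' ≤ 1 := by
  classical
  let K := FractionRing k
  let ι : k →+* K := algebraMap k K
  let S : Finset K := {ι u, ι u'} ∪
    (Finset.univ.biUnion fun p : Fin n × Fin n => (MvPolynomial.map ι (Y p.1 p.2)).coeffs) ∪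
    (Finset.univ.biUnion fun p : Fin n × Fin n => (MvPolynomial.map ι (Z p.1 p.2)).coeffs)
  let A := Algebra.adjoin ℚ (S : Set K)
  haveI : Algebra.FiniteType ℚ A := A.fg_iff_finiteType.1 ⟨S, rfl⟩
  let j : A →+* K := A.val.toRingHom
  have hj : Function.Injective j := Subtype.val_injective
  have hSA : ∀ x ∈ S, x ∈ Set.range j := fun x hx =>
    ⟨⟨x, Algebra.subset_adjoin (by exact_mod_cast hx)⟩, rfl⟩
  obtain ⟨a, ha⟩ := hSA (ι u) (by simp [S])
  obtain ⟨a', ha'⟩ := hSA (ι u') (by simp [S])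
  have hlY : ∀ i l, ∃ q, MvPolynomial.map j q = MvPolynomial.map ι (Y i l) := by
    intro i l
    refine mem_range_map_iff_coeffs_subset.2 fun x hx => hSA x ?_
    refine Finset.mem_union_left _ (Finset.mem_union_right _ ?_)
    exact Finset.mem_biUnion.2 ⟨(i, l), Finset.mem_univ _, by exact_mod_cast hx⟩
  have hlZ : ∀ i l, ∃ q, MvPolynomial.map j q = MvPolynomial.map ι (Z i l) := by
    intro i l
    refine mem_range_map_iff_coeffs_subset.2 fun x hx => hSA x ?_
    refine Finset.mem_union_right _ ?_
    exact Finset.mem_biUnion.2 ⟨(i, l), Finset.mem_univ _, by exact_mod_cast hx⟩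
  choose Y1 hY1 using hlY
  choose Z1 hZ1 using hlZ
  let Y2 : Matrix (Fin n) (Fin n) (MvPolynomial (Fin n × Fin n) A) := Matrix.of Y1
  let Z2 : Matrix (Fin n) (Fin n) (MvPolynomial (Fin n × Fin n) A) := Matrix.of Z1
  have eY : Y2.map (MvPolynomial.map j) = Y.map (MvPolynomial.map ι) := by
    exact Matrix.ext fun i l => hY1 i l
  have eZ : Z2.map (MvPolynomial.map j) = Z.map (MvPolynomial.map ι) := by
    exact Matrix.ext fun i l => hZ1 i l
  have hadj : ∀ {R R' : Type _} [CommRing R] [CommRing R'] (f : R →+* R'),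
      (Matrix.mvPolynomialX (Fin n) (Fin n) R).adjugate.map (MvPolynomial.map f) =
      (Matrix.mvPolynomialX (Fin n) (Fin n) R').adjugate := by
    intro R R' _ _ f
    rw [← gen_map f]
    exact RingHom.map_adjugate (MvPolynomial.map f) _
  have hjm : Function.Injective (MvPolynomial.map j : MvPolynomial (Fin n × Fin n) A →+* _) :=
    MvPolynomial.map_injective j hj
  have hYZ2 : (Matrix.mvPolynomialX (Fin n) (Fin n) A).adjugate = Y2 * Z2 := by
    apply Matrix.map_injective hjm
    beta_reduce
    rw [hadj, Matrix.map_mul, eY, eZ, ← Matrix.map_mul, ← hYZ, hadj]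
  have hdetmap : ∀ {R R' : Type _} [CommRing R] [CommRing R'] (f : R →+* R')
      (M : Matrix (Fin n) (Fin n) R), f M.det = (M.map f).det := fun f M => f.map_det M
  have hdet2 : Y2.det = C a * (Matrix.mvPolynomialX (Fin n) (Fin n) A).det ^ d := by
    apply hjm
    rw [hdetmap, eY, ← hdetmap, hdet, map_mul, map_mul, map_pow, map_pow, gen_det_map, gen_det_map,
      map_C, map_C, ha]
  have haa : a * a' = 1 := by
    apply hj
    rw [map_mul, ha, ha', ← map_mul, hu, map_one, map_one]
  obtain ⟨ψ⟩ := exists_hom A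
  have hgen : (Matrix.of fun i j => MvPolynomial.X (i, j) :
      Matrix (Fin n) (Fin n) (MvPolynomial (Fin n × Fin n) ℂ)) = Matrix.mvPolynomialX (Fin n) (Fin n) ℂ := by
    ext i j : 2; simp [Matrix.mvPolynomialX]
  refine BB.main_C hn hev (Y2.map (MvPolynomial.map ψ)) (Z2.map (MvPolynomial.map ψ)) ?_ (ψ a) ?_ d d' hd ?_
  · rw [hgen, ← Matrix.map_mul, ← hYZ2]
    rw [← gen_map ψ]
    exact (RingHom.map_adjugate (MvPolynomial.map ψ) _).symm
  · intro h
    have := congrArg ψ haa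
    rw [map_mul, h, zero_mul, map_one] at this
    exact zero_ne_one this
  · rw [hgen, ← gen_det_map ψ]
    refine ((MvPolynomial.map ψ).map_det Y2).symm.trans ?_
    rw [hdet2, map_mul, map_pow, map_C]

end AA
end AdjFac

theorem adjugate_generic_factorization_of_even
    (k : Type*) [CommRing k] [IsDomain k] [CharZero k]
    (n : ℕ) (hn : 0 < n) (heven : Even n)
    (X Y Z : Matrix (Fin n) (Fin n) (MvPolynomial (Fin n × Fin n) k))
    (hX : ∀ i j, X i j = MvPolynomial.X (i, j))
    (hYZ : X.adjugate = Y * Z) (hY : ¬ IsUnit Y) (hZ : ¬ IsUnit Z) :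
    Associated Y.det X.det ∨ Associated Y.det (X.det ^ (n - 2)) := by
  have hXg : X = Matrix.mvPolynomialX (Fin n) (Fin n) k := by
    ext i j : 2
    rw [hX]; simp [Matrix.mvPolynomialX]
  have hprod : Y.det * Z.det = (Matrix.mvPolynomialX (Fin n) (Fin n) k).det ^ (n - 1) := by
    rw [← Matrix.det_mul, ← hYZ, Matrix.det_adjugate, hXg, Fintype.card_fin]
  obtain ⟨u, u', d, d', huu, hdd, hf, hg⟩ := AdjFac.AA.divisor hn (n - 1) Y.det Z.det hprod
  have hu : IsUnit (MvPolynomial.C u : MvPolynomial (Fin n × Fin n) k) :=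
    (IsUnit.of_mul_eq_one u' huu).map _
  have hu' : IsUnit (MvPolynomial.C u' : MvPolynomial (Fin n × Fin n) k) :=
    (IsUnit.of_mul_eq_one u (by rw [mul_comm, huu])).map _
  have hd0 : d ≠ 0 := by
    rintro rfl
    rw [pow_zero, mul_one] at hf
    exact hY ((Matrix.isUnit_iff_isUnit_det _).2 (hf ▸ hu))
  have hd0' : d' ≠ 0 := by
    rintro rfl
    rw [pow_zero, mul_one] at hg
    exact hZ ((Matrix.isUnit_iff_isUnit_det _).2 (hg ▸ hu'))
  have hass : Associated Y.det (X.det ^ d) := by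
    rw [hXg, hf]
    exact (associated_isUnit_mul_left_iff hu).2 (Associated.refl _)
  rcases AdjFac.AA.main_k hn heven Y Z (by rw [← hXg, hYZ]) u u' huu d d' (by omega) hf with h | h
  · left
    have : d = 1 := by omega
    simpa [this] using hass
  · right
    have : d = n - 2 := by omega
    rwa [← this]
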